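/- Let N ≥ 2 be even, ε ∈ {−1,1}^N, and p_1,…,p_N ∈ (1,∞) with p_i > 2 for every odd i, and suppose 1/p_i + max_{j ∈ {i−1, i+1} ∩ {1,…,N}} 2/p_j < 3/2 for every odd i. Then the biparameter operator C_N^ε ⊗ C_N^ε, defined for Schwartz functions f_1,…,f_N on ℝ² by C_N^ε ⊗ C_N^ε(f_1,…,f_N)(z_1,z_2) = ∫_{x_1<⋯<x_N} ∫_{y_1<⋯<y_N} ∏_{i=1}^N f̂_i(x_i,y_i) · e^{2πi(z_1 Σ_i ε_i x_i + z_2 Σ_i ε_i y_i)} dx⃗ dy⃗, satisfies: there is a constant C such that ‖C_N^ε ⊗ C_N^ε(f_1,…,f_N)‖_{L^Q(ℝ²)} ≤ C ∏_{i odd} ‖f̂_i‖_{L^{p_i′}(ℝ²)} ∏_{i even} ‖f_i‖_{L^{p_i}(ℝ²)} for all Schwartz f_1,…,f_N on ℝ², where Q = 1/(Σ_{i=1}^N 1/p_i). -/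

import Mathlib

open MeasureTheory Complex
open scoped Real ENNReal

/-- The two-dimensional Fourier transform on `ℝ²`. -/
noncomputable def FT2 (f : ℝ × ℝ → ℂ) (ξ : ℝ × ℝ) : ℂ :=
  ∫ x : ℝ × ℝ, f x * Complex.exp (-(2 * π * Complex.I * (x.1 * ξ.1 + x.2 * ξ.2)))

/-- The biparameter tensor product operator `C_N^ε ⊗ C_N^ε` on `ℝ²`. -/
noncomputable def CopT (N : ℕ) (ε : Fin N → ℝ) (f : Fin N → ℝ × ℝ → ℂ) (z : ℝ × ℝ) : ℂ :=
  ∫ t in {t : (Fin N → ℝ) × (Fin N → ℝ) | StrictMono t.1 ∧ StrictMono t.2},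
    (∏ i, FT2 (f i) (t.1 i, t.2 i)) *
      Complex.exp (2 * π * Complex.I *
        (z.1 * ∑ i, ε i * t.1 i + z.2 * ∑ i, ε i * t.2 i))

section Characters

open Finset ComplexConjugate

/-- The character of frequency `k` on `ZMod L`. -/
noncomputable def chi (L : ℕ) [NeZero L] (k : ℤ) (x : ZMod L) : ℂ :=
  ZMod.stdAddChar ((k : ZMod L) * x)

variable {L : ℕ} [NeZero L]

theorem chi_add (k l : ℤ) (x : ZMod L) : chi L (k + l) x = chi L k x * chi L l x := by
  simp [chi, add_mul, AddChar.map_add_eq_mul]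

theorem chi_add_right (k : ℤ) (x y : ZMod L) : chi L k (x + y) = chi L k x * chi L k y := by
  simp [chi, mul_add, AddChar.map_add_eq_mul]

@[simp] theorem chi_zero (x : ZMod L) : chi L 0 x = 1 := by simp [chi]

theorem chi_neg (k : ℤ) (x : ZMod L) : chi L (-k) x = conj (chi L k x) := by
  simp [chi, AddChar.map_neg_eq_conj]

theorem chi_neg_right (k : ℤ) (x : ZMod L) : chi L k (-x) = conj (chi L k x) := by
  simp [chi, AddChar.map_neg_eq_conj]

@[simp] theorem norm_chi (k : ℤ) (x : ZMod L) : ‖chi L k x‖ = 1 := by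
  simp [chi]

theorem chi_neg_mul (k : ℤ) (x : ZMod L) : chi L (-k) x * chi L k x = 1 := by
  rw [← chi_add]; simp

theorem sum_chi (k : ℤ) : ∑ x : ZMod L, chi L k x = if (k : ZMod L) = 0 then (L : ℂ) else 0 := by
  have := AddChar.sum_mulShift (k : ZMod L) (ZMod.isPrimitive_stdAddChar L)
  simp only [ZMod.card] at this
  push_cast at this
  rw [← this]
  refine sum_congr rfl fun x _ => ?_
  rw [chi, mul_comm]

/-- Discrete Fourier coefficient on `ZMod L`. -/
noncomputable def hat (f : ZMod L → ℂ) (k : ℤ) : ℂ :=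
  (L : ℂ)⁻¹ * ∑ x, f x * chi L (-k) x

theorem hat_add (f g : ZMod L → ℂ) (k : ℤ) : hat (f + g) k = hat f k + hat g k := by
  simp [hat, add_mul, sum_add_distrib, mul_add]

theorem hat_smul (c : ℂ) (f : ZMod L → ℂ) (k : ℤ) : hat (c • f) k = c * hat f k := by
  simp only [hat, Pi.smul_apply, smul_eq_mul, mul_sum]
  exact sum_congr rfl fun x _ => by ring

theorem hat_chi (k l : ℤ) : hat (chi L k) l = if (k : ZMod L) = l then 1 else 0 := by
  have hL : (L : ℂ) ≠ 0 := Nat.cast_ne_zero.2 (NeZero.ne L)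
  simp only [hat, ← chi_add, sum_chi]
  have : ((k + -l : ℤ) : ZMod L) = 0 ↔ (k : ZMod L) = l := by
    push_cast; rw [← sub_eq_add_neg, sub_eq_zero]
  simp only [this]
  split_ifs <;> simp [hL]

/-- Linear version of the Fourier coefficient. -/
noncomputable def hatₗ (L : ℕ) [NeZero L] (k : ℤ) : (ZMod L → ℂ) →ₗ[ℂ] ℂ where
  toFun f := hat f k
  map_add' f g := hat_add f g k
  map_smul' c f := hat_smul c f k

theorem hat_sum {ι : Type*} (s : Finset ι) (f : ι → ZMod L → ℂ) (k : ℤ) :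
    hat (∑ i ∈ s, f i) k = ∑ i ∈ s, hat (f i) k :=
  map_sum (hatₗ L k) f s

theorem hat_sub (f g : ZMod L → ℂ) (k : ℤ) : hat (f - g) k = hat f k - hat g k :=
  map_sub (hatₗ L k) f g

theorem hat_conj (f : ZMod L → ℂ) (k : ℤ) : hat (fun x => conj (f x)) k = conj (hat f (-k)) := by
  simp [hat, map_sum, chi_neg]

/-- The Fourier projection onto a finite set of frequencies. -/
noncomputable def proj (E : Finset ℤ) (f : ZMod L → ℂ) : ZMod L → ℂ :=
  ∑ k ∈ E, hat f k • chi L k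

theorem proj_apply (E : Finset ℤ) (f : ZMod L → ℂ) (x : ZMod L) :
    proj E f x = ∑ k ∈ E, hat f k * chi L k x := by
  simp [proj]

theorem proj_add (E : Finset ℤ) (f g : ZMod L → ℂ) : proj E (f + g) = proj E f + proj E g := by
  simp [proj, hat_add, add_smul, sum_add_distrib]

theorem proj_sub (E : Finset ℤ) (f g : ZMod L → ℂ) : proj E (f - g) = proj E f - proj E g := by
  simp [proj, hat_sub, sub_smul, sum_sub_distrib]

@[simp] theorem proj_empty (f : ZMod L → ℂ) : proj ∅ f = 0 := by simp [proj]

theorem proj_union {E F : Finset ℤ} (h : Disjoint E F) (f : ZMod L → ℂ) :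
    proj (E ∪ F) f = proj E f + proj F f := by
  simp [proj, sum_union h]

theorem proj_congr {E : Finset ℤ} {f g : ZMod L → ℂ} (h : ∀ k ∈ E, hat f k = hat g k) :
    proj E f = proj E g := by
  unfold proj
  exact sum_congr rfl fun k hk => by rw [h k hk]

/-- Functions with spectrum in `s`. -/
noncomputable def Sp (L : ℕ) [NeZero L] (s : Set ℤ) : Submodule ℂ (ZMod L → ℂ) :=
  Submodule.span ℂ (chi L '' s)

theorem Sp_mono {s t : Set ℤ} (h : s ⊆ t) : Sp L s ≤ Sp L t :=
  Submodule.span_mono (Set.image_mono h)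

theorem chi_mem_Sp {s : Set ℤ} {k : ℤ} (h : k ∈ s) : chi L k ∈ Sp L s :=
  Submodule.subset_span ⟨k, h, rfl⟩

theorem proj_mem_Sp {E : Finset ℤ} {s : Set ℤ} (h : ↑E ⊆ s) (f : ZMod L → ℂ) :
    proj E f ∈ Sp L s :=
  Submodule.sum_mem _ fun _ hk => Submodule.smul_mem _ _ (chi_mem_Sp (h hk))

theorem mul_mem_Sp {s t u : Set ℤ} {f g : ZMod L → ℂ} (hf : f ∈ Sp L s) (hg : g ∈ Sp L t)
    (h : ∀ a ∈ s, ∀ b ∈ t, a + b ∈ u) : f * g ∈ Sp L u := by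
  have h1 := Submodule.mul_mem_mul hf hg
  rw [Sp, Sp, Submodule.span_mul_span] at h1
  refine Submodule.span_le.2 ?_ h1
  rintro _ ⟨_, ⟨a, ha, rfl⟩, _, ⟨b, hb, rfl⟩, rfl⟩
  have : chi L a * chi L b = chi L (a + b) := by ext x; simp [chi_add]
  simp only [this]
  exact chi_mem_Sp (h a ha b hb)

theorem conj_mem_Sp {s t : Set ℤ} {f : ZMod L → ℂ} (hf : f ∈ Sp L s) (h : ∀ a ∈ s, -a ∈ t) :
    (fun x => conj (f x)) ∈ Sp L t := by
  induction hf using Submodule.span_induction with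
  | mem g hg =>
    obtain ⟨a, ha, rfl⟩ := hg
    have : (fun x => conj (chi L a x)) = chi L (-a) := by ext x; rw [chi_neg]
    rw [this]; exact chi_mem_Sp (h a ha)
  | zero => simp only [Pi.zero_apply, map_zero]; exact Submodule.zero_mem _
  | add f g _ _ hf hg =>
    simp only [Pi.add_apply, map_add]; exact Submodule.add_mem _ hf hg
  | smul c f _ hf =>
    simp only [Pi.smul_apply, smul_eq_mul, map_mul]; exact Submodule.smul_mem _ _ hf

theorem hat_eq_zero {s : Set ℤ} {f : ZMod L → ℂ} (hf : f ∈ Sp L s) {k : ℤ}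
    (h : ∀ a ∈ s, (a : ZMod L) ≠ k) : hat f k = 0 := by
  induction hf using Submodule.span_induction with
  | mem g hg =>
    obtain ⟨a, ha, rfl⟩ := hg
    rw [hat_chi, if_neg (h a ha)]
  | zero => simp [hat]
  | add f g _ _ hf hg => rw [hat_add, hf, hg, add_zero]
  | smul c f _ hf => rw [hat_smul, hf, mul_zero]

theorem intCast_inj_of_lt {L : ℕ} {a b : ℤ} (h : |a - b| < L) (hab : (a : ZMod L) = b) : a = b := by
  have h1 := (ZMod.intCast_eq_intCast_iff_dvd_sub a b L).1 hab
  have h2 := Int.eq_zero_of_abs_lt_dvd h1 (by rwa [abs_sub_comm])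
  omega

/-- On a set of frequencies with distinct residues. -/
def DR (L : ℕ) (E : Set ℤ) : Prop := Set.InjOn (fun k : ℤ => (k : ZMod L)) E

theorem DR.mono {L : ℕ} {E F : Set ℤ} (hF : DR L F) (h : E ⊆ F) : DR L E := Set.InjOn.mono h hF

theorem DR_Icc {L : ℕ} {a b : ℤ} (h : b - a < L) : DR L (Set.Icc a b) := by
  intro x hx y hy hxy
  refine intCast_inj_of_lt ?_ hxy
  rw [abs_lt]; constructor <;> (simp only [Set.mem_Icc] at hx hy; omega)

theorem proj_eq_self {E : Finset ℤ} {s : Set ℤ} {f : ZMod L → ℂ} (hE : DR L E) (hs : s ⊆ E)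
    (hf : f ∈ Sp L s) : proj E f = f := by
  induction hf using Submodule.span_induction with
  | mem g hg =>
    obtain ⟨a, ha, rfl⟩ := hg
    unfold proj
    rw [sum_eq_single a]
    · simp [hat_chi]
    · intro b hb hba
      rw [hat_chi, if_neg, zero_smul]
      exact fun h => hba (hE hb (hs ha) h.symm)
    · exact fun h => absurd (hs ha) h
  | zero => simp [proj, hat]
  | add f g _ _ hf hg => rw [proj_add, hf, hg]
  | smul c f _ hf =>
    conv_rhs => rw [← hf]
    simp [proj, hat_smul, mul_smul, smul_sum]

theorem proj_eq_zero {E : Finset ℤ} {s : Set ℤ} {f : ZMod L → ℂ}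
    (h : ∀ k ∈ E, ∀ a ∈ s, (a : ZMod L) ≠ k) (hf : f ∈ Sp L s) : proj E f = 0 := by
  unfold proj
  exact sum_eq_zero fun k hk => by rw [hat_eq_zero hf (h k hk), zero_smul]

/-- Parseval identity for trigonometric polynomials. -/
theorem parseval {ι : Type*} {s : Finset ι} {κ : ι → ℤ}
    (hs : Set.InjOn (fun i => (κ i : ZMod L)) s) (c : ι → ℂ) :
    ∑ x : ZMod L, ‖∑ k ∈ s, c k * chi L (κ k) x‖ ^ 2 = L * ∑ k ∈ s, ‖c k‖ ^ 2 := by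
  have key : ∑ x : ZMod L, (∑ k ∈ s, c k * chi L (κ k) x) * conj (∑ k ∈ s, c k * chi L (κ k) x) =
      (L : ℂ) * ∑ k ∈ s, c k * conj (c k) := by
    simp only [map_sum, map_mul, ← chi_neg, sum_mul_sum]
    rw [sum_comm, mul_sum]
    refine sum_congr rfl fun k hk => ?_
    rw [sum_comm, sum_eq_single k]
    · have : ∀ x : ZMod L, c k * chi L (κ k) x * (conj (c k) * chi L (-κ k) x) =
          c k * conj (c k) := by
        intro x
        have := chi_neg_mul (κ k) x
        linear_combination (c k * conj (c k)) * this
      simp [this]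
    · intro l hl hlk
      have : ∀ x : ZMod L, c k * chi L (κ k) x * (conj (c l) * chi L (-κ l) x) =
          c k * conj (c l) * chi L (κ k + -κ l) x := by
        intro x; rw [chi_add]; ring
      simp only [this, ← mul_sum, sum_chi]
      rw [if_neg, mul_zero]
      intro h
      push_cast at h
      rw [← sub_eq_add_neg, sub_eq_zero] at h
      exact hlk (hs hl hk h.symm)
    · exact fun h => absurd hk h
  simp only [Complex.mul_conj, Complex.normSq_eq_norm_sq] at key
  exact_mod_cast key

theorem sum_norm_proj_sq {E : Finset ℤ} (hE : DR L E) (f : ZMod L → ℂ) :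
    ∑ x, ‖proj E f x‖ ^ 2 = L * ∑ k ∈ E, ‖hat f k‖ ^ 2 := by
  simp only [proj_apply]; exact parseval hE _

theorem bessel_coeff {E : Finset ℤ} (hE : DR L E) (f : ZMod L → ℂ) :
    L * ∑ k ∈ E, ‖hat f k‖ ^ 2 ≤ ∑ x, ‖f x‖ ^ 2 := by
  have hL : (L : ℂ) ≠ 0 := Nat.cast_ne_zero.2 (NeZero.ne L)
  have h1 : ∑ x, proj E f x * conj (f x) = (L : ℂ) * ∑ k ∈ E, hat f k * conj (hat f k) := by
    simp only [proj_apply, sum_mul]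
    rw [sum_comm, mul_sum]
    refine sum_congr rfl fun k _ => ?_
    have : conj (hat f k) = (L : ℂ)⁻¹ * ∑ x, conj (f x) * chi L k x := by
      simp [hat, map_sum, chi_neg]
    rw [this, ← mul_assoc, ← mul_assoc, mul_comm (L : ℂ), mul_assoc (hat f k),
      mul_inv_cancel₀ hL, mul_one, mul_sum]
    exact sum_congr rfl fun x _ => by ring
  simp only [Complex.mul_conj, Complex.normSq_eq_norm_sq] at h1
  set S : ℝ := L * ∑ k ∈ E, ‖hat f k‖ ^ 2
  have h2 : ∑ x, proj E f x * conj (f x) = (S : ℂ) := by rw [h1]; simp [S]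
  have h3 : S ≤ ∑ x, ‖proj E f x‖ * ‖f x‖ := by
    calc S ≤ ‖(S : ℂ)‖ := by rw [Complex.norm_real]; exact le_abs_self S
      _ = ‖∑ x, proj E f x * conj (f x)‖ := by rw [h2]
      _ ≤ ∑ x, ‖proj E f x * conj (f x)‖ := norm_sum_le _ _
      _ = _ := by simp
  have h4 := sum_norm_proj_sq hE f
  have h5 : ∑ x, ‖proj E f x‖ * ‖f x‖ ≤ ∑ x, (‖proj E f x‖ ^ 2 / 2 + ‖f x‖ ^ 2 / 2) :=
    sum_le_sum fun x _ => by nlinarith [sq_nonneg (‖proj E f x‖ - ‖f x‖)]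
  rw [sum_add_distrib, ← sum_div, ← sum_div, h4] at h5
  change S ≤ _
  change _ ≤ S / 2 + _ at h5
  linarith

theorem bessel_family {ι : Type*} {s : Finset ι} {E : ι → Finset ℤ} {F : Set ℤ} (hF : DR L F)
    (hE : ∀ i ∈ s, ↑(E i) ⊆ F) (hd : (s : Set ι).PairwiseDisjoint E) (f : ZMod L → ℂ) :
    ∑ i ∈ s, ∑ x, ‖proj (E i) f x‖ ^ 2 ≤ ∑ x, ‖f x‖ ^ 2 := by
  classical
  have h : ∀ i ∈ s, ∑ x, ‖proj (E i) f x‖ ^ 2 = L * ∑ k ∈ E i, ‖hat f k‖ ^ 2 :=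
    fun i hi => sum_norm_proj_sq (hF.mono (hE i hi)) f
  rw [sum_congr rfl h, ← mul_sum, ← sum_biUnion hd]
  refine bessel_coeff (hF.mono ?_) f
  intro k hk
  simp only [coe_biUnion, Set.mem_iUnion] at hk
  obtain ⟨i, hi, hk⟩ := hk
  exact hE i hi hk

theorem bessel_proj {E : Finset ℤ} (hE : DR L E) (f : ZMod L → ℂ) :
    ∑ x, ‖proj E f x‖ ^ 2 ≤ ∑ x, ‖f x‖ ^ 2 := by
  rw [sum_norm_proj_sq hE]; exact bessel_coeff hE f

/-- Projection of a function with spectrum in `[-D, D]` onto frequencies `≥ a`. -/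
noncomputable def ph (D : ℕ) (a : ℤ) (f : ZMod L → ℂ) : ZMod L → ℂ :=
  proj ((Icc (-(D : ℤ)) D).filter (a ≤ ·)) f

end Characters

section Cotlar

open Finset ComplexConjugate

theorem norm_sq_sum_mul_le {ι : Type*} (s : Finset ι) (f g : ι → ℂ) :
    ‖∑ i ∈ s, f i * g i‖ ^ 2 ≤ (∑ i ∈ s, ‖f i‖ ^ 2) * ∑ i ∈ s, ‖g i‖ ^ 2 := by
  have h1 : ‖∑ i ∈ s, f i * g i‖ ≤ ∑ i ∈ s, ‖f i‖ * ‖g i‖ :=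
    (norm_sum_le _ _).trans_eq (by simp)
  exact (pow_le_pow_left₀ (norm_nonneg _) h1 2).trans (sum_mul_sq_le_sq_mul_sq _ _ _)

variable {L : ℕ} [NeZero L]

theorem norm_le_of_half_projections {D : ℕ} (hD : 2 * D < L) {s W : ZMod L → ℂ}
    (hs : s ∈ Sp L (Set.Icc (-(D : ℤ)) D)) (hreal : ∀ x, conj (s x) = s x)
    (hW : W - s ∈ Sp L (Set.Icc (-(D : ℤ)) (-1))) (x : ZMod L) :
    ‖s x‖ ≤ ‖ph D 0 W x‖ + ‖ph D 1 W x‖ := by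
  have hDR : DR L (Set.Icc (-(D : ℤ)) D) := DR_Icc (by omega)
  have hph : ∀ a : ℤ, 0 ≤ a → ph D a W = ph D a s := by
    intro a ha
    rw [ph, ph, ← sub_eq_zero, ← proj_sub]
    refine proj_eq_zero (s := Set.Icc (-(D : ℤ)) (-1)) ?_ hW
    intro k hk b hb hbk
    simp only [mem_filter, mem_Icc, Set.mem_Icc] at hk hb
    have := hDR (x₁ := b) (x₂ := k) ⟨hb.1, by omega⟩ ⟨hk.1.1, hk.1.2⟩ hbk
    omega
  have hsplit : s = ph D 0 s + fun x => conj (ph D 1 s x) := by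
    have h1 : s = proj (Icc (-(D : ℤ)) D) s :=
      (proj_eq_self (by simpa using hDR) (by simp) hs).symm
    ext x
    conv_lhs => rw [h1]
    simp only [ph, proj_apply, Pi.add_apply, map_sum]
    rw [← sum_filter_add_sum_filter_not (Icc (-(D : ℤ)) D) (fun k => (0 : ℤ) ≤ k)]
    congr 1
    refine sum_nbij' (fun k => -k) (fun k => -k) ?_ ?_ (by simp) (by simp) ?_
    · intro k hk; simp only [mem_filter, mem_Icc] at hk ⊢; omega
    · intro k hk; simp only [mem_filter, mem_Icc] at hk ⊢; omega
    · intro k _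
      rw [map_mul, ← chi_neg, neg_neg, ← hat_conj]
      simp only [hreal]
  have h2 : s x = ph D 0 W x + conj (ph D 1 W x) := by
    rw [hph 0 le_rfl, hph 1 zero_le_one]
    exact congrFun hsplit x
  rw [h2]
  exact (norm_add_le _ _).trans (by simp)

/-- Vector-valued boundedness of half-line projections in `L^{2 k}`, for `k` a power of two. -/
theorem cotlar (j : ℕ) : ∃ C : ℝ, 0 < C ∧ ∀ (L : ℕ) [NeZero L] (D : ℕ), 2 ^ (j + 1) * D < L →
    ∀ (ι : Type) [Fintype ι] (a : ι → ℤ) (f : ι → ZMod L → ℂ),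
    (∀ i, f i ∈ Sp L (Set.Icc (-(D : ℤ)) D)) →
    ∑ x, (∑ i, ‖ph D (a i) (f i) x‖ ^ 2) ^ (2 ^ j) ≤
      C * ∑ x, (∑ i, ‖f i x‖ ^ 2) ^ (2 ^ j) := by
  induction j with
  | zero =>
    refine ⟨1, one_pos, fun L _ D hD ι _ a f hf => ?_⟩
    simp only [pow_zero, pow_one, one_mul]
    rw [sum_comm, sum_comm (s := univ (α := ZMod L))]
    refine sum_le_sum fun i _ => bessel_proj ?_ _
    refine DR.mono (DR_Icc (L := L) (a := -(D : ℤ)) (b := D) (by omega)) ?_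
    intro k hk
    simp only [coe_filter, mem_Icc, Set.mem_ofPred_eq] at hk
    exact hk.1
  | succ j ih =>
    obtain ⟨C, hC, ih⟩ := ih
    refine ⟨(4 ^ (2 ^ j) * C) ^ 2, by positivity, fun L _ D hD ι _ a f hf => ?_⟩
    set k := 2 ^ j with hk
    have hk2 : 2 ^ (j + 1) = k * 2 := by rw [pow_succ]
    have hD1 : 2 ^ (j + 1) * (2 * D) < L := by rw [← mul_assoc, ← pow_succ]; exact hD
    have hkpos : 0 < k := by positivity
    have hD2 : 2 * (2 * D) < L := by
      refine lt_of_le_of_lt ?_ hD1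
      rw [hk2]; nlinarith
    have hDR : DR L (Set.Icc (-(D : ℤ)) D) := DR_Icc (by omega)
    set u : ι → ZMod L → ℂ := fun i => ph D (a i) (f i) with hu
    set s : ZMod L → ℂ := ∑ i, u i * (fun x => conj (u i x)) with hs
    set W : ZMod L → ℂ := ∑ i, f i * (fun x => conj (u i x)) with hW
    have husp : ∀ i, u i ∈ Sp L {l : ℤ | -(D : ℤ) ≤ l ∧ l ≤ D ∧ a i ≤ l} := by
      intro i
      refine proj_mem_Sp ?_ _
      intro l hl
      simp only [coe_filter, mem_Icc, Set.mem_ofPred_eq] at hl ⊢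
      exact ⟨hl.1.1, hl.1.2, hl.2⟩
    have hfu : ∀ i, f i - u i ∈ Sp L {l : ℤ | -(D : ℤ) ≤ l ∧ l ≤ D ∧ l < a i} := by
      intro i
      have h1 : f i = proj (Icc (-(D : ℤ)) D) (f i) :=
        (proj_eq_self (by simpa using hDR) (by simp) (hf i)).symm
      have h2 : f i - u i = proj ((Icc (-(D : ℤ)) D).filter (fun l => ¬ a i ≤ l)) (f i) := by
        conv_lhs => rw [h1]
        rw [sub_eq_iff_eq_add, hu]
        simp only [ph]
        rw [← proj_union (disjoint_filter_filter_not _ _ _).symm, union_comm,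
          filter_union_filter_not_eq, ← h1]
      rw [h2]
      refine proj_mem_Sp ?_ _
      intro l hl
      simp only [coe_filter, mem_Icc, Set.mem_ofPred_eq, not_le] at hl ⊢
      exact ⟨hl.1.1, hl.1.2, hl.2⟩
    have husp' : ∀ i, (fun x => conj (u i x)) ∈
        Sp L {l : ℤ | -(D : ℤ) ≤ l ∧ l ≤ D ∧ a i ≤ -l} := fun i =>
      conj_mem_Sp (husp i) (by rintro l ⟨h1, h2, h3⟩; refine ⟨?_, ?_, ?_⟩ <;> omega)
    have hsS : s ∈ Sp L (Set.Icc (-((2 * D : ℕ) : ℤ)) (2 * D : ℕ)) := by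
      refine Submodule.sum_mem _ fun i _ => mul_mem_Sp (husp i) (husp' i) ?_
      rintro x ⟨h1, h2, h3⟩ y ⟨h4, h5, h6⟩
      constructor <;> (push_cast; omega)
    have hWs : W - s ∈ Sp L (Set.Icc (-((2 * D : ℕ) : ℤ)) (-1)) := by
      have : W - s = ∑ i, (f i - u i) * (fun x => conj (u i x)) := by
        rw [hW, hs, ← sum_sub_distrib]
        exact sum_congr rfl fun i _ => by rw [sub_mul]
      rw [this]
      refine Submodule.sum_mem _ fun i _ => mul_mem_Sp (hfu i) (husp' i) ?_
      rintro x ⟨h1, h2, h3⟩ y ⟨h4, h5, h6⟩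
      constructor <;> (push_cast; omega)
    have hWS : W ∈ Sp L (Set.Icc (-((2 * D : ℕ) : ℤ)) (2 * D : ℕ)) := by
      have : W = (W - s) + s := by abel
      rw [this]
      refine Submodule.add_mem _ (Sp_mono ?_ hWs) hsS
      exact Set.Icc_subset_Icc_right (by push_cast; omega)
    set S : ZMod L → ℝ := fun x => ∑ i, ‖u i x‖ ^ 2 with hSdef
    set F : ZMod L → ℝ := fun x => ∑ i, ‖f i x‖ ^ 2 with hFdef
    have hS0 : ∀ x, 0 ≤ S x := fun x => by positivity
    have hF0 : ∀ x, 0 ≤ F x := fun x => by positivity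
    have hsx : ∀ x, s x = (S x : ℂ) := by
      intro x
      simp [hs, hSdef, Complex.mul_conj, Complex.normSq_eq_norm_sq]
    have hWx : ∀ x, ‖W x‖ ^ 2 ≤ F x * S x := by
      intro x
      have := norm_sq_sum_mul_le univ (fun i => f i x) (fun i => conj (u i x))
      simpa [hW, hFdef, hSdef] using this
    have hpt : ∀ x, S x ≤ ‖ph (2 * D) 0 W x‖ + ‖ph (2 * D) 1 W x‖ := by
      intro x
      have := norm_le_of_half_projections hD2 hsS (fun x => by rw [hsx, Complex.conj_ofReal]) hWs x
      rwa [hsx, Complex.norm_real, Real.norm_of_nonneg (hS0 x)] at this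
    have hih : ∀ b : ℤ, ∑ x, ‖ph (2 * D) b W x‖ ^ (2 * k) ≤ C * ∑ x, ‖W x‖ ^ (2 * k) := by
      intro b
      have := ih L (2 * D) hD1 Unit (fun _ => b) (fun _ => W) (fun _ => hWS)
      simpa [← pow_mul] using this
    set X := ∑ x, S x ^ (2 * k)
    have hX0 : 0 ≤ X := sum_nonneg fun x _ => pow_nonneg (hS0 x) _
    have h4 : (2 : ℝ) ^ (2 * k) = 4 ^ k := by rw [pow_mul]; norm_num
    have h1 : X ≤ 4 ^ k * C * ∑ x, ‖W x‖ ^ (2 * k) := by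
      have : X ≤ ∑ x, 2 ^ (2 * k - 1) * (‖ph (2 * D) 0 W x‖ ^ (2 * k) +
          ‖ph (2 * D) 1 W x‖ ^ (2 * k)) := by
        refine sum_le_sum fun x _ => ?_
        exact (pow_le_pow_left₀ (hS0 x) (hpt x) _).trans
          (add_pow_le (norm_nonneg _) (norm_nonneg _) _)
      rw [← mul_sum, sum_add_distrib] at this
      have h2 : (4 : ℝ) ^ k = 2 ^ (2 * k - 1) * 2 := by
        rw [← pow_succ, ← h4]; congr 1; omega
      rw [h2]
      have h3 := hih 0
      have h5 := hih 1
      have : (0 : ℝ) < 2 ^ (2 * k - 1) := by positivity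
      nlinarith
    have h2 : ∑ x, ‖W x‖ ^ (2 * k) ≤ ∑ x, F x ^ k * S x ^ k := by
      refine sum_le_sum fun x _ => ?_
      rw [pow_mul, ← mul_pow]
      exact pow_le_pow_left₀ (by positivity) (hWx x) _
    have h3 : (∑ x, F x ^ k * S x ^ k) ^ 2 ≤ (∑ x, F x ^ (2 * k)) * X := by
      have := sum_mul_sq_le_sq_mul_sq univ (fun x => F x ^ k) (fun x => S x ^ k)
      simp only [← pow_mul] at this
      rw [mul_comm k 2] at this
      exact this
    have h5 : X ^ 2 ≤ (4 ^ k * C) ^ 2 * ((∑ x, F x ^ (2 * k)) * X) := by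
      have h6 : X ≤ 4 ^ k * C * ∑ x, F x ^ k * S x ^ k :=
        h1.trans (mul_le_mul_of_nonneg_left h2 (by positivity))
      calc X ^ 2 ≤ (4 ^ k * C * ∑ x, F x ^ k * S x ^ k) ^ 2 := pow_le_pow_left₀ hX0 h6 2
        _ = (4 ^ k * C) ^ 2 * (∑ x, F x ^ k * S x ^ k) ^ 2 := by ring
        _ ≤ _ := mul_le_mul_of_nonneg_left h3 (by positivity)
    have h6 : 0 ≤ ∑ x, F x ^ (2 * k) := sum_nonneg fun x _ => pow_nonneg (hF0 x) _
    have h7 : X ≤ (4 ^ k * C) ^ 2 * ∑ x, F x ^ (2 * k) := by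
      rcases hX0.eq_or_lt with h | h
      · rw [← h]; positivity
      · nlinarith
    rw [hk2, mul_comm k 2]
    exact h7

end Cotlar

section Smooth

open Finset ComplexConjugate

variable {L : ℕ} [NeZero L]

/-- Normalized convolution on `ZMod L`. -/
noncomputable def conv (c g : ZMod L → ℂ) : ZMod L → ℂ :=
  fun x => (L : ℂ)⁻¹ * ∑ y, c y * g (x - y)

theorem conv_chi (c : ZMod L → ℂ) (k : ℤ) : conv c (chi L k) = hat c k • chi L k := by
  ext x
  simp only [conv, hat, Pi.smul_apply, smul_eq_mul, sub_eq_add_neg, chi_add_right, chi_neg_right]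
  rw [mul_assoc, sum_mul]
  congr 1
  exact sum_congr rfl fun y _ => by rw [chi_neg]; ring

theorem conv_add (c f g : ZMod L → ℂ) : conv c (f + g) = conv c f + conv c g := by
  ext x; simp [conv, mul_add, sum_add_distrib]

theorem conv_smul (c : ZMod L → ℂ) (a : ℂ) (f : ZMod L → ℂ) : conv c (a • f) = a • conv c f := by
  ext x
  simp only [conv, Pi.smul_apply, smul_eq_mul, mul_sum]
  exact sum_congr rfl fun y _ => by ring

theorem conv_mem_Sp {s : Set ℤ} {g : ZMod L → ℂ} (hg : g ∈ Sp L s) (c : ZMod L → ℂ) :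
    conv c g ∈ Sp L s := by
  induction hg using Submodule.span_induction with
  | mem g hg =>
    obtain ⟨a, ha, rfl⟩ := hg
    rw [conv_chi]; exact Submodule.smul_mem _ _ (chi_mem_Sp ha)
  | zero =>
    have : conv c 0 = 0 := by ext x; simp [conv]
    rw [this]; exact Submodule.zero_mem _
  | add f g _ _ hf hg => rw [conv_add]; exact Submodule.add_mem _ hf hg
  | smul a f _ hf => rw [conv_smul]; exact Submodule.smul_mem _ _ hf

theorem hat_conv (c g : ZMod L → ℂ) (k : ℤ) : hat (conv c g) k = hat c k * hat g k := by
  simp only [hat, conv]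
  rw [mul_mul_mul_comm, mul_assoc, sum_mul_sum]
  congr 1
  simp only [mul_assoc, sum_mul, mul_sum]
  rw [sum_comm]
  refine sum_congr rfl fun y _ => ?_
  rw [← Equiv.sum_comp (Equiv.addLeft y)]
  refine sum_congr rfl fun x _ => ?_
  simp only [Equiv.coe_addLeft, add_sub_cancel_left, chi_add_right]
  ring

/-- Geometric sum of characters. -/
noncomputable def geo (L : ℕ) [NeZero L] (l : ℕ) (x : ZMod L) : ℂ :=
  ∑ k ∈ range l, chi L k x

/-- De la Vallée-Poussin kernel modulated to frequency `q * l`. -/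
noncomputable def vp (L : ℕ) [NeZero L] (l : ℕ) (q : ℤ) (x : ZMod L) : ℂ :=
  (l : ℂ)⁻¹ * (geo L (3 * l) x * conj (geo L l x)) * chi L (q * l) x

/-- The positive majorant of `vp`. -/
noncomputable def vpW (L : ℕ) [NeZero L] (l : ℕ) (x : ZMod L) : ℝ :=
  3 * (l : ℝ)⁻¹ * ‖geo L l x‖ ^ 2

theorem vpW_nonneg (l : ℕ) (x : ZMod L) : 0 ≤ vpW L l x := by unfold vpW; positivity

theorem geo_add (l m : ℕ) (x : ZMod L) : geo L (l + m) x = geo L l x + chi L l x * geo L m x := by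
  simp only [geo, sum_range_add, mul_sum]
  congr 1
  exact sum_congr rfl fun k _ => by push_cast; rw [chi_add]

theorem norm_vp_le (l : ℕ) (q : ℤ) (x : ZMod L) : ‖vp L l q x‖ ≤ vpW L l x := by
  have h : ‖geo L (3 * l) x‖ ≤ 3 * ‖geo L l x‖ := by
    have : 3 * l = l + (l + l) := by ring
    rw [this, geo_add, geo_add]
    refine (norm_add_le _ _).trans ?_
    rw [norm_mul, norm_chi, one_mul]
    have := norm_add_le (geo L l x) (chi L l x * geo L l x)
    rw [norm_mul, norm_chi, one_mul] at this
    linarith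
  simp only [vp, vpW, norm_mul, norm_chi, mul_one, norm_inv, Complex.norm_natCast, RCLike.norm_conj]
  have h0 : (0 : ℝ) ≤ (l : ℝ)⁻¹ := by positivity
  calc (l : ℝ)⁻¹ * (‖geo L (3 * l) x‖ * ‖geo L l x‖)
      ≤ (l : ℝ)⁻¹ * (3 * ‖geo L l x‖ * ‖geo L l x‖) := by gcongr
    _ = _ := by ring

theorem sum_geo_sq {l : ℕ} (hl : l ≤ L) : ∑ x : ZMod L, ‖geo L l x‖ ^ 2 = L * l := by
  have hinj : Set.InjOn (fun i : ℕ => (((i : ℕ) : ℤ) : ZMod L)) (range l) := by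
    intro a ha b hb hab
    simp only [coe_range, Set.mem_Iio] at ha hb
    have := intCast_inj_of_lt (L := L) (a := a) (b := b) (by rw [abs_lt]; constructor <;> omega) hab
    exact_mod_cast this
  have := parseval hinj (fun _ => 1)
  simpa [geo] using this

theorem sum_vpW {l : ℕ} (hl : l ≤ L) (h0 : 0 < l) : ∑ x : ZMod L, vpW L l x = 3 * L := by
  simp only [vpW, ← mul_sum, sum_geo_sq hl]
  have : (l : ℝ) ≠ 0 := by positivity
  field_simp

theorem hat_vp {l : ℕ} (h0 : 0 < l) (hl : 6 * l < L) (q k : ℤ) (h1 : q * l ≤ k)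
    (h2 : k ≤ (q + 2) * l) : hat (vp L l q) k = 1 := by
  have hl0 : (l : ℂ) ≠ 0 := by exact_mod_cast h0.ne'
  have hvp : vp L l q = (l : ℂ)⁻¹ • ∑ b ∈ range l, ∑ a ∈ range (3 * l),
      chi L ((a : ℤ) - b + q * l) := by
    ext x
    simp only [vp, geo, map_sum, sum_mul_sum, Pi.smul_apply, Finset.sum_apply, smul_eq_mul,
      mul_assoc]
    congr 1
    rw [sum_comm, sum_mul]
    refine sum_congr rfl fun b _ => ?_
    rw [sum_mul]
    refine sum_congr rfl fun a _ => ?_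
    rw [chi_add, sub_eq_add_neg, chi_add, chi_neg]
  have key : ∀ b ∈ range l, ∑ a ∈ range (3 * l), hat (chi L ((a : ℤ) - b + q * l)) k = 1 := by
    intro b hb
    rw [mem_range] at hb
    have h3 : (q + 2) * (l : ℤ) = q * l + 2 * l := by ring
    obtain ⟨a₀, ha₀⟩ : ∃ a₀ : ℕ, (a₀ : ℤ) = k - q * l + b :=
      ⟨(k - q * l + b).toNat, by rw [Int.toNat_of_nonneg]; omega⟩
    rw [sum_eq_single a₀]
    · rw [hat_chi, if_pos]
      congr 1; omega
    · intro a ha hne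
      rw [mem_range] at ha
      rw [hat_chi, if_neg]
      intro h
      have := intCast_inj_of_lt (L := L) (by rw [abs_lt]; constructor <;> omega) h
      omega
    · intro h
      rw [mem_range] at h
      omega
  rw [hvp, hat_smul, hat_sum]
  simp only [hat_sum]
  rw [sum_congr rfl key]
  simp [hl0]

/-- Equal-length smooth square function, pointwise bound. -/
theorem smooth_sq_pointwise {l : ℕ} (h0 : 0 < l) {R : ℕ} (hR : (2 * R + 2) * l ≤ L)
    (g : ZMod L → ℂ) (x : ZMod L) :
    ∑ q ∈ Icc (-(R : ℤ)) R, ‖conv (vp L l q) g x‖ ^ 2 ≤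
      3 * ((L : ℝ)⁻¹ * ∑ y, vpW L l y * ‖g (x - y)‖ ^ 2) := by
  have hLpos : (0 : ℝ) < L := by exact_mod_cast Nat.pos_of_ne_zero (NeZero.ne L)
  have hlR : (0 : ℝ) < l := by exact_mod_cast h0
  set Q := Icc (-(R : ℤ)) R with hQ
  set A : ℤ → ℂ := fun q => conv (vp L l q) g x with hA
  set S : ℝ := ∑ q ∈ Q, ‖A q‖ ^ 2 with hS
  set B : ZMod L → ℂ := fun y => ∑ q ∈ Q, conj (A q) * chi L (q * l) y with hB
  have h1 : (S : ℂ) = (L : ℂ)⁻¹ * ∑ y, (vp L l 0 y * g (x - y)) * B y := by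
    have : (S : ℂ) = ∑ q ∈ Q, A q * conj (A q) := by
      simp only [hS, Complex.mul_conj, Complex.normSq_eq_norm_sq]; push_cast; rfl
    rw [this]
    simp only [hB, mul_sum]
    rw [sum_comm]
    refine sum_congr rfl fun q _ => ?_
    have e : A q = (L : ℂ)⁻¹ * ∑ y, vp L l q y * g (x - y) := rfl
    generalize conj (A q) = z
    rw [e, mul_sum, sum_mul]
    refine sum_congr rfl fun y _ => ?_
    simp only [vp, zero_mul, chi_zero]
    ring
  have h2 : S ≤ (L : ℝ)⁻¹ * ∑ y, vpW L l y * (‖g (x - y)‖ * ‖B y‖) := by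
    have : ‖(S : ℂ)‖ ≤ (L : ℝ)⁻¹ * ∑ y, vpW L l y * (‖g (x - y)‖ * ‖B y‖) := by
      rw [h1, norm_mul, norm_inv, Complex.norm_natCast]
      refine mul_le_mul_of_nonneg_left ((norm_sum_le _ _).trans (sum_le_sum fun y _ => ?_))
        (by positivity)
      rw [norm_mul, norm_mul, mul_assoc]
      exact mul_le_mul_of_nonneg_right (norm_vp_le l 0 y) (by positivity)
    rw [Complex.norm_real] at this
    exact (le_abs_self S).trans this
  have h3 : ∑ y, vpW L l y * ‖B y‖ ^ 2 = 3 * L * S := by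
    have hinj : Set.InjOn (fun i : ℤ × ℕ => ((i.1 * l + i.2 : ℤ) : ZMod L))
        (Q ×ˢ range l : Finset (ℤ × ℕ)) := by
      rintro ⟨q, r⟩ ha ⟨q', r'⟩ hb hab
      simp only [hQ, coe_product, Set.mem_prod, mem_coe, mem_Icc, mem_range] at ha hb
      obtain ⟨⟨h5, h6⟩, h7⟩ := ha
      obtain ⟨⟨h8, h9⟩, h10⟩ := hb
      have hR' : ((2 * R + 2) * l : ℤ) ≤ L := by exact_mod_cast hR
      have hl' : (0 : ℤ) < l := by exact_mod_cast h0
      have := intCast_inj_of_lt (L := L) (a := q * l + r) (b := q' * l + r')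
        (by rw [abs_lt]; constructor <;> nlinarith) hab
      have h11 : q = q' := by
        rcases lt_trichotomy q q' with h | h | h
        · nlinarith
        · exact h
        · nlinarith
      subst h11
      simp only [Prod.mk.injEq, true_and]
      omega
    have := parseval hinj (fun i => conj (A i.1))
    rw [sum_product] at this
    simp only [sum_const, card_range, nsmul_eq_mul, RCLike.norm_conj, ← mul_sum] at this
    have h4 : ∀ y, ∑ i ∈ Q ×ˢ range l, conj (A i.1) * chi L (i.1 * l + i.2) y =
        geo L l y * B y := by
      intro y
      rw [sum_product, hB]
      simp only [geo, mul_sum]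
      refine sum_congr rfl fun q _ => ?_
      rw [sum_mul]
      refine sum_congr rfl fun r _ => ?_
      rw [chi_add]; ring
    simp only [h4, norm_mul, mul_pow] at this
    simp only [vpW, mul_assoc, ← mul_sum]
    rw [this]
    field_simp
    rfl
  have h4 : S ^ 2 ≤ ((L : ℝ)⁻¹ * ∑ y, vpW L l y * ‖g (x - y)‖ ^ 2) * (3 * S) := by
    have hcs := sum_mul_sq_le_sq_mul_sq univ (fun y => √(vpW L l y) * ‖g (x - y)‖)
      (fun y => √(vpW L l y) * ‖B y‖)
    have e1 : ∀ y, √(vpW L l y) * ‖g (x - y)‖ * (√(vpW L l y) * ‖B y‖) =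
        vpW L l y * (‖g (x - y)‖ * ‖B y‖) := by
      intro y; rw [mul_mul_mul_comm, Real.mul_self_sqrt (vpW_nonneg l y)]
    simp only [e1, mul_pow, Real.sq_sqrt (vpW_nonneg l _)] at hcs
    rw [h3] at hcs
    have hS0 : 0 ≤ S := sum_nonneg fun _ _ => by positivity
    calc S ^ 2 ≤ ((L : ℝ)⁻¹ * ∑ y, vpW L l y * (‖g (x - y)‖ * ‖B y‖)) ^ 2 :=
          pow_le_pow_left₀ hS0 h2 2
      _ = (L : ℝ)⁻¹ ^ 2 * (∑ y, vpW L l y * (‖g (x - y)‖ * ‖B y‖)) ^ 2 := by ring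
      _ ≤ (L : ℝ)⁻¹ ^ 2 * ((∑ y, vpW L l y * ‖g (x - y)‖ ^ 2) * (3 * L * S)) := by gcongr
      _ = _ := by field_simp
  have hS0 : 0 ≤ S := sum_nonneg fun _ _ => by positivity
  rcases hS0.eq_or_lt with h | h
  · rw [← h]
    exact mul_nonneg (by norm_num) (mul_nonneg (by positivity)
      (sum_nonneg fun y _ => mul_nonneg (vpW_nonneg l y) (by positivity)))
  · nlinarith

/-- Equal-length smooth square function in `L^{2 k}`, vector-valued. -/
theorem smooth_sq {l : ℕ} (h0 : 0 < l) {R : ℕ} (hR : (2 * R + 2) * l ≤ L)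
    {ι : Type*} [Fintype ι] (g : ι → ZMod L → ℂ) (k : ℕ) :
    ∑ x, (∑ i, ∑ q ∈ Icc (-(R : ℤ)) R, ‖conv (vp L l q) (g i) x‖ ^ 2) ^ k ≤
      9 ^ k * ∑ x, (∑ i, ‖g i x‖ ^ 2) ^ k := by
  have hLpos : (0 : ℝ) < L := by exact_mod_cast Nat.pos_of_ne_zero (NeZero.ne L)
  have hlL : l ≤ L := by nlinarith
  set F : ZMod L → ℝ := fun x => ∑ i, ‖g i x‖ ^ 2 with hF
  have hF0 : ∀ x, 0 ≤ F x := fun x => by positivity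
  have hw := sum_vpW hlL h0
  set w : ZMod L → ℝ := fun y => vpW L l y / (3 * L) with hwdef
  have hw0 : ∀ y, 0 ≤ w y := fun y => div_nonneg (vpW_nonneg l y) (by positivity)
  have hw1 : ∑ y, w y = 1 := by
    rw [hwdef, ← sum_div, hw]; field_simp
  have h1 : ∀ x, ∑ i, ∑ q ∈ Icc (-(R : ℤ)) R, ‖conv (vp L l q) (g i) x‖ ^ 2 ≤
      9 * ∑ y, w y * F (x - y) := by
    intro x
    calc _ ≤ ∑ i, 3 * ((L : ℝ)⁻¹ * ∑ y, vpW L l y * ‖g i (x - y)‖ ^ 2) :=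
          sum_le_sum fun i _ => smooth_sq_pointwise h0 hR (g i) x
      _ = _ := by
          simp only [hF, mul_sum]
          rw [sum_comm]
          refine sum_congr rfl fun y _ => sum_congr rfl fun i _ => ?_
          rw [hwdef]; field_simp; ring
  calc _ ≤ ∑ x, (9 * ∑ y, w y * F (x - y)) ^ k :=
        sum_le_sum fun x _ => pow_le_pow_left₀ (by positivity) (h1 x) k
    _ ≤ ∑ x, 9 ^ k * ∑ y, w y * F (x - y) ^ k := by
        refine sum_le_sum fun x _ => ?_
        rw [mul_pow]
        refine mul_le_mul_of_nonneg_left ?_ (by positivity)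
        exact Real.pow_arith_mean_le_arith_mean_pow univ w (fun y => F (x - y))
          (fun y _ => hw0 y) hw1 (fun y _ => hF0 _) k
    _ = 9 ^ k * ∑ x, F x ^ k := by
        rw [← mul_sum, sum_comm]
        congr 1
        have : ∀ y, ∑ x, w y * F (x - y) ^ k = w y * ∑ x, F x ^ k := by
          intro y
          rw [← mul_sum]
          congr 1
          exact Equiv.sum_comp (Equiv.subRight y) (fun x => F x ^ k)
        simp only [this, ← sum_mul, hw1, one_mul]

end Smooth

section RubioDeFrancia

open Finset ComplexConjugate

variable {L : ℕ} [NeZero L]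

/-- Projection of a function with spectrum in `[-D, D]` onto the interval `[a, b)`. -/
noncomputable def pI (D : ℕ) (a b : ℤ) (f : ZMod L → ℂ) : ZMod L → ℂ :=
  ph D a f - ph D b f

theorem pI_eq {D : ℕ} {a b : ℤ} (hab : a ≤ b) (f : ZMod L → ℂ) :
    pI D a b f = proj ((Icc (-(D : ℤ)) D).filter (fun k => a ≤ k ∧ k < b)) f := by
  rw [pI, sub_eq_iff_eq_add, ph, ph, ← proj_union]
  · congr 1
    ext k
    simp only [mem_filter, mem_union, mem_Icc]
    omega
  · rw [disjoint_left]
    intro k hk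
    simp only [mem_filter, mem_Icc] at hk ⊢
    omega

theorem pI_mem_Sp {D : ℕ} {a b : ℤ} (hab : a ≤ b) (f : ZMod L → ℂ) :
    pI D a b f ∈ Sp L (Set.Icc a (b - 1)) := by
  rw [pI_eq hab]
  refine proj_mem_Sp ?_ _
  intro k hk
  simp only [coe_filter, mem_Icc, Set.mem_ofPred_eq] at hk
  constructor <;> omega

theorem norm_sub_sq_le (u v : ℂ) : ‖u - v‖ ^ 2 ≤ 2 * (‖u‖ ^ 2 + ‖v‖ ^ 2) := by
  have := norm_sub_le u v
  have h0 := norm_nonneg (u - v)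
  nlinarith [sq_nonneg (‖u‖ - ‖v‖), norm_nonneg u, norm_nonneg v]

theorem two_mul_add_pow_le {a b : ℝ} (ha : 0 ≤ a) (hb : 0 ≤ b) (k : ℕ) :
    (2 * (a + b)) ^ k ≤ 4 ^ k * (a ^ k + b ^ k) := by
  rw [mul_pow]
  have h1 : (a + b) ^ k ≤ 2 ^ k * (a ^ k + b ^ k) := by
    refine (add_pow_le ha hb k).trans ?_
    gcongr
    · norm_num
    · omega
  have h2 : (4 : ℝ) ^ k = 2 ^ k * 2 ^ k := by rw [← mul_pow]; norm_num
  rw [h2, mul_assoc]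
  gcongr

/-- Vector-valued boundedness of interval projections. -/
theorem cotlar_interval (j : ℕ) : ∃ C : ℝ, 0 < C ∧ ∀ (L : ℕ) [NeZero L] (D : ℕ),
    2 ^ (j + 1) * D < L →
    ∀ (ι : Type) [Fintype ι] (a b : ι → ℤ) (f : ι → ZMod L → ℂ),
    (∀ i, f i ∈ Sp L (Set.Icc (-(D : ℤ)) D)) →
    ∑ x, (∑ i, ‖pI D (a i) (b i) (f i) x‖ ^ 2) ^ (2 ^ j) ≤
      C * ∑ x, (∑ i, ‖f i x‖ ^ 2) ^ (2 ^ j) := by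
  obtain ⟨C, hC, h⟩ := cotlar j
  refine ⟨2 * 4 ^ (2 ^ j) * C, by positivity, fun L _ D hD ι _ a b f hf => ?_⟩
  have h1 := h L D hD ι a f hf
  have h2 := h L D hD ι b f hf
  set k := 2 ^ j
  calc _ ≤ ∑ x, (2 * (∑ i, ‖ph D (a i) (f i) x‖ ^ 2 + ∑ i, ‖ph D (b i) (f i) x‖ ^ 2)) ^ k := by
        refine sum_le_sum fun x _ => pow_le_pow_left₀ (by positivity) ?_ k
        rw [← sum_add_distrib, mul_sum]
        exact sum_le_sum fun i _ => norm_sub_sq_le _ _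
    _ ≤ ∑ x, 4 ^ k * ((∑ i, ‖ph D (a i) (f i) x‖ ^ 2) ^ k +
          (∑ i, ‖ph D (b i) (f i) x‖ ^ 2) ^ k) :=
        sum_le_sum fun x _ => two_mul_add_pow_le (by positivity) (by positivity) k
    _ ≤ _ := by
        rw [← mul_sum, sum_add_distrib]
        have : (0 : ℝ) < 4 ^ k := by positivity
        nlinarith

theorem card_le_of_disjoint {κ : Type*} {s : Finset κ} {e : κ → ℤ} {δ : ℕ} (hδ : 0 < δ)
    (hd : (s : Set κ).PairwiseDisjoint fun i => Ico (e i) (e i + δ)) {P : ℤ} {n : ℕ}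
    (hs : ∀ i ∈ s, P ≤ e i ∧ e i + δ ≤ P + n * δ) : #s ≤ n := by
  classical
  have h1 : #(s.biUnion fun i => Ico (e i) (e i + δ)) = #s * δ := by
    rw [card_biUnion hd]; simp
  have h2 : s.biUnion (fun i => Ico (e i) (e i + δ)) ⊆ Ico P (P + (n * δ : ℕ)) := by
    intro k hk
    simp only [mem_biUnion, mem_Ico] at hk ⊢
    obtain ⟨i, hi, hk⟩ := hk
    have := hs i hi
    push_cast
    omega
  have h3 := card_le_card h2
  rw [h1, Int.card_Ico, add_sub_cancel_left, Int.toNat_natCast] at h3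
  exact Nat.le_of_mul_le_mul_right h3 hδ

/-- Projections onto intervals of a common length with bounded multiplicity. -/
theorem equal_length (j : ℕ) : ∃ C : ℝ, 0 < C ∧ ∀ (L : ℕ) [NeZero L] (D : ℕ),
    2 ^ (j + 1) * D < L → ∀ (l R n : ℕ), 0 < l → 6 * l < L → (2 * R + 2) * l ≤ L →
    ∀ (ι κ : Type) [Fintype ι] [Fintype κ] [DecidableEq ι] (I : Finset (ι × κ)) (c : ι × κ → ℤ)
      (g : ι → ZMod L → ℂ),
    (∀ i, g i ∈ Sp L (Set.Icc (-(D : ℤ)) D)) → (∀ i ∈ I, -(R : ℤ) ≤ c i / l ∧ c i / l ≤ R) →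
    (∀ μ q, #{i ∈ I | (i.1, c i / l) = (μ, q)} ≤ n) →
    ∑ x, (∑ i ∈ I, ‖pI D (c i) (c i + l) (g i.1) x‖ ^ 2) ^ (2 ^ j) ≤
      C * n ^ (2 ^ j) * ∑ x, (∑ i, ‖g i x‖ ^ 2) ^ (2 ^ j) := by
  obtain ⟨C, hC, h⟩ := cotlar_interval j
  refine ⟨C * 9 ^ (2 ^ j), by positivity,
    fun L _ D hD l R n hl hlL hR ι κ _ _ _ I c g hg hI hcard => ?_⟩
  set k := 2 ^ j
  have hDR : DR L (Set.Icc (-(D : ℤ)) D) := by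
    refine DR_Icc ?_
    have : 2 * D ≤ 2 ^ (j + 1) * D := by
      refine Nat.mul_le_mul_right D ?_
      rw [pow_succ]; have := Nat.one_le_two_pow (n := j); omega
    omega
  have heq : ∀ i : I, pI D (c i) (c i + l) (g i.1.1) =
      pI D (c i) (c i + l) (conv (vp L l (c i / l)) (g i.1.1)) := by
    intro i
    have hl' : (0 : ℤ) < l := by exact_mod_cast hl
    rw [pI_eq (by omega), pI_eq (by omega)]
    refine proj_congr fun k hk => ?_
    simp only [mem_filter, mem_Icc] at hk
    have h1 := Int.ediv_mul_le (c i) hl'.ne'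
    have h2 := Int.lt_ediv_add_one_mul_self (c i) hl'
    rw [hat_conv, hat_vp hl hlL _ _ (by omega) (by nlinarith), one_mul]
  have h1 := h L D hD I (fun i => c i) (fun i => c i + l)
    (fun i => conv (vp L l (c i / l)) (g i.1.1)) (fun i => conv_mem_Sp (hg _) _)
  simp only [← heq] at h1
  have hc : ∀ x, ∑ i : I, ‖pI D (c i) (c i + l) (g i.1.1) x‖ ^ 2 =
      ∑ i ∈ I, ‖pI D (c i) (c i + l) (g i.1) x‖ ^ 2 :=
    fun x => sum_coe_sort I (fun i => ‖pI D (c i) (c i + l) (g i.1) x‖ ^ 2)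
  simp only [hc] at h1
  refine h1.trans ?_
  rw [mul_assoc, mul_assoc]
  refine mul_le_mul_of_nonneg_left ?_ hC.le
  have h2 := smooth_sq hl hR g k
  have h3 : ∀ x, ∑ i : I, ‖conv (vp L l (c i / l)) (g i.1.1) x‖ ^ 2 ≤
      n * ∑ i, ∑ q ∈ Icc (-(R : ℤ)) R, ‖conv (vp L l q) (g i) x‖ ^ 2 := by
    intro x
    rw [sum_coe_sort I (fun i => ‖conv (vp L l (c i / l)) (g i.1) x‖ ^ 2), ← sum_product', mul_sum]
    rw [← sum_fiberwise_of_maps_to (g := fun i => (i.1, c i / (l : ℤ)))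
      (t := univ ×ˢ Icc (-(R : ℤ)) R) (fun i hi => by simpa using hI i hi)]
    refine sum_le_sum fun p _ => ?_
    have : ∀ i ∈ {i ∈ I | (i.1, c i / (l : ℤ)) = p}, ‖conv (vp L l (c i / l)) (g i.1) x‖ ^ 2 =
        ‖conv (vp L l p.2) (g p.1) x‖ ^ 2 := by
      intro i hi
      rw [← (mem_filter.1 hi).2]
    rw [sum_congr rfl this, sum_const, nsmul_eq_mul]
    gcongr
    exact hcard p.1 p.2
  calc _ ≤ ∑ x, (n * ∑ i, ∑ q ∈ Icc (-(R : ℤ)) R, ‖conv (vp L l q) (g i) x‖ ^ 2) ^ k :=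
        sum_le_sum fun x _ => pow_le_pow_left₀ (by positivity) (h3 x) k
    _ = n ^ k * ∑ x, (∑ i, ∑ q ∈ Icc (-(R : ℤ)) R, ‖conv (vp L l q) (g i) x‖ ^ 2) ^ k := by
        rw [mul_sum]; exact sum_congr rfl fun x _ => mul_pow _ _ _
    _ ≤ n ^ k * (9 ^ k * ∑ x, (∑ i, ‖g i x‖ ^ 2) ^ k) := by gcongr
    _ = _ := by ring

/-- Multiplying an interval projection by a function with spectrum in a short window. -/
theorem pI_mul_eq {D B l : ℕ} {a b A : ℤ} (hab : a ≤ b) (hB : 2 * B < L)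
    (h1 : (D : ℤ) + |A| + l ≤ B) (ha : -(D : ℤ) ≤ a) (hb : b ≤ D + 1) {g G : ZMod L → ℂ}
    (hg : g ∈ Sp L (Set.Icc (-(D : ℤ)) D)) (hG : G ∈ Sp L (Set.Icc A (A + l - 1))) :
    pI D a b g * G = proj (Ico (a + A) (b + A + l)) (g * G) -
      proj (Ico (a + A) (b + A + l)) ((pI D (a - l) a g + pI D b (b + l) g) * G) := by
  have hA := abs_le.1 (le_refl |A|)
  have hDR : DR L (Set.Icc (-(B : ℤ)) B) := DR_Icc (by omega)
  set E := Ico (a + A) (b + A + l) with hE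
  have hEB : (E : Set ℤ) ⊆ Set.Icc (-(B : ℤ)) B := by
    intro k hk
    simp only [hE, coe_Ico, Set.mem_Ico] at hk
    constructor <;> omega
  set r : ZMod L → ℂ := proj ((Icc (-(D : ℤ)) D).filter (fun k => k < a - l ∨ b + l ≤ k)) g with hr
  have hDD : DR L (Set.Icc (-(D : ℤ)) D) :=
    hDR.mono (Set.Icc_subset_Icc (by have := abs_nonneg A; omega) (by have := abs_nonneg A; omega))
  have hdec : g = pI D a b g + (pI D (a - l) a g + pI D b (b + l) g) + r := by
    have h1 : g = proj (Icc (-(D : ℤ)) D) g :=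
      (proj_eq_self (by simpa using hDD) (by simp) hg).symm
    conv_lhs => rw [h1]
    rw [pI_eq hab, pI_eq (by omega), pI_eq (by omega), hr, ← proj_union, ← proj_union, ← proj_union]
    · congr 1
      ext k
      simp only [mem_filter, mem_union, mem_Icc]
      omega
    all_goals
      rw [disjoint_left]
      intro k hk
      simp only [mem_filter, mem_union, mem_Icc] at hk ⊢
      omega
  have hr0 : proj E (r * G) = 0 := by
    refine proj_eq_zero (s := {k : ℤ | -(B : ℤ) ≤ k ∧ k ≤ B ∧ k ∉ E}) ?_ ?_
    · rintro k hk c ⟨hc1, hc2, hc3⟩ hck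
      exact hc3 (hDR (x₁ := c) ⟨hc1, hc2⟩ (hEB hk) hck ▸ hk)
    · refine mul_mem_Sp (s := ((Icc (-(D : ℤ)) D).filter (fun k => k < a - l ∨ b + l ≤ k) : Finset ℤ))
        (proj_mem_Sp le_rfl _) hG ?_
      intro x hx y hy
      simp only [coe_filter, mem_Icc, Set.mem_ofPred_eq, Set.mem_Icc] at hx hy
      refine ⟨by omega, by omega, ?_⟩
      rw [hE, mem_Ico]
      omega
  have hself : proj E (pI D a b g * G) = pI D a b g * G := by
    refine proj_eq_self (s := E) (hDR.mono hEB) le_rfl ?_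
    refine mul_mem_Sp (pI_mem_Sp hab g) hG ?_
    intro x hx y hy
    simp only [Set.mem_Icc, hE, coe_Ico, Set.mem_Ico] at hx hy ⊢
    omega
  have : g * G = pI D a b g * G + (pI D (a - l) a g + pI D b (b + l) g) * G + r * G := by
    conv_lhs => rw [hdec]
    ring
  rw [this, proj_add, proj_add, hr0, hself]
  abel

theorem pow_sum_le {ι : Type*} (s : Finset ι) (w : ι → ℝ) (hw : ∀ i, 0 ≤ w i)
    (len : ι → ℕ) (m : ℕ) :
    (∑ i ∈ s, w i) ^ (m + 1) ≤
      (m + 1) * ∑ i ∈ s, w i * (∑ j ∈ s with len j ≤ len i, w j) ^ m := by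
  classical
  have key : ∀ (n : ℕ) (S t : ℝ), 0 ≤ S → 0 ≤ t →
      (t + S) ^ (n + 1) ≤ (n + 1) * (t * (t + S) ^ n) + S ^ (n + 1) := by
    intro n
    induction n with
    | zero => intro S t _ _; simp
    | succ n ih =>
      intro S t hS ht
      have h1 := mul_le_mul_of_nonneg_left (ih S t hS ht) hS
      have h2 : 0 ≤ (t + S) ^ n := by positivity
      have h3 : (t + S) ^ (n + 1) = (t + S) * (t + S) ^ n := by ring
      have h4 : (t + S) ^ (n + 1 + 1) = S * (t + S) ^ (n + 1) + t * ((t + S) * (t + S) ^ n) := by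
        ring
      rw [h4]
      push_cast
      rw [h3] at h1 ⊢
      have : 0 ≤ (n + 1) * (t * t * (t + S) ^ n) := by positivity
      have h5 : S ^ (n + 1 + 1) = S * S ^ (n + 1) := by ring
      rw [h5]
      nlinarith
  induction s using Finset.induction_on_max_value len with
  | empty => simp
  | insert a s ha hmax ih =>
    rw [sum_insert ha, sum_insert ha, mul_add]
    have hf : (insert a s).filter (fun j => len j ≤ len a) = insert a s := by
      rw [filter_eq_self]
      intro i hi
      rcases mem_insert.1 hi with rfl | hi
      · exact le_rfl
      · exact hmax i hi
    rw [hf, sum_insert ha]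
    refine (key m _ _ (sum_nonneg fun i _ => hw i) (hw a)).trans ?_
    refine add_le_add le_rfl (ih.trans ?_)
    refine mul_le_mul_of_nonneg_left (sum_le_sum fun i _ => ?_) (by positivity)
    refine mul_le_mul_of_nonneg_left (pow_le_pow_left₀ (sum_nonneg fun i _ => hw i) ?_ m) (hw i)
    exact sum_le_sum_of_subset_of_nonneg (filter_subset_filter _ (subset_insert _ _))
      fun i _ _ => hw i

end RubioDeFrancia

section RubioDeFranciaMain

open Finset ComplexConjugate

variable {L : ℕ} [NeZero L]

theorem prod_mem_Sp {ι : Type*} (s : Finset ι) (u : ι → ZMod L → ℂ) (a b : ι → ℤ)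
    (h : ∀ i ∈ s, u i ∈ Sp L (Set.Icc (a i) (b i))) :
    ∏ i ∈ s, u i ∈ Sp L (Set.Icc (∑ i ∈ s, a i) (∑ i ∈ s, b i)) := by
  classical
  induction s using Finset.induction_on with
  | empty =>
    have : (1 : ZMod L → ℂ) = chi L 0 := by ext; simp
    simp only [prod_empty, sum_empty, this]
    exact chi_mem_Sp (by simp)
  | insert i s hi ih =>
    rw [prod_insert hi, sum_insert hi, sum_insert hi]
    refine mul_mem_Sp (h i (mem_insert_self _ _)) (ih fun j hj => h j (mem_insert_of_mem hj)) ?_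
    rintro x ⟨h1, h2⟩ y ⟨h3, h4⟩
    exact ⟨add_le_add h1 h3, add_le_add h2 h4⟩

theorem sum_le_sum_sum_of_cover {α β : Type*} {s : Finset α} {t : Finset β}
    {u : β → Finset α} (f : α → ℝ) (hf : ∀ a, 0 ≤ f a) (h : ∀ a ∈ s, ∃ r ∈ t, a ∈ u r) :
    ∑ a ∈ s, f a ≤ ∑ r ∈ t, ∑ a ∈ u r, f a := by
  classical
  have h1 : ∀ r ∈ t, ∑ a ∈ s with a ∈ u r, f a ≤ ∑ a ∈ u r, f a := fun r _ =>
    sum_le_sum_of_subset_of_nonneg (fun a ha => (mem_filter.1 ha).2) fun a _ _ => hf a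
  refine le_trans ?_ (sum_le_sum h1)
  simp only [sum_filter]
  rw [sum_comm]
  refine sum_le_sum fun a ha => ?_
  obtain ⟨r, hr, har⟩ := h a ha
  have := single_le_sum (f := fun r => if a ∈ u r then f a else 0)
    (fun r _ => by split_ifs <;> simp [hf]) hr
  simpa [har] using this

/-- Bessel inequality for enlarged intervals. -/
theorem bessel_enlarged {κ : Type*} {s : Finset κ} {a b : κ → ℤ} {B δ m : ℕ} {A : ℤ}
    (hB : 2 * B < L) (hs : ∀ i ∈ s, a i + δ ≤ b i)
    (hd : (s : Set κ).PairwiseDisjoint fun i => Ico (a i) (b i))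
    (h1 : ∀ i ∈ s, -(B : ℤ) ≤ a i + A ∧ b i + A + m * δ ≤ B) (h : ZMod L → ℂ) :
    ∑ i ∈ s, ∑ x, ‖proj (Ico (a i + A) (b i + A + m * δ)) h x‖ ^ 2 ≤
      (m + 1) * ∑ x, ‖h x‖ ^ 2 := by
  have hDR : DR L (Set.Icc (-(B : ℤ)) B) := DR_Icc (by omega)
  have hsub : ∀ r ≤ m, ∀ i ∈ s,
      ((Ico (a i + A + r * δ) (b i + A + r * δ) : Finset ℤ) : Set ℤ) ⊆ Set.Icc (-(B : ℤ)) B := by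
    intro r hr i hi k hk
    have := h1 i hi
    have hr' : (r : ℤ) * δ ≤ m * δ := by exact_mod_cast Nat.mul_le_mul_right δ hr
    have : (0 : ℤ) ≤ r * δ := by positivity
    simp only [coe_Ico, Set.mem_Ico] at hk
    constructor <;> omega
  have h2 : ∀ i ∈ s, ∑ x, ‖proj (Ico (a i + A) (b i + A + m * δ)) h x‖ ^ 2 ≤
      ∑ r ∈ range (m + 1), ∑ x, ‖proj (Ico (a i + A + r * δ) (b i + A + r * δ)) h x‖ ^ 2 := by
    intro i hi
    rw [sum_norm_proj_sq, sum_congr rfl fun r hr => sum_norm_proj_sq (hDR.mono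
      (hsub r (Nat.lt_succ_iff.1 (mem_range.1 hr)) i hi)) h, ← mul_sum]
    · refine mul_le_mul_of_nonneg_left ?_ (by positivity)
      refine sum_le_sum_sum_of_cover _ (fun _ => by positivity) ?_
      have key : ∀ n : ℕ, ∀ k ∈ Ico (a i + A) (b i + A + n * δ), ∃ r ≤ n,
          k ∈ Ico (a i + A + r * δ) (b i + A + r * δ) := by
        intro n
        induction n with
        | zero => intro k hk; exact ⟨0, le_rfl, by simpa using hk⟩
        | succ n ih =>
          intro k hk
          by_cases hk' : k < b i + A + n * δ
          · obtain ⟨r, hr, hk⟩ := ih k (by rw [mem_Ico] at hk ⊢; exact ⟨hk.1, hk'⟩)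
            exact ⟨r, by omega, hk⟩
          · refine ⟨n + 1, le_rfl, ?_⟩
            have := hs i hi
            rw [mem_Ico] at hk ⊢
            push_cast at hk ⊢
            rw [add_mul] at hk ⊢
            omega
      intro k hk
      obtain ⟨r, hr, hk⟩ := key m k hk
      exact ⟨r, mem_range.2 (by omega), hk⟩
    · refine hDR.mono ?_
      intro k hk
      have := h1 i hi
      simp only [coe_Ico, Set.mem_Ico] at hk
      constructor <;> omega
  calc _ ≤ ∑ i ∈ s, ∑ r ∈ range (m + 1),
        ∑ x, ‖proj (Ico (a i + A + r * δ) (b i + A + r * δ)) h x‖ ^ 2 := sum_le_sum h2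
    _ = ∑ r ∈ range (m + 1), ∑ i ∈ s,
        ∑ x, ‖proj (Ico (a i + A + r * δ) (b i + A + r * δ)) h x‖ ^ 2 := sum_comm
    _ ≤ ∑ r ∈ range (m + 1), ∑ x, ‖h x‖ ^ 2 := by
        refine sum_le_sum fun r hr => bessel_family hDR
          (fun i hi => hsub r (Nat.lt_succ_iff.1 (mem_range.1 hr)) i hi) ?_ h
        intro i hi i' hi' hii
        have := hd hi hi' hii
        simp only [Function.onFun] at this ⊢
        rw [disjoint_left] at this ⊢
        intro k hk hk'
        refine this (a := k - A - r * δ) ?_ ?_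
        · rw [mem_Ico] at hk ⊢; omega
        · rw [mem_Ico] at hk' ⊢; omega
    _ = _ := by simp

/-- The square of the margins adjacent to the intervals of length at least `δ`. -/
noncomputable def margin {ι κ : Type} [Fintype ι] [Fintype κ] (D m : ℕ) (a b : ι × κ → ℤ)
    (g : ι → ZMod L → ℂ) (δ : ℕ) (x : ZMod L) : ℝ :=
  ∑ i : ι × κ with δ ≤ (b i - a i).toNat, (‖pI D (a i - (m * δ : ℕ)) (a i) (g i.1) x‖ ^ 2 +
    ‖pI D (b i) (b i + (m * δ : ℕ)) (g i.1) x‖ ^ 2)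

theorem margin_nonneg {ι κ : Type} [Fintype ι] [Fintype κ] (D m : ℕ) (a b : ι × κ → ℤ)
    (g : ι → ZMod L → ℂ) (δ : ℕ) (x : ZMod L) : 0 ≤ margin D m a b g δ x := by
  unfold margin; positivity

theorem margin_bound (j m : ℕ) (hm : 0 < m) : ∃ C : ℝ, 0 < C ∧ ∀ (L : ℕ) [NeZero L] (D : ℕ),
    (2 ^ (j + 1) + 32 * m) * (D + 1) < L → ∀ (ι κ : Type) [Fintype ι] [Fintype κ]
      (a b : ι × κ → ℤ) (g : ι → ZMod L → ℂ),
    (∀ i, g i ∈ Sp L (Set.Icc (-(D : ℤ)) D)) →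
    (∀ i, -(D : ℤ) ≤ a i ∧ a i ≤ b i ∧ b i ≤ D + 1) →
    (∀ μ κ₁ κ₂, κ₁ ≠ κ₂ → Disjoint (Ico (a (μ, κ₁)) (b (μ, κ₁))) (Ico (a (μ, κ₂)) (b (μ, κ₂)))) →
    ∀ δ ≤ 2 * D + 1, ∑ x, (margin D m a b g δ x) ^ (2 ^ j) ≤
      C * ∑ x, (∑ i, ‖g i x‖ ^ 2) ^ (2 ^ j) := by
  classical
  obtain ⟨C, hC, h⟩ := equal_length j
  refine ⟨2 ^ (2 ^ j) * (2 * (C * (m + 1 : ℕ) ^ (2 ^ j))), by positivity,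
    fun L _ D hD ι κ _ _ a b g hg hab hd δ hδ => ?_⟩
  set k := 2 ^ j with hk
  rcases Nat.eq_zero_or_pos δ with rfl | hδ0
  · have : ∀ x, margin D m a b g 0 x = 0 := by intro x; simp [margin, pI]
    simp only [this]
    rw [zero_pow (by positivity), sum_const_zero]
    positivity
  have hl : 0 < m * δ := by positivity
  have hexp : (2 ^ (j + 1) + 32 * m) * (D + 1) =
    2 ^ (j + 1) * D + 2 ^ (j + 1) + 32 * (m * D) + 32 * m := by ring
  have hmδ : m * δ ≤ 2 * (m * D) + m := by nlinarith
  have hj : 0 < 2 ^ j := by positivity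
  have hD1 : 2 ^ (j + 1) * D < L := by omega
  have hmD : D ≤ m * D := Nat.le_mul_of_pos_left D hm
  have hl6 : 6 * (m * δ) < L := by omega
  set l := m * δ with hldef
  set R := (D + 1) / l + 2 with hR
  have hdiv : (D + 1) / l * l ≤ D + 1 := Nat.div_mul_le_self _ _
  have hRl : (2 * R + 2) * l ≤ L := by
    have : (2 * R + 2) * l = 2 * ((D + 1) / l * l) + 6 * l := by rw [hR]; ring
    omega
  have hl' : (0 : ℤ) < l := by exact_mod_cast hl
  have hq : ∀ c : ℤ, -(D : ℤ) - l ≤ c → c ≤ D + 1 → -(R : ℤ) ≤ c / l ∧ c / l ≤ R := by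
    intro c h1 h2
    have hup : ((D + 1 : ℕ) : ℤ) < (((D + 1) / l + 1 : ℕ) : ℤ) * l := by
      have := Nat.lt_mul_div_succ (D + 1) hl
      rw [mul_comm] at this
      exact_mod_cast this
    constructor
    · rw [Int.le_ediv_iff_mul_le hl', hR]
      push_cast at hup ⊢
      nlinarith
    · refine Int.le_of_lt_add_one ((Int.ediv_lt_iff_lt_mul hl').2 ?_)
      rw [hR]
      push_cast at hup ⊢
      nlinarith
  set I : Finset (ι × κ) := univ.filter (fun i => δ ≤ (b i - a i).toNat) with hI
  have hlen : ∀ i ∈ I, a i + δ ≤ b i := by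
    intro i hi
    have := (mem_filter.1 hi).2
    have := hab i
    omega
  have hleft := h L D hD1 l R (m + 1) hl hl6 hRl ι κ I (fun i => a i - l) g hg
    (fun i _ => hq _ (by have := hab i; omega) (by have := hab i; omega)) (by
      intro μ q
      refine card_le_of_disjoint hδ0 (e := a) (P := (q + 1) * l) ?_ ?_
      · rintro ⟨μ₁, κ₁⟩ h1 ⟨μ₂, κ₂⟩ h2 h12
        simp only [coe_filter, Set.mem_ofPred_eq, Prod.mk.injEq] at h1 h2
        obtain ⟨h1, rfl, -⟩ := h1
        obtain ⟨h2, rfl, -⟩ := h2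
        refine (hd μ₂ κ₁ κ₂ (by rintro rfl; exact h12 rfl)).mono ?_ ?_
        · exact Ico_subset_Ico_right (hlen _ h1)
        · exact Ico_subset_Ico_right (hlen _ h2)
      · intro i hi
        rw [mem_filter, Prod.mk.injEq] at hi
        have h1 := Int.ediv_mul_le (a i - l) hl'.ne'
        have h2 := Int.lt_ediv_add_one_mul_self (a i - l) hl'
        rw [hi.2.2] at h1 h2
        have h3 : ((m + 1 : ℕ) : ℤ) * δ = l + δ := by rw [hldef]; push_cast; ring
        rw [h3]
        constructor <;> linarith)
  have hright := h L D hD1 l R (m + 1) hl hl6 hRl ι κ I (fun i => b i) g hg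
    (fun i _ => hq _ (by have := hab i; omega) (by have := hab i; omega)) (by
      intro μ q
      refine card_le_of_disjoint hδ0 (e := fun i => b i - δ) (P := q * l - δ) ?_ ?_
      · rintro ⟨μ₁, κ₁⟩ h1 ⟨μ₂, κ₂⟩ h2 h12
        simp only [coe_filter, Set.mem_ofPred_eq, Prod.mk.injEq] at h1 h2
        obtain ⟨h1, rfl, -⟩ := h1
        obtain ⟨h2, rfl, -⟩ := h2
        refine (hd μ₂ κ₁ κ₂ (by rintro rfl; exact h12 rfl)).mono ?_ ?_
        · exact Ico_subset_Ico (by have := hlen _ h1; omega) (by omega)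
        · exact Ico_subset_Ico (by have := hlen _ h2; omega) (by omega)
      · intro i hi
        rw [mem_filter, Prod.mk.injEq] at hi
        have h1 := Int.ediv_mul_le (b i) hl'.ne'
        have h2 := Int.lt_ediv_add_one_mul_self (b i) hl'
        rw [hi.2.2] at h1 h2
        have h3 : ((m + 1 : ℕ) : ℤ) * δ = l + δ := by rw [hldef]; push_cast; ring
        rw [h3]
        constructor <;> linarith)
  simp only [sub_add_cancel] at hleft
  calc ∑ x, (margin D m a b g δ x) ^ k
      = ∑ x, (∑ i ∈ I, ‖pI D (a i - l) (a i) (g i.1) x‖ ^ 2 +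
          ∑ i ∈ I, ‖pI D (b i) (b i + l) (g i.1) x‖ ^ 2) ^ k := by
        simp only [margin, sum_add_distrib]; rfl
    _ ≤ ∑ x, 2 ^ k * ((∑ i ∈ I, ‖pI D (a i - l) (a i) (g i.1) x‖ ^ 2) ^ k +
          (∑ i ∈ I, ‖pI D (b i) (b i + l) (g i.1) x‖ ^ 2) ^ k) := by
        refine sum_le_sum fun x _ => ?_
        refine (add_pow_le (by positivity) (by positivity) k).trans ?_
        gcongr
        · norm_num
        · omega
    _ ≤ _ := by
        rw [← mul_sum, sum_add_distrib, mul_assoc]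
        refine mul_le_mul_of_nonneg_left ?_ (by positivity)
        linarith

end RubioDeFranciaMain

section RubioDeFranciaSquare

open Finset ComplexConjugate

variable {L : ℕ} [NeZero L]

theorem norm_add_sq_le_two_mul (u v : ℂ) : ‖u + v‖ ^ 2 ≤ 2 * (‖u‖ ^ 2 + ‖v‖ ^ 2) := by
  simpa using norm_sub_sq_le u (-v)

theorem tuple_bound {m D : ℕ} (hL : (10 * m + 2) * (D + 1) < L) {ι κ : Type} [Fintype ι]
    [Fintype κ] (a b : ι × κ → ℤ) (g : ι → ZMod L → ℂ)
    (hg : ∀ i, g i ∈ Sp L (Set.Icc (-(D : ℤ)) D))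
    (hab : ∀ i, -(D : ℤ) ≤ a i ∧ a i ≤ b i ∧ b i ≤ D + 1)
    (hd : ∀ μ κ₁ κ₂, κ₁ ≠ κ₂ →
      Disjoint (Ico (a (μ, κ₁)) (b (μ, κ₁))) (Ico (a (μ, κ₂)) (b (μ, κ₂))))
    (hm : 0 < m) (t : Fin m → ι × κ) (δ : ℕ) (ht : ∀ r, (b (t r) - a (t r)).toNat ≤ δ)
    (hδ : δ ≤ 2 * D + 1) :
    ∑ i : ι × κ with δ ≤ (b i - a i).toNat, ∑ x, ‖pI D (a i) (b i) (g i.1) x‖ ^ 2 *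
        ∏ r, ‖pI D (a (t r)) (b (t r)) (g (t r).1) x‖ ^ 2 ≤
      4 * (m + 1) * ∑ x, (∑ i, ‖g i x‖ ^ 2 + margin D m a b g δ x) *
        ∏ r, ‖pI D (a (t r)) (b (t r)) (g (t r).1) x‖ ^ 2 := by
  classical
  set I : Finset (ι × κ) := univ.filter (fun i => δ ≤ (b i - a i).toNat) with hI
  set G : ZMod L → ℂ := ∏ r, pI D (a (t r)) (b (t r)) (g (t r).1) with hGdef
  have hGx : ∀ x, ∏ r, ‖pI D (a (t r)) (b (t r)) (g (t r).1) x‖ ^ 2 = ‖G x‖ ^ 2 := by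
    intro x
    rw [hGdef, Finset.prod_apply, norm_prod, prod_pow]
  simp only [hGx]
  set l := m * δ with hl
  set A := ∑ r, a (t r) with hA
  have hG : G ∈ Sp L (Set.Icc A (A + l - 1)) := by
    refine Sp_mono ?_ (prod_mem_Sp univ _ _ _ fun r _ => pI_mem_Sp (hab (t r)).2.1 (g (t r).1))
    refine Set.Icc_subset_Icc le_rfl ?_
    calc ∑ r, (b (t r) - 1) ≤ ∑ r, (a (t r) + (δ - 1)) := by
          refine sum_le_sum fun r _ => ?_
          have := ht r
          omega
      _ = A + m * (δ - 1) := by rw [sum_add_distrib]; simp [hA]; ring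
      _ ≤ _ := by
          rw [hl]; push_cast
          have : (1 : ℤ) ≤ m := by exact_mod_cast hm
          linarith
  have hAabs : |A| ≤ m * (D + 1) := by
    calc |A| ≤ ∑ r, |a (t r)| := abs_sum_le_sum_abs _ _
      _ ≤ ∑ r : Fin m, ((D : ℤ) + 1) := by
          refine sum_le_sum fun r _ => abs_le.2 ?_
          have := hab (t r)
          constructor <;> omega
      _ = _ := by simp
  have hA' := abs_le.1 (le_refl |A|)
  have hlm : (l : ℤ) ≤ 2 * (m * (D + 1)) := by
    have h2 : l ≤ 2 * (m * (D + 1)) := by rw [hl]; nlinarith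
    exact_mod_cast h2
  set B := 4 * (m * (D + 1)) + (D + 1) with hB
  have hBL : 2 * B < L := by
    have : (10 * m + 2) * (D + 1) = 10 * (m * (D + 1)) + 2 * (D + 1) := by ring
    have : 0 < m * (D + 1) := by positivity
    omega
  have hB1 : (D : ℤ) + |A| + l ≤ B := by rw [hB]; push_cast; linarith
  have hBE : ∀ i, -(B : ℤ) ≤ a i + A ∧ b i + A + l ≤ B := by
    intro i
    have := hab i
    have h3 : (B : ℤ) = 4 * (m * (D + 1)) + (D + 1) := by rw [hB]; push_cast; ring
    constructor <;> omega
  have hDR : DR L (Set.Icc (-(B : ℤ)) B) := DR_Icc (by omega)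
  set E : ι × κ → Finset ℤ := fun i => Ico (a i + A) (b i + A + l) with hE
  set v : ι × κ → ZMod L → ℂ := fun i => pI D (a i - l) (a i) (g i.1) + pI D (b i) (b i + l) (g i.1)
    with hv
  have h1 : ∀ i x, ‖pI D (a i) (b i) (g i.1) x‖ ^ 2 * ‖G x‖ ^ 2 ≤
      2 * (‖proj (E i) (g i.1 * G) x‖ ^ 2 + ‖proj (E i) (v i * G) x‖ ^ 2) := by
    intro i x
    have := congrFun (pI_mul_eq (hab i).2.1 hBL hB1 (hab i).1 (hab i).2.2 (hg i.1) hG) x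
    rw [Pi.mul_apply, Pi.sub_apply] at this
    rw [← mul_pow, ← norm_mul, this]
    exact norm_sub_sq_le _ _
  have h2 : ∑ i ∈ I, ∑ x, ‖proj (E i) (g i.1 * G) x‖ ^ 2 ≤
      (m + 1) * ∑ x, (∑ i, ‖g i x‖ ^ 2) * ‖G x‖ ^ 2 := by
    have h3 : ∀ μ, ∑ κ₁ with (μ, κ₁) ∈ I, ∑ x, ‖proj (E (μ, κ₁)) (g μ * G) x‖ ^ 2 ≤
        (m + 1) * ∑ x, ‖g μ x‖ ^ 2 * ‖G x‖ ^ 2 := by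
      intro μ
      have := bessel_enlarged (s := univ.filter fun κ₁ => (μ, κ₁) ∈ I)
        (a := fun κ₁ => a (μ, κ₁)) (b := fun κ₁ => b (μ, κ₁)) (B := B) (δ := δ) (m := m) (A := A)
        hBL (by
          intro κ₁ h
          have := (mem_filter.1 (mem_filter.1 h).2).2
          have := hab (μ, κ₁)
          omega) (fun κ₁ _ κ₂ _ h => hd μ κ₁ κ₂ h) (fun κ₁ _ => by
          have := hBE (μ, κ₁)
          rw [hl] at this; push_cast at this; exact this) (g μ * G)
      simp only [Pi.mul_apply, norm_mul, mul_pow] at this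
      refine le_trans (le_of_eq ?_) this
      refine sum_congr rfl fun κ₁ _ => ?_
      simp only [hE, hl]; push_cast; rfl
    calc _ = ∑ μ, ∑ κ₁ with (μ, κ₁) ∈ I, ∑ x, ‖proj (E (μ, κ₁)) (g μ * G) x‖ ^ 2 := by
          simp only [sum_filter]
          rw [← Fintype.sum_prod_type' (f := fun μ κ₁ => if (μ, κ₁) ∈ I then
            ∑ x, ‖proj (E (μ, κ₁)) (g μ * G) x‖ ^ 2 else 0), sum_ite_mem, univ_inter]
      _ ≤ ∑ μ, (m + 1) * ∑ x, ‖g μ x‖ ^ 2 * ‖G x‖ ^ 2 := sum_le_sum fun μ _ => h3 μ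
      _ = _ := by
          rw [← mul_sum, sum_comm]
          simp only [sum_mul]
  have h4 : ∑ i ∈ I, ∑ x, ‖proj (E i) (v i * G) x‖ ^ 2 ≤
      2 * ∑ x, margin D m a b g δ x * ‖G x‖ ^ 2 := by
    calc _ ≤ ∑ i ∈ I, ∑ x, ‖(v i * G) x‖ ^ 2 := by
          refine sum_le_sum fun i _ => bessel_proj (hDR.mono ?_) _
          intro k hk
          have := hBE i
          simp only [hE, coe_Ico, Set.mem_Ico] at hk
          constructor <;> omega
      _ ≤ ∑ i ∈ I, ∑ x, 2 * (‖pI D (a i - l) (a i) (g i.1) x‖ ^ 2 +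
            ‖pI D (b i) (b i + l) (g i.1) x‖ ^ 2) * ‖G x‖ ^ 2 := by
          refine sum_le_sum fun i _ => sum_le_sum fun x _ => ?_
          rw [Pi.mul_apply, norm_mul, mul_pow]
          exact mul_le_mul_of_nonneg_right (norm_add_sq_le_two_mul _ _) (by positivity)
      _ = _ := by
          rw [sum_comm, mul_sum]
          refine sum_congr rfl fun x _ => ?_
          rw [margin, ← sum_mul, ← mul_sum, ← mul_assoc]
  calc _ ≤ ∑ i ∈ I, ∑ x, 2 * (‖proj (E i) (g i.1 * G) x‖ ^ 2 + ‖proj (E i) (v i * G) x‖ ^ 2) :=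
        sum_le_sum fun i _ => sum_le_sum fun x _ => h1 i x
    _ = 2 * (∑ i ∈ I, ∑ x, ‖proj (E i) (g i.1 * G) x‖ ^ 2) +
        2 * ∑ i ∈ I, ∑ x, ‖proj (E i) (v i * G) x‖ ^ 2 := by
        simp only [← mul_sum, sum_add_distrib, mul_add]
    _ ≤ 2 * ((m + 1) * ∑ x, (∑ i, ‖g i x‖ ^ 2) * ‖G x‖ ^ 2) +
        2 * (2 * ∑ x, margin D m a b g δ x * ‖G x‖ ^ 2) := by gcongr
    _ ≤ _ := by
        simp only [add_mul, sum_add_distrib]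
        have h5 : 0 ≤ ∑ x, (∑ i, ‖g i x‖ ^ 2) * ‖G x‖ ^ 2 := by positivity
        have h6 : 0 ≤ ∑ x, margin D m a b g δ x * ‖G x‖ ^ 2 :=
          sum_nonneg fun x _ => mul_nonneg (margin_nonneg _ _ _ _ _ _ _) (by positivity)
        have h7 : (1 : ℝ) ≤ m := by exact_mod_cast hm
        nlinarith

/-- Rubio de Francia's inequality for a family of functions in `L^{2 k}` with a loss depending on
the number of intervals. -/
theorem rubio_de_francia_spectrum (j : ℕ) : ∃ C : ℝ, 0 < C ∧ ∃ c : ℕ, ∀ (L : ℕ) [NeZero L] (D : ℕ),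
    c * (D + 1) < L → ∀ (ι κ : Type) [Fintype ι] [Fintype κ]
      (a b : ι × κ → ℤ) (g : ι → ZMod L → ℂ),
    (∀ i, g i ∈ Sp L (Set.Icc (-(D : ℤ)) D)) →
    (∀ i, -(D : ℤ) ≤ a i ∧ a i ≤ b i ∧ b i ≤ D + 1) →
    (∀ μ κ₁ κ₂, κ₁ ≠ κ₂ → Disjoint (Ico (a (μ, κ₁)) (b (μ, κ₁))) (Ico (a (μ, κ₂)) (b (μ, κ₂)))) →
    ∑ x, (∑ i : ι × κ, ‖pI D (a i) (b i) (g i.1) x‖ ^ 2) ^ (2 ^ j) ≤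
      C * Fintype.card (ι × κ) * ∑ x, (∑ i, ‖g i x‖ ^ 2) ^ (2 ^ j) := by
  classical
  rcases Nat.eq_zero_or_pos j with rfl | hj
  · refine ⟨1, one_pos, 2, fun L _ D hD ι κ _ _ a b g hg hab hd => ?_⟩
    simp only [pow_zero, pow_one, one_mul]
    have hDR : DR L (Set.Icc (-(D : ℤ)) D) := DR_Icc (by omega)
    rcases isEmpty_or_nonempty (ι × κ) with he | he
    · simp
    have hc : (1 : ℝ) ≤ Fintype.card (ι × κ) := by exact_mod_cast Fintype.card_pos
    have h0 : 0 ≤ ∑ x, ∑ i, ‖g i x‖ ^ 2 := by positivity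
    refine le_trans ?_ (le_mul_of_one_le_left h0 hc)
    rw [sum_comm, sum_comm (s := univ (α := ZMod L)), Fintype.sum_prod_type]
    refine sum_le_sum fun μ _ => ?_
    simp only [pI_eq (hab _).2.1]
    refine bessel_family hDR (fun κ₁ _ => ?_) (fun κ₁ _ κ₂ _ h => ?_) (g μ)
    · intro k hk
      simp only [coe_filter, mem_Icc, Set.mem_ofPred_eq] at hk
      exact hk.1
    · refine (hd μ κ₁ κ₂ h).mono ?_ ?_ <;>
      · intro k hk
        simp only [mem_filter] at hk
        exact mem_Ico.2 hk.2
  obtain ⟨m, hm⟩ : ∃ m, 2 ^ j = m + 1 := ⟨2 ^ j - 1, by have := Nat.one_le_two_pow (n := j); omega⟩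
  have hm0 : 0 < m := by
    have : 2 ^ 1 ≤ 2 ^ j := Nat.pow_le_pow_right two_pos hj
    omega
  obtain ⟨C, hC, hmargin⟩ := margin_bound j m hm0
  set K : ℝ := (m + 1) * (4 * (m + 1)) with hK
  refine ⟨2 * (2 * K) ^ (m + 1) * (2 ^ (m + 1) * (1 + C)), by positivity,
    2 ^ (j + 1) + 32 * m + 2, fun L _ D hD ι κ _ _ a b g hg hab hd => ?_⟩
  rw [hm]
  rcases isEmpty_or_nonempty (ι × κ) with he | he
  · simp
  have hL1 : (10 * m + 2) * (D + 1) < L :=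
    lt_of_le_of_lt (Nat.mul_le_mul_right _ (by omega)) hD
  have hL2 : (2 ^ (j + 1) + 32 * m) * (D + 1) < L :=
    lt_of_le_of_lt (Nat.mul_le_mul_right _ (by omega)) hD
  set len : ι × κ → ℕ := fun i => (b i - a i).toNat with hlen
  have hlenD : ∀ i, len i ≤ 2 * D + 1 := by
    intro i; have := hab i; simp only [hlen]; omega
  set w : ι × κ → ZMod L → ℝ := fun i x => ‖pI D (a i) (b i) (g i.1) x‖ ^ 2 with hw
  have hw0 : ∀ i x, 0 ≤ w i x := fun i x => by positivity
  set S : ZMod L → ℝ := fun x => ∑ i, w i x with hS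
  have hS0 : ∀ x, 0 ≤ S x := fun x => sum_nonneg fun i _ => hw0 i x
  set F : ZMod L → ℝ := fun x => ∑ i, ‖g i x‖ ^ 2 with hF
  have hF0 : ∀ x, 0 ≤ F x := fun x => by positivity
  set U : ZMod L → ℝ := fun x => univ.sup' univ_nonempty fun i => margin D m a b g (len i) x with hU
  have hUle : ∀ i x, margin D m a b g (len i) x ≤ U x := fun i x =>
    le_sup' (fun i => margin D m a b g (len i) x) (mem_univ i)
  have hU0 : ∀ x, 0 ≤ U x := fun x =>
    (margin_nonneg D m a b g _ x).trans (hUle he.some x)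
  have htuple : ∀ t : Fin m → ι × κ,
      ∑ i with ∀ r, len (t r) ≤ len i, ∑ x, w i x * ∏ r, w (t r) x ≤
        4 * (m + 1) * ∑ x, (F x + U x) * ∏ r, w (t r) x := by
    intro t
    have : Nonempty (Fin m) := ⟨⟨0, hm0⟩⟩
    obtain ⟨r₀, -, hr₀⟩ := exists_max_image univ (fun r => len (t r)) univ_nonempty
    have hset : (univ.filter fun i => ∀ r, len (t r) ≤ len i) =
        univ.filter fun i => len (t r₀) ≤ len i := by
      ext i
      simp only [mem_filter, mem_univ, true_and]
      exact ⟨fun h => h r₀, fun h r => (hr₀ r (mem_univ r)).trans h⟩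
    rw [hset]
    refine (tuple_bound hL1 a b g hg hab hd hm0 t (len (t r₀)) (fun r => hr₀ r (mem_univ r))
      (hlenD _)).trans ?_
    gcongr with x
    exact hUle (t r₀) x
  have hmain : ∑ x, S x ^ (m + 1) ≤ K * ∑ x, (F x + U x) * S x ^ m := by
    calc ∑ x, S x ^ (m + 1)
        ≤ ∑ x, (m + 1) * ∑ i, w i x * (∑ j with len j ≤ len i, w j x) ^ m :=
          sum_le_sum fun x _ => pow_sum_le univ (fun i => w i x) (fun i => hw0 i x) len m
      _ = (m + 1) * ∑ t : Fin m → ι × κ, ∑ i with ∀ r, len (t r) ≤ len i,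
            ∑ x, w i x * ∏ r, w (t r) x := by
          rw [← mul_sum, sum_comm]
          congr 1
          simp only [sum_filter]
          rw [sum_comm (s := univ (α := Fin m → ι × κ))]
          refine sum_congr rfl fun i _ => ?_
          rw [← sum_filter, sum_comm]
          refine sum_congr rfl fun x _ => ?_
          rw [← mul_sum, ← sum_filter, sum_pow']
          congr 1
          refine sum_congr ?_ fun _ _ => rfl
          ext t
          simp
      _ ≤ (m + 1) * ∑ t : Fin m → ι × κ, 4 * (m + 1) * ∑ x, (F x + U x) * ∏ r, w (t r) x := by
          gcongr with t
          exact htuple t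
      _ = _ := by
          rw [← mul_sum, ← mul_assoc, ← hK, sum_comm]
          congr 1
          refine sum_congr rfl fun x _ => ?_
          rw [← mul_sum, hS]
          congr 1
          simp only [sum_pow', Fintype.piFinset_univ]
  have hK0 : 0 < K := by positivity
  have hpt : ∀ x, K * ((F x + U x) * S x ^ m) ≤
      S x ^ (m + 1) / 2 + (2 * K) ^ (m + 1) * (F x + U x) ^ (m + 1) := by
    intro x
    have hH : 0 ≤ F x + U x := add_nonneg (hF0 x) (hU0 x)
    have hSm : 0 ≤ S x ^ m := pow_nonneg (hS0 x) m
    rcases le_total (2 * K * (F x + U x)) (S x) with h | h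
    · have h1 : 0 ≤ (2 * K) ^ (m + 1) * (F x + U x) ^ (m + 1) := by positivity
      rw [pow_succ (S x)]
      nlinarith
    · have h1 : S x ^ m ≤ (2 * K * (F x + U x)) ^ m := pow_le_pow_left₀ (hS0 x) h m
      have h2 : 0 ≤ S x ^ (m + 1) := pow_nonneg (hS0 x) _
      rw [← mul_pow, pow_succ (2 * K * (F x + U x))]
      have h3 : 0 ≤ K * (F x + U x) := by positivity
      have h4 := mul_le_mul_of_nonneg_left h1 h3
      have h5 : 0 ≤ (2 * K * (F x + U x)) ^ m := by positivity
      nlinarith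
  have hS2 : ∑ x, S x ^ (m + 1) ≤ 2 * (2 * K) ^ (m + 1) * ∑ x, (F x + U x) ^ (m + 1) := by
    have := sum_le_sum fun x (_ : x ∈ univ (α := ZMod L)) => hpt x
    rw [← mul_sum, sum_add_distrib, ← sum_div, ← mul_sum] at this
    linarith
  refine hS2.trans ?_
  rw [mul_assoc (2 * (2 * K) ^ (m + 1)), mul_assoc (2 * (2 * K) ^ (m + 1))]
  refine mul_le_mul_of_nonneg_left ?_ (by positivity)
  have hUsum : ∑ x, U x ^ (m + 1) ≤ Fintype.card (ι × κ) * (C * ∑ x, F x ^ (m + 1)) := by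
    calc ∑ x, U x ^ (m + 1) ≤ ∑ x, ∑ i, margin D m a b g (len i) x ^ (m + 1) := by
          refine sum_le_sum fun x _ => ?_
          obtain ⟨i, hi, h⟩ := exists_mem_eq_sup' univ_nonempty
            fun i => margin D m a b g (len i) x
          simp only [hU]
          rw [h]
          exact single_le_sum (f := fun i => margin D m a b g (len i) x ^ (m + 1))
            (fun i _ => pow_nonneg (margin_nonneg _ _ _ _ _ _ _) _) hi
      _ ≤ ∑ i : ι × κ, C * ∑ x, F x ^ (m + 1) := by
          rw [sum_comm]
          refine sum_le_sum fun i _ => ?_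
          have := hmargin L D hL2 ι κ a b g hg hab hd (len i) (hlenD i)
          rwa [hm] at this
      _ = _ := by simp
  have hc : (1 : ℝ) ≤ Fintype.card (ι × κ) := by exact_mod_cast Fintype.card_pos
  have hFs : 0 ≤ ∑ x, F x ^ (m + 1) := sum_nonneg fun x _ => pow_nonneg (hF0 x) _
  calc ∑ x, (F x + U x) ^ (m + 1) ≤ ∑ x, 2 ^ (m + 1) * (F x ^ (m + 1) + U x ^ (m + 1)) := by
        refine sum_le_sum fun x _ => (add_pow_le (hF0 x) (hU0 x) _).trans ?_
        refine mul_le_mul_of_nonneg_right (pow_le_pow_right₀ (by norm_num) (by omega)) ?_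
        exact add_nonneg (pow_nonneg (hF0 x) _) (pow_nonneg (hU0 x) _)
    _ = 2 ^ (m + 1) * (∑ x, F x ^ (m + 1) + ∑ x, U x ^ (m + 1)) := by
        rw [← mul_sum, sum_add_distrib]
    _ ≤ 2 ^ (m + 1) * (Fintype.card (ι × κ) * ∑ x, F x ^ (m + 1) +
          Fintype.card (ι × κ) * (C * ∑ x, F x ^ (m + 1))) := by
        gcongr
        exact le_mul_of_one_le_left hFs hc
    _ = _ := by ring

end RubioDeFranciaSquare

section Rectangles

open Finset ComplexConjugate

variable {L : ℕ} [NeZero L]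

theorem conv_comm (c g : ZMod L → ℂ) : conv c g = conv g c := by
  ext x
  simp only [conv]
  rw [← Equiv.sum_comp (Equiv.subLeft x)]
  congr 1
  refine sum_congr rfl fun y _ => ?_
  simp [mul_comm]

theorem vp_mem_Sp {l : ℕ} (q : ℤ) :
    vp L l q ∈ Sp L (Set.Icc ((q - 1) * l) ((q + 3) * l)) := by
  have h1 : ∀ m : ℕ, geo L m ∈ Sp L (Set.Icc 0 (m : ℤ)) := fun m => by
    have : geo L m = ∑ k ∈ range m, chi L k := by ext x; simp [geo]
    rw [this]
    refine Submodule.sum_mem _ fun k hk => chi_mem_Sp ?_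
    have := mem_range.1 hk
    constructor <;> omega
  have h2 : (fun x => conj (geo L l x)) ∈ Sp L (Set.Icc (-(l : ℤ)) 0) :=
    conj_mem_Sp (h1 l) fun a ha => ⟨by linarith [ha.2], by linarith [ha.1]⟩
  have h3 := mul_mem_Sp (u := Set.Icc (-(l : ℤ)) (3 * l)) (h1 (3 * l)) h2 fun a ha b hb => by
    have := ha.1; have := ha.2; have := hb.1; have := hb.2
    push_cast at *
    constructor <;> linarith
  have h4 := mul_mem_Sp (u := Set.Icc ((q - 1) * l) ((q + 3) * l)) h3
    (chi_mem_Sp (L := L) (s := {q * l}) (Set.mem_singleton _)) fun a ha b hb => by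
    have := ha.1; have := ha.2
    rw [Set.mem_singleton_iff] at hb
    subst hb
    constructor <;> linarith
  have h5 := Submodule.smul_mem _ ((l : ℂ)⁻¹) h4
  convert h5 using 1
  ext x; simp [vp, mul_assoc]

/-- An integer interval contained in `[-K, K]`. -/
def IsIv (K : ℕ) (E : Finset ℤ) : Prop :=
  ∃ a b : ℤ, -(K : ℤ) ≤ a ∧ a ≤ b ∧ b ≤ K + 1 ∧ E = Ico a b

theorem IsIv.subset {K : ℕ} {E : Finset ℤ} (h : IsIv K E) : (E : Set ℤ) ⊆ Set.Icc (-(K : ℤ)) K := by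
  obtain ⟨a, b, h1, h2, h3, rfl⟩ := h
  intro k hk
  have := mem_Ico.1 (mem_coe.1 hk)
  constructor <;> omega

theorem isIv_of_ordConnected {K : ℕ} {E : Finset ℤ} (hE : (E : Set ℤ).OrdConnected)
    (hK : (E : Set ℤ) ⊆ Set.Icc (-(K : ℤ)) K) : IsIv K E := by
  rcases E.eq_empty_or_nonempty with rfl | hne
  · exact ⟨0, 0, by omega, le_rfl, by omega, by simp⟩
  · refine ⟨E.min' hne, E.max' hne + 1, (hK (E.min'_mem hne)).1, ?_, ?_, ?_⟩
    · have := E.min'_le_max' hne; omega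
    · have := (hK (E.max'_mem hne)).2; omega
    · ext k
      rw [mem_Ico, Order.lt_add_one_iff]
      exact ⟨fun h => ⟨E.min'_le k h, E.le_max' k h⟩, fun h =>
        hE.out (E.min'_mem hne) (E.max'_mem hne) h⟩

/-- Smooth truncation to frequencies in `[-2(K+1), 2(K+1)]`. -/
noncomputable def trunc (L : ℕ) [NeZero L] (K : ℕ) (f : ZMod L → ℂ) : ZMod L → ℂ :=
  conv (vp L (K + 1) (-1)) f

theorem trunc_mem_Sp (K : ℕ) (f : ZMod L → ℂ) :
    trunc L K f ∈ Sp L (Set.Icc (-((2 * (K + 1) : ℕ) : ℤ)) (2 * (K + 1) : ℕ)) := by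
  rw [trunc, conv_comm]
  refine Sp_mono ?_ (conv_mem_Sp (vp_mem_Sp _) f)
  refine Set.Icc_subset_Icc ?_ ?_ <;> push_cast <;> linarith

theorem pI_trunc {K : ℕ} (hL : 6 * (K + 1) < L) {a b : ℤ} (ha : -(K : ℤ) ≤ a) (hab : a ≤ b)
    (hb : b ≤ K + 1) (f : ZMod L → ℂ) :
    pI (2 * (K + 1)) a b (trunc L K f) = proj (Ico a b) f := by
  rw [pI_eq hab]
  have : ((Icc (-((2 * (K + 1) : ℕ) : ℤ)) (2 * (K + 1) : ℕ)).filter fun k => a ≤ k ∧ k < b) =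
      Ico a b := by
    ext k
    simp only [mem_filter, mem_Icc, mem_Ico]
    push_cast
    constructor
    · exact fun h => h.2
    · intro h; refine ⟨⟨?_, ?_⟩, h⟩ <;> linarith [h.1, h.2]
  rw [this]
  refine proj_congr fun k hk => ?_
  rw [mem_Ico] at hk
  rw [trunc, hat_conv, hat_vp (by omega) hL, one_mul] <;> push_cast <;> linarith [hk.1, hk.2]

theorem sum_trunc_le {K : ℕ} (hL : 4 * (K + 1) ≤ L) {ι : Type*} [Fintype ι]
    (g : ι → ZMod L → ℂ) (k : ℕ) :
    ∑ x, (∑ i, ‖trunc L K (g i) x‖ ^ 2) ^ k ≤ 9 ^ k * ∑ x, (∑ i, ‖g i x‖ ^ 2) ^ k := by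
  refine le_trans ?_ (smooth_sq (Nat.succ_pos K) (R := 1) (by omega) g k)
  refine sum_le_sum fun x _ => pow_le_pow_left₀ (by positivity) (sum_le_sum fun i _ => ?_) k
  exact single_le_sum (f := fun q => ‖conv (vp L (K + 1) q) (g i) x‖ ^ 2)
    (fun q _ => by positivity) (by simp : (-1 : ℤ) ∈ Icc (-((1 : ℕ) : ℤ)) (1 : ℕ))

/-- Vector-valued boundedness of interval projections. -/
theorem vector_proj (j : ℕ) : ∃ C : ℝ, 0 < C ∧ ∃ c : ℕ, ∀ (L : ℕ) [NeZero L] (K : ℕ),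
    c * (K + 1) < L → ∀ (ι : Type) [Fintype ι] (E : ι → Finset ℤ) (g : ι → ZMod L → ℂ),
    (∀ i, IsIv K (E i)) →
    ∑ x, (∑ i, ‖proj (E i) (g i) x‖ ^ 2) ^ (2 ^ j) ≤ C * ∑ x, (∑ i, ‖g i x‖ ^ 2) ^ (2 ^ j) := by
  obtain ⟨C, hC, h⟩ := cotlar_interval j
  refine ⟨C * 9 ^ 2 ^ j, by positivity, 6 + 2 ^ (j + 1) * 2, fun L _ K hL ι _ E g hE => ?_⟩
  choose a b h1 h2 h3 h4 using hE
  have hL1 : 6 * (K + 1) < L := by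
    have : 0 ≤ 2 ^ (j + 1) * 2 * (K + 1) := Nat.zero_le _
    nlinarith
  have hL2 : 2 ^ (j + 1) * (2 * (K + 1)) < L := by nlinarith
  have := h L (2 * (K + 1)) hL2 ι a b (fun i => trunc L K (g i)) fun i => trunc_mem_Sp K (g i)
  simp only [pI_trunc hL1 (h1 _) (h2 _) (h3 _), ← h4] at this
  refine this.trans ?_
  rw [mul_assoc]
  exact mul_le_mul_of_nonneg_left (sum_trunc_le (by omega) g _) hC.le

/-- Rubio de Francia's inequality with a small power loss in the number of intervals. -/
theorem rubio_de_francia (j : ℕ) : ∃ C : ℝ, 0 < C ∧ ∃ c : ℕ, ∀ (L : ℕ) [NeZero L] (K : ℕ),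
    c * (K + 1) < L → ∀ (ι κ : Type) [Fintype ι] [Fintype κ] (E : ι × κ → Finset ℤ)
      (g : ι → ZMod L → ℂ), (∀ i, IsIv K (E i)) →
    (∀ μ κ₁ κ₂, κ₁ ≠ κ₂ → Disjoint (E (μ, κ₁)) (E (μ, κ₂))) →
    ∑ x, (∑ i : ι × κ, ‖proj (E i) (g i.1) x‖ ^ 2) ^ (2 ^ j) ≤
      C * Fintype.card (ι × κ) * ∑ x, (∑ i, ‖g i x‖ ^ 2) ^ (2 ^ j) := by
  obtain ⟨C, hC, c, h⟩ := rubio_de_francia_spectrum j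
  refine ⟨C * 9 ^ 2 ^ j, by positivity, 6 + 3 * c, fun L _ K hL ι κ _ _ E g hE hd => ?_⟩
  choose a b h1 h2 h3 h4 using hE
  have hL1 : 6 * (K + 1) < L := by
    have : 0 ≤ 3 * c * (K + 1) := Nat.zero_le _
    nlinarith
  have hL2 : c * (2 * (K + 1) + 1) < L := by nlinarith
  have := h L (2 * (K + 1)) hL2 ι κ a b (fun i => trunc L K (g i))
    (fun i => trunc_mem_Sp K (g i))
    (fun i => ⟨by push_cast; linarith [h1 i], h2 i, by push_cast; linarith [h3 i]⟩)
    fun μ κ₁ κ₂ hne => by rw [← h4, ← h4]; exact hd μ κ₁ κ₂ hne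
  simp only [pI_trunc hL1 (h1 _) (h2 _) (h3 _), ← h4] at this
  refine this.trans ?_
  have h5 := mul_le_mul_of_nonneg_left (sum_trunc_le (by omega : 4 * (K + 1) ≤ L) g (2 ^ j))
    (by positivity : 0 ≤ C * (Fintype.card (ι × κ) : ℝ))
  refine h5.trans (le_of_eq (by ring))

/-- Projection of a function of two variables to a rectangle of frequencies. -/
noncomputable def rproj (E F : Finset ℤ) (f : ZMod L × ZMod L → ℂ) : ZMod L × ZMod L → ℂ :=
  fun z => proj F (fun y => proj E (fun x => f (x, y)) z.1) z.2

theorem vector_rproj (j : ℕ) : ∃ C : ℝ, 0 < C ∧ ∃ c : ℕ, ∀ (L : ℕ) [NeZero L] (K : ℕ),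
    c * (K + 1) < L → ∀ (ι : Type) [Fintype ι] (E F : ι → Finset ℤ) (g : ι → ZMod L × ZMod L → ℂ),
    (∀ i, IsIv K (E i)) → (∀ i, IsIv K (F i)) →
    ∑ z, (∑ i, ‖rproj (E i) (F i) (g i) z‖ ^ 2) ^ (2 ^ j) ≤
      C * ∑ z, (∑ i, ‖g i z‖ ^ 2) ^ (2 ^ j) := by
  obtain ⟨C, hC, c, h⟩ := vector_proj j
  refine ⟨C * C, by positivity, c, fun L _ K hL ι _ E F g hE hF => ?_⟩
  rw [Fintype.sum_prod_type, Fintype.sum_prod_type_right, mul_assoc, mul_sum]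
  calc _ ≤ ∑ x, C * ∑ y, (∑ i, ‖proj (E i) (fun x => g i (x, y)) x‖ ^ 2) ^ (2 ^ j) :=
        sum_le_sum fun x _ => h L K hL ι F (fun i y => proj (E i) (fun x => g i (x, y)) x) hF
    _ = C * ∑ y, ∑ x, (∑ i, ‖proj (E i) (fun x => g i (x, y)) x‖ ^ 2) ^ (2 ^ j) := by
        rw [← mul_sum, sum_comm]
    _ ≤ _ := by
        gcongr with y
        exact h L K hL ι E (fun i x => g i (x, y)) hE

theorem rubio_de_francia_rproj (j : ℕ) : ∃ C : ℝ, 0 < C ∧ ∃ c : ℕ, ∀ (L : ℕ) [NeZero L] (K : ℕ),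
    c * (K + 1) < L → ∀ (ι κ : Type) [Fintype ι] [Fintype κ] (E : ι → Finset ℤ)
      (F : ι × κ → Finset ℤ) (f : ZMod L × ZMod L → ℂ),
    (∀ i, IsIv K (E i)) → (∀ i, IsIv K (F i)) →
    (∀ μ₁ μ₂, μ₁ ≠ μ₂ → Disjoint (E μ₁) (E μ₂)) →
    (∀ μ κ₁ κ₂, κ₁ ≠ κ₂ → Disjoint (F (μ, κ₁)) (F (μ, κ₂))) →
    ∑ z, (∑ i : ι × κ, ‖rproj (E i.1) (F i) f z‖ ^ 2) ^ (2 ^ j) ≤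
      C * (Fintype.card (ι × κ) : ℝ) ^ 2 * ∑ z, (‖f z‖ ^ 2) ^ (2 ^ j) := by
  obtain ⟨C, hC, c, h⟩ := rubio_de_francia j
  refine ⟨C * C, by positivity, c, fun L _ K hL ι κ _ _ E F f hE hF hd hd' => ?_⟩
  rcases isEmpty_or_nonempty κ with hκ | hκ
  · simp
  have hcard : (Fintype.card ι : ℝ) ≤ Fintype.card (ι × κ) := by
    rw [Fintype.card_prod]
    exact_mod_cast Nat.le_mul_of_pos_right _ Fintype.card_pos
  set M : ℝ := ((Fintype.card (ι × κ) : ℕ) : ℝ)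
  rw [Fintype.sum_prod_type, Fintype.sum_prod_type_right]
  calc _ ≤ ∑ x, C * M * ∑ y, (∑ i, ‖proj (E i) (fun x => f (x, y)) x‖ ^ 2) ^ (2 ^ j) :=
        sum_le_sum fun x _ => h L K hL ι κ F (fun i y => proj (E i) (fun x => f (x, y)) x) hF hd'
    _ = C * M * ∑ y, ∑ x, (∑ i, ‖proj (E i) (fun x => f (x, y)) x‖ ^ 2) ^ (2 ^ j) := by
        rw [← mul_sum, sum_comm]
    _ ≤ C * M * ∑ y, (C * M * ∑ x, (‖f (x, y)‖ ^ 2) ^ (2 ^ j)) := by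
        gcongr with y
        have := h L K hL Unit ι (fun i => E i.2) (fun _ x => f (x, y)) (fun i => hE i.2)
          fun _ a b hab => hd a b hab
        simp only [univ_unique, sum_singleton, Fintype.sum_prod_type, Fintype.card_prod,
          Fintype.card_unit, one_mul] at this
        refine this.trans ?_
        gcongr
    _ = _ := by rw [← mul_sum]; ring

/-- Characters of `ZMod L × ZMod L`. -/
noncomputable def chi2 (L : ℕ) [NeZero L] (ξ : ℤ × ℤ) (z : ZMod L × ZMod L) : ℂ :=
  chi L ξ.1 z.1 * chi L ξ.2 z.2

/-- Fourier coefficients on `ZMod L × ZMod L`. -/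
noncomputable def hat2 (f : ZMod L × ZMod L → ℂ) (ξ : ℤ × ℤ) : ℂ :=
  ((L : ℂ) ^ 2)⁻¹ * ∑ z, f z * conj (chi2 L ξ z)

theorem rproj_apply (E F : Finset ℤ) (f : ZMod L × ZMod L → ℂ) (z : ZMod L × ZMod L) :
    rproj E F f z = ∑ ξ ∈ E ×ˢ F, hat2 f ξ * chi2 L ξ z := by
  rw [sum_product_right]
  simp only [rproj, proj_apply, hat, sum_mul, mul_sum]
  refine sum_congr rfl fun l _ => ?_
  rw [sum_comm]
  refine sum_congr rfl fun k _ => ?_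
  simp only [hat2, sum_mul, mul_sum]
  rw [Fintype.sum_prod_type_right]
  refine sum_congr rfl fun y _ => sum_congr rfl fun x _ => ?_
  simp only [chi2, map_mul, chi_neg]
  ring

theorem sum_rproj_mul_conj (E F : Finset ℤ) (f g : ZMod L × ZMod L → ℂ) :
    ∑ z, rproj E F f z * conj (g z) = ∑ z, f z * conj (rproj E F g z) := by
  have h : ∀ f g : ZMod L × ZMod L → ℂ, ∑ z, f z * conj (rproj E F g z) =
      ∑ ξ ∈ E ×ˢ F, (L : ℂ) ^ 2 * hat2 f ξ * conj (hat2 g ξ) := fun f g => by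
    have hL : (L : ℂ) ^ 2 ≠ 0 := pow_ne_zero _ (by exact_mod_cast NeZero.ne L)
    simp only [rproj_apply, map_sum, map_mul, mul_sum]
    rw [sum_comm]
    refine sum_congr rfl fun ξ _ => ?_
    have h0 : (L : ℂ) ^ 2 * hat2 f ξ = ∑ z, f z * conj (chi2 L ξ z) := by
      rw [hat2, mul_inv_cancel_left₀ hL]
    rw [h0, sum_mul]
    exact sum_congr rfl fun x _ => by ring
  have h' : ∑ z, rproj E F f z * conj (g z) = conj (∑ z, g z * conj (rproj E F f z)) := by
    simp [map_sum, mul_comm]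
  rw [h', h, h, map_sum]
  refine sum_congr rfl fun k _ => ?_
  simp; ring

end Rectangles

section Interpolation

open Finset ComplexConjugate

/-- The `L^p` norm on a finite type, with counting measure, as a function of `a = 1 / p`. -/
noncomputable def nrm {X : Type*} [Fintype X] (a : ℝ) (f : X → ℝ) : ℝ := (∑ x, f x ^ a⁻¹) ^ a

/-- The `ℓ²` norm of a finite family of complex numbers. -/
noncomputable def l2 {I : Type*} [Fintype I] (g : I → ℂ) : ℝ := √(∑ i, ‖g i‖ ^ 2)

theorem l2_nonneg {I : Type*} [Fintype I] (g : I → ℂ) : 0 ≤ l2 g := Real.sqrt_nonneg _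

theorem l2_sq {I : Type*} [Fintype I] (g : I → ℂ) : l2 g ^ 2 = ∑ i, ‖g i‖ ^ 2 :=
  Real.sq_sqrt (by positivity)

theorem l2_smul {I : Type*} [Fintype I] (g : I → ℂ) (c : ℂ) :
    l2 (fun i => c * g i) = ‖c‖ * l2 g := by
  simp only [l2, norm_mul, mul_pow, ← mul_sum]
  rw [Real.sqrt_mul (by positivity), Real.sqrt_sq (norm_nonneg _)]

theorem norm_le_l2 {I : Type*} [Fintype I] (g : I → ℂ) (i : I) : ‖g i‖ ≤ l2 g :=
  Real.le_sqrt_of_sq_le (single_le_sum (f := fun i => ‖g i‖ ^ 2) (fun _ _ => by positivity)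
    (mem_univ i))

theorem nrm_nonneg {X : Type*} [Fintype X] (a : ℝ) {f : X → ℝ} (hf : ∀ x, 0 ≤ f x) :
    0 ≤ nrm a f :=
  Real.rpow_nonneg (sum_nonneg fun x _ => Real.rpow_nonneg (hf x) _) _

theorem nrm_mono {X : Type*} [Fintype X] {a : ℝ} (ha : 0 < a) {f g : X → ℝ} (hf : ∀ x, 0 ≤ f x)
    (h : ∀ x, f x ≤ g x) : nrm a f ≤ nrm a g :=
  Real.rpow_le_rpow (sum_nonneg fun x _ => Real.rpow_nonneg (hf x) _)
    (sum_le_sum fun x _ => Real.rpow_le_rpow (hf x) (h x) (inv_nonneg.2 ha.le)) ha.le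

theorem mul_norm_cexp {v : ℝ} (hv : 0 ≤ v) {c : ℂ} (hc : c.re ≠ 0) :
    v * ‖cexp ((c - 1) * (Real.log v : ℂ))‖ = v ^ c.re := by
  rcases hv.eq_or_lt with rfl | hv
  · simp [Real.zero_rpow hc]
  · rw [Complex.norm_exp, Complex.re_mul_ofReal, sub_re, one_re, sub_mul, one_mul, Real.exp_sub,
      Real.exp_log hv, mul_div_cancel₀ _ hv.ne', Real.rpow_def_of_pos hv, mul_comm]

theorem nrm_rpow {X : Type*} [Fintype X] {a α : ℝ} (ha : 0 < a) (hα : 0 < α) {f : X → ℝ}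
    (hf : ∀ x, 0 ≤ f x) : nrm a (fun x => f x ^ (a / α)) = (∑ x, f x ^ α⁻¹) ^ a := by
  unfold nrm
  congr 1
  refine sum_congr rfl fun x _ => ?_
  rw [← Real.rpow_mul (hf x)]
  congr 1
  field_simp

/-- Riesz–Thorin interpolation in bilinear form, with one argument valued in `ℓ²`. -/
theorem riesz_thorin {X Y I : Type*} [Fintype X] [Fintype Y] [Fintype I] (k : X → Y → I → ℂ)
    {a₀ a₁ b₀ b₁ A₀ A₁ θ : ℝ} (ha₀ : 0 < a₀) (ha₁ : 0 < a₁) (hb₀ : 0 < b₀) (hb₁ : 0 < b₁)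
    (hA₀ : 0 ≤ A₀) (hA₁ : 0 ≤ A₁) (hθ₀ : 0 ≤ θ) (hθ₁ : θ ≤ 1)
    (h₀ : ∀ (f : X → ℂ) (g : Y → I → ℂ), ‖∑ x, ∑ y, ∑ i, k x y i * f x * g y i‖ ≤
      A₀ * (nrm a₀ (fun x => ‖f x‖) * nrm b₀ (fun y => l2 (g y))))
    (h₁ : ∀ (f : X → ℂ) (g : Y → I → ℂ), ‖∑ x, ∑ y, ∑ i, k x y i * f x * g y i‖ ≤
      A₁ * (nrm a₁ (fun x => ‖f x‖) * nrm b₁ (fun y => l2 (g y))))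
    (f : X → ℂ) (g : Y → I → ℂ) :
    ‖∑ x, ∑ y, ∑ i, k x y i * f x * g y i‖ ≤ A₀ ^ (1 - θ) * A₁ ^ θ *
      (nrm ((1 - θ) * a₀ + θ * a₁) (fun x => ‖f x‖) *
        nrm ((1 - θ) * b₀ + θ * b₁) (fun y => l2 (g y))) := by
  have hconv : ∀ {u v : ℝ}, 0 < u → 0 < v → 0 < (1 - θ) * u + θ * v := fun {u v} hu hv => by
    rcases hθ₀.eq_or_lt with rfl | h
    · simpa using hu
    · have := mul_nonneg (sub_nonneg.2 hθ₁) hu.le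
      have := mul_pos h hv
      linarith
  set α := (1 - θ) * a₀ + θ * a₁ with hα
  set β := (1 - θ) * b₀ + θ * b₁ with hβ
  have hα0 : 0 < α := hconv ha₀ ha₁
  have hβ0 : 0 < β := hconv hb₀ hb₁
  set F := ∑ x, ‖f x‖ ^ α⁻¹ with hF
  set G := ∑ y, l2 (g y) ^ β⁻¹ with hG
  have hF0 : 0 ≤ F := sum_nonneg fun x _ => Real.rpow_nonneg (norm_nonneg _) _
  have hG0 : 0 ≤ G := sum_nonneg fun x _ => Real.rpow_nonneg (l2_nonneg _) _
  let P : ℂ → ℂ := fun z => ((1 - z) * a₀ + z * a₁) / α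
  let R : ℂ → ℂ := fun z => ((1 - z) * b₀ + z * b₁) / β
  let fz : ℂ → X → ℂ := fun z x => f x * cexp ((P z - 1) * (Real.log ‖f x‖ : ℂ))
  let gz : ℂ → Y → I → ℂ := fun z y i => cexp ((R z - 1) * (Real.log (l2 (g y)) : ℂ)) * g y i
  have hPre : ∀ z, (P z).re = ((1 - z.re) * a₀ + z.re * a₁) / α := fun z => by simp [P]
  have hRre : ∀ z, (R z).re = ((1 - z.re) * b₀ + z.re * b₁) / β := fun z => by simp [R]
  have hfz : ∀ z, (P z).re ≠ 0 → ∀ x, ‖fz z x‖ = ‖f x‖ ^ (P z).re := fun z hz x => by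
    simp only [fz, norm_mul]
    exact mul_norm_cexp (norm_nonneg _) hz
  have hgz : ∀ z, (R z).re ≠ 0 → ∀ y, l2 (gz z y) = l2 (g y) ^ (R z).re := fun z hz y => by
    simp only [gz]
    rw [l2_smul, mul_comm]
    exact mul_norm_cexp (l2_nonneg _) hz
  let h : ℂ → ℂ := fun z => ∑ x, ∑ y, ∑ i, k x y i * fz z x * gz z y i
  have hdiff : Differentiable ℂ h := by
    simp only [h, fz, gz, P, R]
    fun_prop
  have hbd : BddAbove ((norm ∘ h) '' HadamardThreeLines.verticalClosedStrip 0 1) := by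
    let B : ℝ → ℝ := fun s => ∑ x, ∑ y, ∑ i, ‖k x y i‖ *
      (‖f x‖ * Real.exp ((((1 - s) * a₀ + s * a₁) / α - 1) * Real.log ‖f x‖)) *
      (Real.exp ((((1 - s) * b₀ + s * b₁) / β - 1) * Real.log (l2 (g y))) * ‖g y i‖)
    have hB : Continuous B := by simp only [B]; fun_prop
    obtain ⟨M, hM⟩ := (isCompact_Icc (a := (0 : ℝ)) (b := 1)).bddAbove_image hB.continuousOn
    refine ⟨M, ?_⟩
    rintro _ ⟨z, hz, rfl⟩
    refine le_trans ?_ (hM ⟨z.re, hz, rfl⟩)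
    simp only [h, Function.comp]
    refine (norm_sum_le _ _).trans (sum_le_sum fun x _ => (norm_sum_le _ _).trans
      (sum_le_sum fun y _ => (norm_sum_le _ _).trans (sum_le_sum fun i _ => le_of_eq ?_)))
    simp only [fz, gz, norm_mul, Complex.norm_exp, Complex.re_mul_ofReal, sub_re, one_re, hPre,
      hRre]
  have hbound : ∀ (s a b A : ℝ), 0 < a → 0 < b → (1 - s) * a₀ + s * a₁ = a →
      (1 - s) * b₀ + s * b₁ = b → (∀ (f : X → ℂ) (g : Y → I → ℂ),
        ‖∑ x, ∑ y, ∑ i, k x y i * f x * g y i‖ ≤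
        A * (nrm a (fun x => ‖f x‖) * nrm b (fun y => l2 (g y)))) →
      ∀ z ∈ re ⁻¹' {s}, ‖h z‖ ≤ A * (F ^ a * G ^ b) := by
    intro s a b A ha hb hsa hsb H z hz
    have hz' : z.re = s := hz
    have h1 : (P z).re = a / α := by rw [hPre, hz', hsa]
    have h2 : (R z).re = b / β := by rw [hRre, hz', hsb]
    refine (H _ _).trans (le_of_eq ?_)
    simp only [hfz z (by rw [h1]; positivity), hgz z (by rw [h2]; positivity), h1, h2]
    rw [nrm_rpow ha hα0 fun x => norm_nonneg _, nrm_rpow hb hβ0 fun x => l2_nonneg _]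
  have key := HadamardThreeLines.norm_le_interp_of_mem_verticalClosedStrip₀₁' h (z := (θ : ℂ))
    (show (θ : ℂ).re ∈ Set.Icc (0 : ℝ) 1 from ⟨by simpa using hθ₀, by simpa using hθ₁⟩)
    hdiff.diffContOnCl hbd
    (hbound 0 a₀ b₀ A₀ ha₀ hb₀ (by ring) (by ring) h₀)
    (hbound 1 a₁ b₁ A₁ ha₁ hb₁ (by ring) (by ring) h₁)
  have hPθ : P θ = 1 := by
    have : (α : ℂ) ≠ 0 := by exact_mod_cast hα0.ne'
    simp only [P]; rw [div_eq_one_iff_eq this, hα]; push_cast; ring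
  have hRθ : R θ = 1 := by
    have : (β : ℂ) ≠ 0 := by exact_mod_cast hβ0.ne'
    simp only [R]; rw [div_eq_one_iff_eq this, hβ]; push_cast; ring
  have hθ : h θ = ∑ x, ∑ y, ∑ i, k x y i * f x * g y i := by
    simp [h, fz, gz, hPθ, hRθ]
  rw [hθ] at key
  refine key.trans (le_of_eq ?_)
  simp only [ofReal_re, nrm]
  rw [← hF, ← hG]
  have hr' : ∀ x : ℝ, 0 ≤ x → ∀ u v, 0 < u → 0 < v →
      (x ^ u) ^ (1 - θ) * (x ^ v) ^ θ = x ^ ((1 - θ) * u + θ * v) := by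
    intro x hx u v hu hv
    rw [← Real.rpow_mul hx, ← Real.rpow_mul hx, mul_comm u, mul_comm v,
      Real.rpow_add_of_nonneg hx (mul_nonneg (sub_nonneg.2 hθ₁) hu.le) (mul_nonneg hθ₀ hv.le)]
  rw [Real.mul_rpow hA₀ (by positivity), Real.mul_rpow hA₁ (by positivity),
    Real.mul_rpow (by positivity) (by positivity), Real.mul_rpow (by positivity) (by positivity),
    hα, hβ, ← hr' F hF0 a₀ a₁ ha₀ ha₁, ← hr' G hG0 b₀ b₁ hb₀ hb₁]
  ring

/-- Duality for the mixed norm `L^p(ℓ²)`. -/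
theorem nrm_le_of_dual {Y I : Type*} [Fintype Y] [Fintype I] {a A : ℝ} (ha : 0 < a) (ha1 : a < 1)
    (hA : 0 ≤ A) (u : Y → I → ℂ)
    (h : ∀ g : Y → I → ℂ, ‖∑ y, ∑ i, u y i * g y i‖ ≤ A * nrm (1 - a) (fun y => l2 (g y))) :
    nrm a (fun y => l2 (u y)) ≤ A := by
  set U : Y → ℝ := fun y => l2 (u y) with hU
  have hU0 : ∀ y, 0 ≤ U y := fun y => l2_nonneg _
  set S := ∑ y, U y ^ a⁻¹ with hS
  have hS0 : 0 ≤ S := sum_nonneg fun x _ => Real.rpow_nonneg (hU0 _) _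
  have ha' : 1 < a⁻¹ := (one_lt_inv₀ ha).2 ha1
  have key := h fun y i => (U y ^ (a⁻¹ - 2) : ℝ) * conj (u y i)
  have hl : ∀ y, l2 (fun i => ((U y ^ (a⁻¹ - 2) : ℝ) : ℂ) * conj (u y i)) = U y ^ (a⁻¹ - 1) := by
    intro y
    rw [l2_smul, Complex.norm_real, Real.norm_of_nonneg (Real.rpow_nonneg (hU0 y) _)]
    have : l2 (fun i => conj (u y i)) = U y := by simp [hU, l2]
    rw [this]
    rcases (hU0 y).eq_or_lt with h0 | h0
    · rw [← h0, mul_zero, Real.zero_rpow (by linarith)]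
    · nth_rewrite 2 [← Real.rpow_one (U y)]
      rw [← Real.rpow_add h0]; ring_nf
  have hs : ∑ y, ∑ i, u y i * (((U y ^ (a⁻¹ - 2) : ℝ) : ℂ) * conj (u y i)) = (S : ℂ) := by
    rw [hS, ofReal_sum]
    refine sum_congr rfl fun y _ => ?_
    have h1 : ∀ i, u y i * (((U y ^ (a⁻¹ - 2) : ℝ) : ℂ) * conj (u y i)) =
        ((U y ^ (a⁻¹ - 2) * ‖u y i‖ ^ 2 : ℝ) : ℂ) := fun i => by
      rw [mul_left_comm, Complex.mul_conj, Complex.normSq_eq_norm_sq]; push_cast; ring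
    simp only [h1]
    rw [← ofReal_sum, ← mul_sum, ← l2_sq]
    congr 1
    change U y ^ (a⁻¹ - 2) * U y ^ 2 = _
    rcases (hU0 y).eq_or_lt with h0 | h0
    · rw [← h0, Real.zero_rpow (by linarith : a⁻¹ ≠ 0)]; simp
    · rw [← Real.rpow_natCast, ← Real.rpow_add h0]; norm_num
  rw [hs, Complex.norm_real, Real.norm_of_nonneg hS0] at key
  simp only [hl] at key
  have hn : nrm (1 - a) (fun y => U y ^ (a⁻¹ - 1)) = S ^ (1 - a) := by
    unfold nrm
    congr 1
    refine sum_congr rfl fun y _ => ?_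
    rw [← Real.rpow_mul (hU0 y)]
    congr 1
    have : 1 - a ≠ 0 := by linarith
    field_simp
  rw [hn] at key
  change S ^ a ≤ A
  rcases hS0.eq_or_lt with h0 | h0
  · rw [← h0, Real.zero_rpow ha.ne']
    exact hA
  · have : S = S ^ a * S ^ (1 - a) := by rw [← Real.rpow_add h0]; simp
    nth_rewrite 1 [this] at key
    exact le_of_mul_le_mul_right key (Real.rpow_pos_of_pos h0 _)

theorem norm_sum_mul_le_l2 {I : Type*} [Fintype I] (u g : I → ℂ) :
    ‖∑ i, u i * g i‖ ≤ l2 u * l2 g := by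
  refine (norm_sum_le _ _).trans ?_
  simp only [norm_mul]
  rw [l2, l2]
  exact Real.sum_mul_le_sqrt_mul_sqrt _ _ _

theorem norm_sum_mul_le_nrm {Y : Type*} [Fintype Y] {a : ℝ} (ha : 0 < a)
    (ha1 : a < 1) {u g : Y → ℝ} (hu : ∀ y, 0 ≤ u y) (hg : ∀ y, 0 ≤ g y) :
    ∑ y, u y * g y ≤ nrm a u * nrm (1 - a) g := by
  have hpq : (a⁻¹).HolderConjugate ((1 - a)⁻¹) := by
    rw [Real.holderConjugate_iff]
    exact ⟨(one_lt_inv₀ ha).2 ha1, by simp⟩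
  have := Real.inner_le_Lp_mul_Lq_of_nonneg univ hpq (fun i _ => hu i) (fun i _ => hg i)
  simpa [nrm] using this

theorem norm_bilin_le {Y I : Type*} [Fintype Y] [Fintype I] {a : ℝ} (ha : 0 < a)
    (ha1 : a < 1) (u g : Y → I → ℂ) :
    ‖∑ y, ∑ i, u y i * g y i‖ ≤ nrm a (fun y => l2 (u y)) * nrm (1 - a) (fun y => l2 (g y)) :=
  (norm_sum_le _ _).trans <| (sum_le_sum fun y _ => norm_sum_mul_le_l2 (u y) (g y)).trans
    (norm_sum_mul_le_nrm ha ha1 (fun _ => l2_nonneg _) fun _ => l2_nonneg _)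

theorem nrm_mul_left {X : Type*} [Fintype X] {a : ℝ} (ha : 0 < a) {c : ℝ} (hc : 0 ≤ c)
    {f : X → ℝ} (hf : ∀ x, 0 ≤ f x) : nrm a (fun x => c * f x) = c * nrm a f := by
  unfold nrm
  simp only [fun x => Real.mul_rpow hc (hf x) (z := a⁻¹), ← mul_sum]
  rw [Real.mul_rpow (Real.rpow_nonneg hc _) (sum_nonneg fun x _ => Real.rpow_nonneg (hf x) _),
    ← Real.rpow_mul hc, inv_mul_cancel₀ ha.ne', Real.rpow_one]

theorem nrm_le_of_sum_pow_le {X : Type*} [Fintype X] (j : ℕ) {C : ℝ} (hC : 0 ≤ C) {f g : X → ℝ}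
    (h : ∑ x, (f x ^ 2) ^ 2 ^ j ≤ C * ∑ x, (g x ^ 2) ^ 2 ^ j) :
    nrm ((2 ^ (j + 1) : ℝ)⁻¹) f ≤ C ^ ((2 ^ (j + 1) : ℝ)⁻¹) * nrm ((2 ^ (j + 1) : ℝ)⁻¹) g := by
  have h1 : ∀ t : ℝ, t ^ (((2 : ℝ) ^ (j + 1))⁻¹)⁻¹ = (t ^ 2) ^ 2 ^ j := fun t => by
    rw [inv_inv, ← pow_mul, ← pow_succ', ← Real.rpow_natCast t]
    norm_num
  unfold nrm
  simp only [h1]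
  rw [← Real.mul_rpow hC (by positivity)]
  exact Real.rpow_le_rpow (by positivity) h (by positivity)

end Interpolation

section SquareFunction

open Finset ComplexConjugate

variable {L : ℕ} [NeZero L]

theorem nrm_half_l2 {X I : Type*} [Fintype X] [Fintype I] (u : X → I → ℂ) :
    nrm (1 / 2) (fun x => l2 (u x)) = √(∑ x, ∑ i, ‖u x i‖ ^ 2) := by
  unfold nrm
  rw [← Real.sqrt_eq_rpow]
  congr 1
  refine sum_congr rfl fun x _ => ?_
  rw [← l2_sq]; norm_num

theorem nrm_half {X : Type*} [Fintype X] (u : X → ℂ) :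
    nrm (1 / 2) (fun x => ‖u x‖) = √(∑ x, ‖u x‖ ^ 2) := by
  unfold nrm
  rw [← Real.sqrt_eq_rpow]
  norm_num

theorem sum_rproj_sq_le {K : ℕ} (hL : 2 * K < L) {ι κ : Type*} [Fintype ι] [Fintype κ]
    {E : ι → Finset ℤ} {F : ι × κ → Finset ℤ} (f : ZMod L × ZMod L → ℂ)
    (hE : ∀ i, IsIv K (E i)) (hF : ∀ i, IsIv K (F i))
    (hd : ∀ μ₁ μ₂, μ₁ ≠ μ₂ → Disjoint (E μ₁) (E μ₂))
    (hd' : ∀ μ κ₁ κ₂, κ₁ ≠ κ₂ → Disjoint (F (μ, κ₁)) (F (μ, κ₂))) :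
    ∑ z, ∑ i : ι × κ, ‖rproj (E i.1) (F i) f z‖ ^ 2 ≤ ∑ z, ‖f z‖ ^ 2 := by
  have hDR : DR L (Set.Icc (-(K : ℤ)) K) := DR_Icc (by omega)
  calc _ = ∑ x, ∑ μ, ∑ κ', ∑ y,
        ‖proj (F (μ, κ')) (fun y => proj (E μ) (fun x => f (x, y)) x) y‖ ^ 2 := by
        rw [Fintype.sum_prod_type]
        refine sum_congr rfl fun x _ => ?_
        rw [sum_comm, Fintype.sum_prod_type]
        rfl
    _ ≤ ∑ x, ∑ μ, ∑ y, ‖proj (E μ) (fun x => f (x, y)) x‖ ^ 2 :=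
        sum_le_sum fun x _ => sum_le_sum fun μ _ =>
          bessel_family hDR (fun i _ => (hF _).subset) (fun i _ j _ hij => hd' μ i j hij) _
    _ = ∑ y, ∑ μ, ∑ x, ‖proj (E μ) (fun x => f (x, y)) x‖ ^ 2 := by
        rw [sum_comm, sum_comm (s := univ (α := ZMod L))]
        exact sum_congr rfl fun μ _ => sum_comm
    _ ≤ ∑ y, ∑ x, ‖f (x, y)‖ ^ 2 :=
        sum_le_sum fun y _ => bessel_family hDR (fun i _ => (hE _).subset)
          (fun i _ j _ hij => hd i j hij) fun x => f (x, y)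
    _ = _ := by rw [Fintype.sum_prod_type_right]

/-- The bilinear form of a family of rectangular projections, in kernel form. -/
theorem exists_kernel_rproj {I : Type*} [Fintype I] (E F : I → Finset ℤ) :
    ∃ k : ZMod L × ZMod L → ZMod L × ZMod L → I → ℂ,
      ∀ (f : ZMod L × ZMod L → ℂ) (g : ZMod L × ZMod L → I → ℂ),
        ∑ w, ∑ z, ∑ i, k w z i * f w * g z i = ∑ z, ∑ i, rproj (E i) (F i) f z * g z i := by
  refine ⟨fun w z i => ∑ ξ ∈ E i ×ˢ F i, ((L : ℂ) ^ 2)⁻¹ * conj (chi2 L ξ w) * chi2 L ξ z,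
    fun f g => ?_⟩
  rw [sum_comm]
  refine sum_congr rfl fun z _ => ?_
  rw [sum_comm]
  refine sum_congr rfl fun i _ => ?_
  rw [rproj_apply, ← sum_mul]
  congr 1
  simp only [sum_mul, hat2, mul_sum]
  rw [sum_comm]
  exact sum_congr rfl fun ξ _ => sum_congr rfl fun w _ => by ring

theorem bilin_rproj_eq {I : Type*} [Fintype I] (E F : I → Finset ℤ)
    (f : ZMod L × ZMod L → ℂ) (g : ZMod L × ZMod L → I → ℂ) :
    ∑ z, ∑ i, rproj (E i) (F i) f z * g z i =
      ∑ z, f z * conj (∑ i, rproj (E i) (F i) (fun z => conj (g z i)) z) := by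
  rw [sum_comm]
  simp only [map_sum, mul_sum]
  rw [sum_comm (s := univ (α := ZMod L × ZMod L))]
  refine sum_congr rfl fun i _ => ?_
  rw [← sum_rproj_mul_conj]
  simp

theorem norm_sum_le_sqrt_card {I : Type*} [Fintype I] (u : I → ℂ) :
    ‖∑ i, u i‖ ≤ √(Fintype.card I) * l2 u := by
  have := norm_sum_mul_le_l2 (fun _ => (1 : ℂ)) u
  simpa [l2] using this

/-- Square function estimate for disjoint families of rectangles. -/
theorem square_function {a τ : ℝ} (ha : 0 < a) (ha1 : a < 1) (hτ : 0 < τ) :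
    ∃ C : ℝ, 0 < C ∧ ∃ c : ℕ, ∀ (L : ℕ) [NeZero L] (K : ℕ), c * (K + 1) < L →
    ∀ (ι κ : Type) [Fintype ι] [Fintype κ] (E : ι → Finset ℤ) (F : ι × κ → Finset ℤ)
      (f : ZMod L × ZMod L → ℂ), (∀ i, IsIv K (E i)) → (∀ i, IsIv K (F i)) →
    (∀ μ₁ μ₂, μ₁ ≠ μ₂ → Disjoint (E μ₁) (E μ₂)) →
    (∀ μ κ₁ κ₂, κ₁ ≠ κ₂ → Disjoint (F (μ, κ₁)) (F (μ, κ₂))) →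
    nrm a (fun z => l2 (fun i : ι × κ => rproj (E i.1) (F i) f z)) ≤
      C * (Fintype.card (ι × κ) : ℝ) ^ (max 0 (a - 1 / 2) + τ) * nrm a (fun z => ‖f z‖) := by
  obtain ⟨j, hj⟩ : ∃ j : ℕ, (1 / 2 : ℝ) ^ j < min (min a (1 - a)) (min (1 / 4) (τ / 2)) :=
    exists_pow_lt_of_lt_one (by simp [ha, ha1, hτ]) (by norm_num)
  simp only [lt_min_iff] at hj
  obtain ⟨C₁, hC₁, c₁, h₁⟩ := rubio_de_francia_rproj j
  obtain ⟨C₂, hC₂, c₂, h₂⟩ := vector_rproj j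
  set b : ℝ := (2 ^ (j + 1) : ℝ)⁻¹ with hb
  have hb0 : 0 < b := by positivity
  have hbj : b ≤ (1 / 2 : ℝ) ^ j := by
    rw [hb, pow_succ, one_div, inv_pow]
    refine inv_anti₀ (by positivity) ?_
    have : (0 : ℝ) < 2 ^ j := by positivity
    linarith
  have hba : b < a := hbj.trans_lt hj.1.1
  have hba' : b < 1 - a := hbj.trans_lt hj.1.2
  have hb4 : b < 1 / 4 := hbj.trans_lt hj.2.1
  have hbτ : b < τ / 2 := hbj.trans_lt hj.2.2
  refine ⟨max 1 (C₁ ^ b) * max 1 (C₂ ^ b), by positivity, 2 + c₁ + c₂,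
    fun L _ K hL ι κ _ _ E F f hE hF hd hd' => ?_⟩
  have hL0 : 2 * K < L := by nlinarith [Nat.zero_le (c₁ * (K + 1)), Nat.zero_le (c₂ * (K + 1))]
  have hL1 : c₁ * (K + 1) < L := by nlinarith [Nat.zero_le (c₂ * (K + 1))]
  have hL2 : c₂ * (K + 1) < L := by nlinarith [Nat.zero_le (c₁ * (K + 1))]
  rcases isEmpty_or_nonempty (ι × κ) with hI | hI
  · have h0 : nrm a (fun z => l2 (fun i : ι × κ => rproj (E i.1) (F i) f z)) = 0 := by
      have : (a⁻¹ : ℝ) ≠ 0 := (inv_pos.2 ha).ne'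
      simp [nrm, l2, Real.zero_rpow this, Real.zero_rpow ha.ne']
    rw [h0]
    exact mul_nonneg (by positivity) (nrm_nonneg _ fun _ => norm_nonneg _)
  set M : ℝ := ((Fintype.card (ι × κ) : ℕ) : ℝ) with hM
  have hM1 : 1 ≤ M := by
    rw [hM]; exact_mod_cast (Fintype.card_pos (α := ι × κ))
  obtain ⟨k, hk⟩ := exists_kernel_rproj (L := L) (fun i : ι × κ => E i.1) F
  have hhalf : ∀ (f : ZMod L × ZMod L → ℂ) (g : ZMod L × ZMod L → ι × κ → ℂ),
      ‖∑ w, ∑ z, ∑ i, k w z i * f w * g z i‖ ≤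
      1 * (nrm (1 / 2) (fun x => ‖f x‖) * nrm (1 / 2) (fun y => l2 (g y))) := by
    intro f g
    rw [hk, one_mul]
    refine (norm_bilin_le (a := 1 / 2) (by norm_num) (by norm_num) _ g).trans ?_
    rw [show (1 : ℝ) - 1 / 2 = 1 / 2 by norm_num, nrm_half_l2, nrm_half]
    exact mul_le_mul_of_nonneg_right
      (Real.sqrt_le_sqrt (sum_rproj_sq_le hL0 f hE hF hd hd'))
      (nrm_nonneg _ fun _ => l2_nonneg _)
  have hbig : ∀ (f : ZMod L × ZMod L → ℂ) (g : ZMod L × ZMod L → ι × κ → ℂ),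
      ‖∑ w, ∑ z, ∑ i, k w z i * f w * g z i‖ ≤
      (C₁ ^ b * M ^ (2 * b)) * (nrm b (fun x => ‖f x‖) * nrm (1 - b) (fun y => l2 (g y))) := by
    intro f g
    rw [hk]
    refine (norm_bilin_le hb0 (by linarith) _ g).trans ?_
    rw [← mul_assoc]
    refine mul_le_mul_of_nonneg_right ?_ (nrm_nonneg _ fun _ => l2_nonneg _)
    have := h₁ L K hL1 ι κ E F f hE hF hd hd'
    simp only [← l2_sq] at this
    have := nrm_le_of_sum_pow_le j (by positivity) this
    rw [← hb, ← hM, Real.mul_rpow hC₁.le (by positivity), ← Real.rpow_natCast M,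
      ← Real.rpow_mul (by positivity)] at this
    exact_mod_cast this
  have hdual : ∀ (f : ZMod L × ZMod L → ℂ) (g : ZMod L × ZMod L → ι × κ → ℂ),
      ‖∑ w, ∑ z, ∑ i, k w z i * f w * g z i‖ ≤
      (C₂ ^ b * M ^ (1 / 2 : ℝ)) *
        (nrm (1 - b) (fun x => ‖f x‖) * nrm b (fun y => l2 (g y))) := by
    intro f g
    rw [hk, bilin_rproj_eq]
    refine (norm_sum_le _ _).trans ?_
    simp only [norm_mul, RCLike.norm_conj]
    have e : b = 1 - (1 - b) := by ring
    refine (norm_sum_mul_le_nrm (a := 1 - b) (by linarith) (by linarith)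
      (fun _ => norm_nonneg _) (fun _ => norm_nonneg _)).trans ?_
    rw [mul_left_comm, ← e]
    refine mul_le_mul_of_nonneg_left ?_ (nrm_nonneg _ fun _ => norm_nonneg _)
    refine (nrm_mono hb0 (fun _ => norm_nonneg _) fun z => norm_sum_le_sqrt_card _).trans ?_
    rw [nrm_mul_left hb0 (Real.sqrt_nonneg _) fun _ => l2_nonneg _, ← Real.sqrt_eq_rpow,
      mul_comm (C₂ ^ b), mul_assoc]
    refine mul_le_mul_of_nonneg_left ?_ (Real.sqrt_nonneg _)
    have := h₂ L K hL2 (ι × κ) (fun i => E i.1) F (fun i z => conj (g z i)) (fun i => hE i.1) hF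
    simp only [← l2_sq] at this
    refine (nrm_le_of_sum_pow_le j hC₂.le this).trans (le_of_eq ?_)
    simp [l2, hb]
  have hC : ∀ {u : ℝ} (θ : ℝ), 0 ≤ θ → θ ≤ 1 → 0 ≤ u → u ^ θ ≤ max 1 u := fun {u} θ h0 h1 hu => by
    rcases le_total u 1 with h | h
    · exact (Real.rpow_le_one hu h h0).trans (le_max_left _ _)
    · calc u ^ θ ≤ u ^ (1 : ℝ) := Real.rpow_le_rpow_of_exponent_le h h1
        _ ≤ _ := by rw [Real.rpow_one]; exact le_max_right _ _
  refine nrm_le_of_dual ha ha1 (mul_nonneg (by positivity) (nrm_nonneg _ fun _ => norm_nonneg _)) _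
    fun g => ?_
  rw [← hk, mul_assoc]
  have hne : 0 ≤ nrm a (fun z => ‖f z‖) * nrm (1 - a) (fun y => l2 (g y)) :=
    mul_nonneg (nrm_nonneg _ fun _ => norm_nonneg _) (nrm_nonneg _ fun _ => l2_nonneg _)
  have hden : 0 < 1 / 2 - b := by linarith
  rcases le_total a (1 / 2) with h | h
  · set θ := (1 / 2 - a) / (1 / 2 - b) with hθ
    have hθ0 : 0 ≤ θ := div_nonneg (by linarith) hden.le
    have hθ1 : θ ≤ 1 := (div_le_one hden).2 (by linarith)
    have hθm : θ * (1 / 2 - b) = 1 / 2 - a := div_mul_cancel₀ _ hden.ne'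
    have key := riesz_thorin k (by norm_num) hb0 (by norm_num) (by linarith) zero_le_one
      (by positivity) hθ0 hθ1 hhalf hbig f g
    rw [show (1 - θ) * (1 / 2) + θ * b = a by linarith,
      show (1 - θ) * (1 / 2) + θ * (1 - b) = 1 - a by linarith] at key
    refine key.trans (mul_le_mul_of_nonneg_right ?_ hne)
    rw [Real.one_rpow, one_mul, Real.mul_rpow (by positivity) (by positivity),
      ← Real.rpow_mul (by positivity : 0 ≤ M)]
    refine mul_le_mul ?_ ?_ (by positivity) (by positivity)
    · exact (hC θ hθ0 hθ1 (Real.rpow_nonneg hC₁.le b)).trans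
        (le_mul_of_one_le_right (by positivity) (le_max_left _ _))
    · refine Real.rpow_le_rpow_of_exponent_le hM1 ?_
      rw [max_eq_left (by linarith)]
      nlinarith
  · set θ := (a - 1 / 2) / (1 / 2 - b) with hθ
    have hθ0 : 0 ≤ θ := div_nonneg (by linarith) hden.le
    have hθ1 : θ ≤ 1 := (div_le_one hden).2 (by linarith)
    have hθm : θ * (1 / 2 - b) = a - 1 / 2 := div_mul_cancel₀ _ hden.ne'
    have key := riesz_thorin k (by norm_num) (by linarith) (by norm_num) hb0 zero_le_one
      (by positivity) hθ0 hθ1 hhalf hdual f g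
    rw [show (1 - θ) * (1 / 2) + θ * (1 - b) = a by linarith,
      show (1 - θ) * (1 / 2) + θ * b = 1 - a by linarith] at key
    refine key.trans (mul_le_mul_of_nonneg_right ?_ hne)
    rw [Real.one_rpow, one_mul, Real.mul_rpow (by positivity) (by positivity),
      ← Real.rpow_mul (by positivity : 0 ≤ M)]
    refine mul_le_mul ?_ ?_ (by positivity) (by positivity)
    · exact (hC θ hθ0 hθ1 (Real.rpow_nonneg hC₂.le b)).trans
        (le_mul_of_one_le_left (by positivity) (le_max_left _ _))
    · refine Real.rpow_le_rpow_of_exponent_le hM1 ?_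
      rw [max_eq_right (by linarith)]
      nlinarith

end SquareFunction

section HausdorffYoung

open Finset ComplexConjugate

theorem nrm_add_le {X : Type*} [Fintype X] {b : ℝ} (hb : 0 < b) (hb1 : b ≤ 1) {f g : X → ℝ}
    (hf : ∀ x, 0 ≤ f x) (hg : ∀ x, 0 ≤ g x) : nrm b (fun x => f x + g x) ≤ nrm b f + nrm b g := by
  have := Real.Lp_add_le_of_nonneg (s := univ) ((one_le_inv₀ hb).2 hb1)
    (fun i _ => hf i) (fun i _ => hg i)
  simpa [nrm] using this

theorem nrm_zero {X : Type*} [Fintype X] {b : ℝ} (hb : 0 < b) : nrm b (fun _ : X => 0) = 0 := by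
  simp [nrm, Real.zero_rpow (inv_pos.2 hb).ne', Real.zero_rpow hb.ne']

theorem nrm_sum_le {X ι : Type*} [Fintype X] {b : ℝ} (hb : 0 < b) (hb1 : b ≤ 1) (s : Finset ι)
    {f : ι → X → ℝ} (hf : ∀ i x, 0 ≤ f i x) :
    nrm b (fun x => ∑ i ∈ s, f i x) ≤ ∑ i ∈ s, nrm b (f i) := by
  classical
  induction s using Finset.induction_on with
  | empty => simp [nrm_zero hb]
  | insert i s hi ih =>
    simp only [sum_insert hi]
    exact (nrm_add_le hb hb1 (hf i) fun x => sum_nonneg fun j _ => hf j x).trans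
      (add_le_add le_rfl ih)

theorem nrm_sq {X : Type*} [Fintype X] {a : ℝ} {f : X → ℝ} (hf : ∀ x, 0 ≤ f x) :
    nrm a f ^ 2 = nrm (2 * a) (fun x => f x ^ 2) := by
  unfold nrm
  rw [← Real.rpow_natCast, ← Real.rpow_mul (sum_nonneg fun x _ => Real.rpow_nonneg (hf x) _),
    mul_comm a]
  push_cast
  congr 1
  refine sum_congr rfl fun x _ => ?_
  rw [← Real.rpow_natCast (f x), ← Real.rpow_mul (hf x)]
  congr 1
  rw [mul_inv]; push_cast; ring

/-- Minkowski's inequality: `L^p(ℓ²) ≤ ℓ²(L^p)` for `p ≥ 2`. -/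
theorem nrm_l2_le {Y I : Type*} [Fintype Y] [Fintype I] {a : ℝ} (ha : 0 < a) (ha1 : a ≤ 1 / 2)
    (u : Y → I → ℂ) :
    nrm a (fun y => l2 (u y)) ≤ √(∑ i, nrm a (fun y => ‖u y i‖) ^ 2) := by
  refine Real.le_sqrt_of_sq_le ?_
  rw [nrm_sq fun _ => l2_nonneg _]
  simp only [l2_sq, fun i => nrm_sq (a := a) (f := fun y => ‖u y i‖) fun _ => norm_nonneg _]
  exact nrm_sum_le (by linarith) (by linarith) univ fun i y => by positivity

theorem norm_chi2 (L : ℕ) [NeZero L] (ξ : ℤ × ℤ) (z : ZMod L × ZMod L) : ‖chi2 L ξ z‖ = 1 := by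
  simp [chi2, norm_chi]

theorem parseval_chi2 {L : ℕ} [NeZero L] {B : Finset ℤ} (hB : DR L B) (c : B × B → ℂ) :
    ∑ z, ‖∑ ξ : B × B, c ξ * chi2 L (ξ.1, ξ.2) z‖ ^ 2 = L ^ 2 * ∑ ξ, ‖c ξ‖ ^ 2 := by
  have hinj : Set.InjOn (fun i : B => ((i : ℤ) : ZMod L)) (univ : Finset B) :=
    fun i _ j _ h => Subtype.ext (hB i.2 j.2 h)
  rw [Fintype.sum_prod_type_right]
  calc _ = ∑ y, ∑ x, ‖∑ k : B, (∑ l : B, c (k, l) * chi L l y) * chi L k x‖ ^ 2 := by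
        refine sum_congr rfl fun y _ => sum_congr rfl fun x _ => ?_
        rw [Fintype.sum_prod_type]
        congr 2
        refine sum_congr rfl fun k _ => ?_
        rw [sum_mul]
        exact sum_congr rfl fun l _ => by simp only [chi2]; ring
    _ = ∑ y, (L : ℝ) * ∑ k : B, ‖∑ l : B, c (k, l) * chi L l y‖ ^ 2 :=
        sum_congr rfl fun y _ => parseval hinj _
    _ = L * ∑ k : B, ∑ y, ‖∑ l : B, c (k, l) * chi L l y‖ ^ 2 := by rw [← mul_sum, sum_comm]
    _ = L * ∑ k : B, (L : ℝ) * ∑ l : B, ‖c (k, l)‖ ^ 2 := by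
        congr 1
        exact sum_congr rfl fun k _ => parseval hinj _
    _ = _ := by rw [← mul_sum, Fintype.sum_prod_type]; ring

theorem hausdorff_young {L : ℕ} [NeZero L] {B : Finset ℤ} (hB : DR L B) {a : ℝ} (ha : 0 < a)
    (ha1 : a ≤ 1 / 2) (c : ℤ × ℤ → ℂ) :
    nrm a (fun z => ‖∑ ξ ∈ B ×ˢ B, c ξ * chi2 L ξ z‖) ≤
      (L : ℝ) ^ (2 * a) * (∑ ξ ∈ B ×ˢ B, ‖c ξ‖ ^ (1 - a)⁻¹) ^ (1 - a) := by
  have hL : (0 : ℝ) < L := by exact_mod_cast Nat.pos_of_ne_zero (NeZero.ne L)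
  have hconv : ∀ {M : Type} [AddCommMonoid M] (h : ℤ × ℤ → M),
      ∑ ξ ∈ B ×ˢ B, h ξ = ∑ ξ : B × B, h (ξ.1, ξ.2) := fun {M} _ h => by
    rw [sum_product, Fintype.sum_prod_type, ← sum_coe_sort B]
    exact sum_congr rfl fun k _ => by rw [← sum_coe_sort B]
  have h0 : ∀ (f : B × B → ℂ) (g : ZMod L × ZMod L → Unit → ℂ),
      ‖∑ x, ∑ y, ∑ i, chi2 L (x.1, x.2) y * f x * g y i‖ ≤
      1 * (nrm 1 (fun x => ‖f x‖) * nrm 1 (fun y => l2 (g y))) := by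
    intro f g
    have : nrm 1 (fun x => ‖f x‖) * nrm 1 (fun y => l2 (g y)) = ∑ x, ∑ y, ‖f x‖ * ‖g y ()‖ := by
      simp [nrm, l2, sum_mul_sum]
    rw [one_mul, this]
    refine (norm_sum_le _ _).trans (sum_le_sum fun x _ => (norm_sum_le _ _).trans
      (sum_le_sum fun y _ => ?_))
    simp [norm_chi2]
  have h1 : ∀ (f : B × B → ℂ) (g : ZMod L × ZMod L → Unit → ℂ),
      ‖∑ x, ∑ y, ∑ i, chi2 L (x.1, x.2) y * f x * g y i‖ ≤
      L * (nrm (1 / 2) (fun x => ‖f x‖) * nrm (1 / 2) (fun y => l2 (g y))) := by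
    intro f g
    have e : ∑ x, ∑ y, ∑ i, chi2 L (x.1, x.2) y * f x * g y i =
        ∑ y, ∑ i, (fun y (_ : Unit) => ∑ x : B × B, f x * chi2 L (x.1, x.2) y) y i * g y i := by
      rw [sum_comm]
      refine sum_congr rfl fun y _ => ?_
      simp only [univ_unique, sum_singleton, sum_mul]
      exact sum_congr rfl fun x _ => by ring
    rw [e]
    refine (norm_bilin_le (a := 1 / 2) (by norm_num) (by norm_num) _ g).trans ?_
    rw [show (1 : ℝ) - 1 / 2 = 1 / 2 by norm_num, ← mul_assoc]
    refine mul_le_mul_of_nonneg_right (le_of_eq ?_) (nrm_nonneg _ fun _ => l2_nonneg _)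
    rw [nrm_half_l2, nrm_half]
    simp only [univ_unique, sum_singleton]
    rw [parseval_chi2 hB, Real.sqrt_mul (by positivity), Real.sqrt_sq hL.le]
  have key : nrm a (fun z => l2 fun _ : Unit => ∑ x : B × B, c (x.1, x.2) * chi2 L (x.1, x.2) z) ≤
      (L : ℝ) ^ (2 * a) * nrm (1 - a) (fun x : B × B => ‖c (x.1, x.2)‖) := by
    refine nrm_le_of_dual ha (by linarith)
      (mul_nonneg (by positivity) (nrm_nonneg _ fun _ => norm_nonneg _)) _ fun g => ?_
    have := riesz_thorin _ one_pos (by norm_num) one_pos (by norm_num) zero_le_one hL.le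
      (by linarith : 0 ≤ 2 * a) (by linarith) h0 h1 (fun x => c (x.1, x.2)) g
    rw [show (1 - 2 * a) * 1 + 2 * a * (1 / 2) = 1 - a by ring, Real.one_rpow, one_mul] at this
    rw [mul_assoc]
    refine le_trans (le_of_eq ?_) this
    congr 1
    conv_rhs => rw [sum_comm]
    refine sum_congr rfl fun y _ => ?_
    simp only [univ_unique, sum_singleton, sum_mul]
    exact sum_congr rfl fun x _ => by ring
  have hc := @hconv ℂ _
  have hr := @hconv ℝ _
  simp only [hc, hr]
  simpa [l2, nrm] using key

/-- The square function of frequency-localized pieces of a function with given Fourier data. -/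
theorem square_function_fourier {L : ℕ} [NeZero L] {B : Finset ℤ} (hB : DR L B) {a : ℝ}
    (ha : 0 < a) (ha1 : a ≤ 1 / 2) (c : ℤ × ℤ → ℂ) {I : Type*} [Fintype I]
    (R : I → Finset (ℤ × ℤ)) (hR : ∀ i, R i ⊆ B ×ˢ B) (hd : ∀ i j, i ≠ j → Disjoint (R i) (R j))
    {μ : ℝ} (hμ0 : 0 ≤ μ) (hμ : ∀ i, ∑ ξ ∈ R i, ‖c ξ‖ ^ (1 - a)⁻¹ ≤
      μ * ∑ ξ ∈ B ×ˢ B, ‖c ξ‖ ^ (1 - a)⁻¹) :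
    nrm a (fun z => l2 (fun i => ∑ ξ ∈ R i, c ξ * chi2 L ξ z)) ≤
      (L : ℝ) ^ (2 * a) * μ ^ (1 / 2 - a) * (∑ ξ ∈ B ×ˢ B, ‖c ξ‖ ^ (1 - a)⁻¹) ^ (1 - a) := by
  classical
  set W := ∑ ξ ∈ B ×ˢ B, ‖c ξ‖ ^ (1 - a)⁻¹ with hW
  have hW0 : 0 ≤ W := sum_nonneg fun _ _ => Real.rpow_nonneg (norm_nonneg _) _
  set w : I → ℝ := fun i => ∑ ξ ∈ R i, ‖c ξ‖ ^ (1 - a)⁻¹ with hw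
  have hw0 : ∀ i, 0 ≤ w i := fun i => sum_nonneg fun _ _ => Real.rpow_nonneg (norm_nonneg _) _
  have hL : (0 : ℝ) ≤ L := Nat.cast_nonneg _
  have h1a : 0 < 1 - a := by linarith
  have hone : ∀ i, nrm a (fun z => ‖∑ ξ ∈ R i, c ξ * chi2 L ξ z‖) ≤
      (L : ℝ) ^ (2 * a) * w i ^ (1 - a) := by
    intro i
    have := hausdorff_young hB ha ha1 (fun ξ => if ξ ∈ R i then c ξ else 0)
    have e : ∀ ξ, ‖if ξ ∈ R i then c ξ else 0‖ ^ (1 - a)⁻¹ =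
        if ξ ∈ R i then ‖c ξ‖ ^ (1 - a)⁻¹ else 0 := fun ξ => by
      split_ifs
      · rfl
      · rw [norm_zero, Real.zero_rpow (inv_pos.2 h1a).ne']
    simp only [e, ite_mul, zero_mul, sum_ite_mem, inter_eq_right.2 (hR i)] at this
    exact this
  have hsum : ∑ i, w i ≤ W := by
    rw [hw, ← sum_biUnion fun i _ j _ hij => hd i j hij]
    refine sum_le_sum_of_subset_of_nonneg ?_ fun _ _ _ => Real.rpow_nonneg (norm_nonneg _) _
    exact biUnion_subset.2 fun i _ => hR i
  refine (nrm_l2_le ha ha1 _).trans (Real.sqrt_le_iff.2 ⟨by positivity, ?_⟩)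
  calc ∑ i, nrm a (fun z => ‖∑ ξ ∈ R i, c ξ * chi2 L ξ z‖) ^ 2
      ≤ ∑ i, ((L : ℝ) ^ (2 * a)) ^ 2 * ((μ * W) ^ (1 - 2 * a) * w i) := by
        refine sum_le_sum fun i _ => ?_
        refine (pow_le_pow_left₀ (nrm_nonneg _ fun _ => norm_nonneg _) (hone i) 2).trans ?_
        rw [mul_pow]
        refine mul_le_mul_of_nonneg_left ?_ (by positivity)
        rw [← Real.rpow_natCast, ← Real.rpow_mul (hw0 i),
          show (1 - a) * ((2 : ℕ) : ℝ) = (1 - 2 * a) + 1 by push_cast; ring,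
          Real.rpow_add_of_nonneg (hw0 i) (by linarith) zero_le_one, Real.rpow_one]
        exact mul_le_mul_of_nonneg_right
          (Real.rpow_le_rpow (hw0 i) (hμ i) (by linarith)) (hw0 i)
    _ ≤ ((L : ℝ) ^ (2 * a)) ^ 2 * ((μ * W) ^ (1 - 2 * a) * W) := by
        rw [← mul_sum, ← mul_sum]
        gcongr
    _ = _ := by
        rw [mul_pow, mul_pow, Real.mul_rpow hμ0 hW0, ← Real.rpow_natCast (μ ^ _),
          ← Real.rpow_natCast (W ^ _), ← Real.rpow_mul hμ0, ← Real.rpow_mul hW0,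
          show (1 - a) * ((2 : ℕ) : ℝ) = (1 - 2 * a) + 1 by push_cast; ring,
          Real.rpow_add_of_nonneg hW0 (by linarith) zero_le_one, Real.rpow_one,
          show (1 / 2 - a) * ((2 : ℕ) : ℝ) = 1 - 2 * a by push_cast; ring]
        ring

end HausdorffYoung

section Mesh

open Finset

theorem floor_two_pow_succ_div_two (n : ℕ) (s : ℝ) :
    ⌊(2 : ℝ) ^ (n + 1) * s⌋₊ / 2 = ⌊(2 : ℝ) ^ n * s⌋₊ := by
  rw [← Nat.floor_div_ofNat]
  congr 1
  rw [pow_succ]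
  simp only [OfNat.ofNat]
  ring_nf

theorem floor_two_pow_eq_of_le {n m : ℕ} (h : n ≤ m) {s t : ℝ}
    (e : ⌊(2 : ℝ) ^ m * s⌋₊ = ⌊(2 : ℝ) ^ m * t⌋₊) : ⌊(2 : ℝ) ^ n * s⌋₊ = ⌊(2 : ℝ) ^ n * t⌋₊ := by
  induction m, h using Nat.le_induction with
  | base => exact e
  | succ m _ ih =>
    refine ih ?_
    rw [← floor_two_pow_succ_div_two, e, floor_two_pow_succ_div_two]

/-- The number of dyadic levels below `T` at which `s < t` are separated by a midpoint. -/
noncomputable def sepCount (T : ℕ) (s t : ℝ) : ℕ :=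
  ∑ n ∈ range T, ∑ m ∈ range (2 ^ n),
    if ⌊(2 : ℝ) ^ (n + 1) * s⌋₊ = 2 * m ∧ ⌊(2 : ℝ) ^ (n + 1) * t⌋₊ = 2 * m + 1 then 1 else 0

theorem sepCount_eq_zero (T : ℕ) {s t : ℝ} (h : t ≤ s) : sepCount T s t = 0 := by
  refine sum_eq_zero fun n _ => sum_eq_zero fun m _ => if_neg fun e => ?_
  have : ⌊(2 : ℝ) ^ (n + 1) * t⌋₊ ≤ ⌊(2 : ℝ) ^ (n + 1) * s⌋₊ := Nat.floor_le_floor (by gcongr)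
  omega

theorem eventually_sepCount_eq_one {s t : ℝ} (hs : 0 ≤ s) (hst : s < t) (ht : t < 1) :
    ∀ᶠ T in Filter.atTop, sepCount T s t = 1 := by
  classical
  have hex : ∃ n : ℕ, ⌊(2 : ℝ) ^ n * s⌋₊ ≠ ⌊(2 : ℝ) ^ n * t⌋₊ := by
    obtain ⟨n, hn⟩ := pow_unbounded_of_one_lt (1 / (t - s)) one_lt_two
    refine ⟨n, fun e => ?_⟩
    have h1 : 1 < 2 ^ n * (t - s) := by rwa [div_lt_iff₀ (by linarith)] at hn
    have h2 := Nat.floor_le (show (0 : ℝ) ≤ 2 ^ n * s by positivity)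
    have h3 := Nat.lt_floor_add_one ((2 : ℝ) ^ n * t)
    rw [← e] at h3
    nlinarith
  obtain ⟨k, hk⟩ : ∃ k, Nat.find hex = k + 1 := by
    refine Nat.exists_eq_succ_of_ne_zero fun h => ?_
    have := Nat.find_spec hex
    rw [h] at this
    refine this ?_
    rw [pow_zero, one_mul, one_mul, Nat.floor_eq_zero.2 (by linarith), Nat.floor_eq_zero.2 ht]
  have hne : ⌊(2 : ℝ) ^ (k + 1) * s⌋₊ ≠ ⌊(2 : ℝ) ^ (k + 1) * t⌋₊ := hk ▸ Nat.find_spec hex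
  have heq : ⌊(2 : ℝ) ^ k * s⌋₊ = ⌊(2 : ℝ) ^ k * t⌋₊ := by
    by_contra h
    have := Nat.find_min' hex h
    omega
  have hle : ⌊(2 : ℝ) ^ (k + 1) * s⌋₊ ≤ ⌊(2 : ℝ) ^ (k + 1) * t⌋₊ :=
    Nat.floor_le_floor (by gcongr)
  have h1 := floor_two_pow_succ_div_two k s
  have h2 := floor_two_pow_succ_div_two k t
  filter_upwards [Filter.eventually_ge_atTop (k + 1)] with T hT
  rw [sepCount, sum_eq_single k, sum_eq_single ⌊(2 : ℝ) ^ k * s⌋₊]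
  · rw [if_pos]
    omega
  · intro m _ hm
    exact if_neg fun e => hm (by omega)
  · intro h
    refine absurd (mem_range.2 ?_) h
    have h3 : (2 : ℝ) ^ k * s < (2 ^ k : ℕ) := by
      push_cast
      have : (0 : ℝ) < 2 ^ k := by positivity
      nlinarith
    exact (Nat.floor_lt (by positivity)).2 h3
  · intro n _ hn
    refine sum_eq_zero fun m _ => if_neg fun e => ?_
    have h3 := floor_two_pow_succ_div_two n s
    have h4 := floor_two_pow_succ_div_two n t
    rcases lt_or_gt_of_ne hn with h | h
    · have := floor_two_pow_eq_of_le (show n + 1 ≤ k by omega) heq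
      omega
    · exact hne (floor_two_pow_eq_of_le (show k + 1 ≤ n by omega) (by omega))
  · intro h
    exact absurd (mem_range.2 (by omega)) h

/-- Half of the normalised distribution function of the weight `W` on `[-K, K]`. -/
noncomputable def cdf (K : ℕ) (W : ℤ → ℝ) (x : ℤ) : ℝ :=
  (∑ y ∈ Ico (-(K : ℤ)) x, W y + W x / 2) / (2 * ∑ y ∈ Icc (-(K : ℤ)) K, W y)

theorem cdf_sub {K : ℕ} {W : ℤ → ℝ} {x x' : ℤ} (hx : -(K : ℤ) ≤ x) (h : x < x') :
    cdf K W x' - cdf K W x =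
      (W x / 2 + ∑ y ∈ Ioo x x', W y + W x' / 2) / (2 * ∑ y ∈ Icc (-(K : ℤ)) K, W y) := by
  have : ∑ y ∈ Ico (-(K : ℤ)) x', W y =
      ∑ y ∈ Ico (-(K : ℤ)) x, W y + (W x + ∑ y ∈ Ioo x x', W y) := by
    rw [← Ico_union_Ico_eq_Ico hx h.le, sum_union (Ico_disjoint_Ico_consecutive _ _ _),
      ← Ioo_insert_left h, sum_insert (by simp)]
  rw [cdf, cdf, this]
  ring

/-- Dyadic mesh adapted to the weight `W`; `E true n m` and `E false n m` are the two halves of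
the `m`-th cell of level `n`. -/
theorem exists_mesh (K : ℕ) (W : ℤ → ℝ) (hW : ∀ x, 0 ≤ W x) :
    ∃ (E : Bool → ℕ → ℕ → Finset ℤ) (T₀ : ℕ),
      (∀ b n m, IsIv K (E b n m)) ∧
      (∀ b n m m', m ≠ m' → Disjoint (E b n m) (E b n m')) ∧
      (∀ b n m, ∑ x ∈ E b n m, W x ≤ 4 * (2 ^ n)⁻¹ * ∑ x ∈ Icc (-(K : ℤ)) K, W x) ∧
      (∀ b n m, T₀ ≤ n → E b n m = ∅) ∧
      ∀ T ≥ T₀, ∀ x ∈ Icc (-(K : ℤ)) K, ∀ x' ∈ Icc (-(K : ℤ)) K, W x ≠ 0 ∨ W x' ≠ 0 →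
        ∑ n ∈ range T, ∑ m ∈ range (2 ^ n), (if x ∈ E true n m ∧ x' ∈ E false n m then 1 else 0) =
          if x < x' then 1 else 0 := by
  classical
  set B := Icc (-(K : ℤ)) K with hB
  set tot := ∑ x ∈ B, W x with htot
  rcases (sum_nonneg fun x (_ : x ∈ B) => hW x).eq_or_lt with h0 | h0
  · refine ⟨fun _ _ _ => ∅, 0, fun _ _ _ => isIv_of_ordConnected (by simpa using
      Set.ordConnected_empty) (by simp), by simp, fun _ _ _ => ?_, by simp, ?_⟩
    · rw [sum_empty]; positivity
    · intro T _ x hx x' hx' h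
      have := (sum_eq_zero_iff_of_nonneg fun x _ => hW x).1 h0.symm
      exact absurd h (by simp [this x hx, this x' hx'])
  have hsub : ∀ {S : Finset ℤ}, S ⊆ B → ∑ x ∈ S, W x ≤ tot := fun h =>
    sum_le_sum_of_subset_of_nonneg h fun x _ _ => hW x
  set Φ := cdf K W with hΦ
  have hΦ0 : ∀ x, 0 ≤ Φ x := fun x =>
    div_nonneg (add_nonneg (sum_nonneg fun y _ => hW y) (by linarith [hW x])) (by linarith)
  have hΦ1 : ∀ x ∈ B, Φ x < 1 := fun x hx => by
    rw [hΦ, cdf, div_lt_one (by linarith)]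
    have h1 : ∑ y ∈ Ico (-(K : ℤ)) x, W y ≤ tot :=
      hsub fun y hy => by rw [mem_Ico] at hy; rw [hB, mem_Icc] at *; omega
    have h2 : W x ≤ tot := single_le_sum (f := W) (fun x _ => hW x) hx
    linarith
  have hmono : ∀ x ∈ B, ∀ x', x ≤ x' → Φ x ≤ Φ x' := fun x hx x' h => by
    rcases h.eq_or_lt with rfl | h
    · rfl
    rw [← sub_nonneg, hΦ, cdf_sub (mem_Icc.1 hx).1 h]
    have := sum_nonneg fun y (_ : y ∈ Ioo x x') => hW y
    exact div_nonneg (by linarith [hW x, hW x']) (by linarith)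
  have hstrict : ∀ x ∈ B, ∀ x', x < x' → (W x ≠ 0 ∨ W x' ≠ 0) → Φ x < Φ x' :=
      fun x hx x' h hne => by
    rw [← sub_pos, hΦ, cdf_sub (mem_Icc.1 hx).1 h]
    have := sum_nonneg fun y (_ : y ∈ Ioo x x') => hW y
    refine div_pos ?_ (by linarith)
    rcases hne with h | h
    · linarith [lt_of_le_of_ne (hW x) (Ne.symm h), hW x']
    · linarith [lt_of_le_of_ne (hW x') (Ne.symm h), hW x]
  obtain ⟨T₀, hT₀⟩ : ∃ T₀, ∀ x ∈ B, ∀ x' ∈ B, Φ x < Φ x' → sepCount T₀ (Φ x) (Φ x') = 1 := by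
    have : ∀ᶠ T in Filter.atTop, ∀ x ∈ B, ∀ x' ∈ B, Φ x < Φ x' → sepCount T (Φ x) (Φ x') = 1 := by
      refine (Filter.eventually_all_finset B).2 fun x _ =>
        (Filter.eventually_all_finset B).2 fun x' hx' => ?_
      by_cases h : Φ x < Φ x'
      · filter_upwards [eventually_sepCount_eq_one (hΦ0 x) h (hΦ1 x' hx')] with T hT _ using hT
      · exact Filter.Eventually.of_forall fun _ h' => absurd h' h
    exact this.exists
  let bit : Bool → ℕ := fun b => if b then 0 else 1
  let E₀ : Bool → ℕ → ℕ → Finset ℤ := fun b n m =>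
    B.filter fun x => ⌊(2 : ℝ) ^ (n + 1) * Φ x⌋₊ = 2 * m + bit b
  let E : Bool → ℕ → ℕ → Finset ℤ := fun b n m =>
    if n < T₀ ∧ (E₀ true n m).Nonempty ∧ (E₀ false n m).Nonempty then E₀ b n m else ∅
  have hEsub : ∀ b n m, E b n m ⊆ E₀ b n m := fun b n m => by
    simp only [E]; split_ifs <;> simp
  have hmem : ∀ {b n m x}, x ∈ E b n m → x ∈ B ∧ ⌊(2 : ℝ) ^ (n + 1) * Φ x⌋₊ = 2 * m + bit b :=
    fun {b n m x} h => mem_filter.1 (hEsub b n m h)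
  refine ⟨E, T₀, fun b n m => ?_, fun b n m m' hm => ?_, fun b n m => ?_, fun b n m hn => ?_, ?_⟩
  · refine isIv_of_ordConnected ?_ fun x hx => mem_Icc.1 (hmem hx).1
    by_cases hc : n < T₀ ∧ (E₀ true n m).Nonempty ∧ (E₀ false n m).Nonempty
    · refine ⟨fun x hx y hy z hz => ?_⟩
      have hx' := hmem hx
      have hy' := hmem hy
      have hzB : z ∈ B := by
        have := mem_Icc.1 hx'.1; have := mem_Icc.1 hy'.1; have := hz.1; have := hz.2
        exact mem_Icc.2 ⟨by omega, by omega⟩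
      simp only [E, if_pos hc, E₀, coe_filter, Set.mem_ofPred_eq]
      refine ⟨hzB, le_antisymm ?_ ?_⟩
      · rw [← hy'.2]; have := hmono z hzB y hz.2; exact Nat.floor_le_floor (by gcongr)
      · rw [← hx'.2]; have := hmono x hx'.1 z hz.1; exact Nat.floor_le_floor (by gcongr)
    · simp only [E, if_neg hc, coe_empty]; exact Set.ordConnected_empty
  · refine disjoint_left.2 fun x hx hx' => hm ?_
    have := (hmem hx).2; have := (hmem hx').2
    omega
  · by_cases hc : n < T₀ ∧ (E₀ true n m).Nonempty ∧ (E₀ false n m).Nonempty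
    swap
    · simp only [E, if_neg hc, sum_empty]; positivity
    obtain ⟨-, ⟨u, hu⟩, ⟨v, hv⟩⟩ := hc
    set P := B.filter fun x => ⌊(2 : ℝ) ^ n * Φ x⌋₊ = m with hP
    have hEP : ∀ b, E₀ b n m ⊆ P := fun b x hx => by
      have h := mem_filter.1 hx
      refine mem_filter.2 ⟨h.1, ?_⟩
      rw [← floor_two_pow_succ_div_two, h.2]
      have : bit b ≤ 1 := by cases b <;> simp [bit]
      omega
    have hPne : P.Nonempty := ⟨u, hEP _ hu⟩
    set x₀ := P.min' hPne
    set x₁ := P.max' hPne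
    have hx₀ := mem_filter.1 (P.min'_mem hPne)
    have hx₁ := mem_filter.1 (P.max'_mem hPne)
    have hlt : x₀ < x₁ := by
      refine lt_of_le_of_ne (P.min'_le_max' hPne) fun e => ?_
      have huv : u = v := by
        have := P.min'_le u (hEP _ hu); have := P.le_max' u (hEP _ hu)
        have := P.min'_le v (hEP _ hv); have := P.le_max' v (hEP _ hv)
        omega
      have h1 := (mem_filter.1 hu).2; have h2 := (mem_filter.1 hv).2
      rw [huv] at h1
      simp only [bit] at h1 h2
      simp at h1 h2
      omega
    have hd := cdf_sub (W := W) (mem_Icc.1 hx₀.1).1 hlt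
    have hfl : Φ x₁ - Φ x₀ ≤ (2 ^ n)⁻¹ := by
      have h1 := Nat.floor_le (show (0 : ℝ) ≤ 2 ^ n * Φ x₀ from mul_nonneg (by positivity) (hΦ0 _))
      have h2 := Nat.lt_floor_add_one ((2 : ℝ) ^ n * Φ x₁)
      rw [hx₀.2] at h1
      rw [hx₁.2] at h2
      have h3 : (0 : ℝ) < 2 ^ n := by positivity
      rw [← one_div, le_div_iff₀ h3]
      nlinarith
    have hPsum : ∑ x ∈ P, W x ≤ W x₀ + ∑ y ∈ Ioo x₀ x₁, W y + W x₁ := by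
      have : P ⊆ Icc x₀ x₁ := fun x hx => mem_Icc.2 ⟨P.min'_le x hx, P.le_max' x hx⟩
      refine (sum_le_sum_of_subset_of_nonneg this fun x _ _ => hW x).trans (le_of_eq ?_)
      rw [← Ico_insert_right hlt.le, sum_insert (by simp), ← Ioo_insert_left hlt,
        sum_insert (by simp)]
      ring
    have h1 : ∑ x ∈ E b n m, W x ≤ ∑ x ∈ P, W x :=
      sum_le_sum_of_subset_of_nonneg ((hEsub b n m).trans (hEP b)) fun x _ _ => hW x
    have h2 : W x₀ / 2 + ∑ y ∈ Ioo x₀ x₁, W y + W x₁ / 2 ≤ (2 ^ n)⁻¹ * (2 * tot) := by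
      rw [← div_le_iff₀ (by linarith)]
      exact hd ▸ hfl
    have := sum_nonneg fun y (_ : y ∈ Ioo x₀ x₁) => hW y
    linarith
  · simp only [E]
    rw [if_neg]
    omega
  · intro T hT x hx x' hx' hne
    have key : ∑ n ∈ range T, ∑ m ∈ range (2 ^ n),
        (if x ∈ E true n m ∧ x' ∈ E false n m then 1 else 0) = sepCount T₀ (Φ x) (Φ x') := by
      rw [sepCount, ← sum_subset (range_mono hT)]
      · refine sum_congr rfl fun n hn => sum_congr rfl fun m _ => ?_
        refine if_congr ⟨fun h => ⟨(hmem h.1).2, (hmem h.2).2⟩, fun h => ?_⟩ rfl rfl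
        have h1 : x ∈ E₀ true n m := mem_filter.2 ⟨hx, by simp [bit, h.1]⟩
        have h2 : x' ∈ E₀ false n m := mem_filter.2 ⟨hx', by simp [bit, h.2]⟩
        have hc : n < T₀ ∧ (E₀ true n m).Nonempty ∧ (E₀ false n m).Nonempty :=
          ⟨mem_range.1 hn, ⟨x, h1⟩, ⟨x', h2⟩⟩
        simp only [E, if_pos hc]
        exact ⟨h1, h2⟩
      · intro n _ hn
        refine sum_eq_zero fun m _ => if_neg fun h => ?_
        simp only [E] at h
        rw [if_neg (fun h' => hn (mem_range.2 h'.1))] at h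
        simp at h
    rw [key]
    split_ifs with h
    · exact hT₀ x hx x' hx' (hstrict x hx x' h hne)
    · exact sepCount_eq_zero _ (hmono x' hx' x (not_lt.1 h))

/-- A two-parameter mesh of pairs of rectangles. -/
structure Mesh (K : ℕ) where
  /-- The first sides. -/
  E : Bool → ℕ → ℕ → Finset ℤ
  /-- The second sides. -/
  F : Bool → ℕ → ℕ → ℕ → ℕ → Finset ℤ
  isIv_E : ∀ b n m, IsIv K (E b n m)
  isIv_F : ∀ b n m l q, IsIv K (F b n m l q)
  disj_E : ∀ b n m m', m ≠ m' → Disjoint (E b n m) (E b n m')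
  disj_F : ∀ b n m l q q', q ≠ q' → Disjoint (F b n m l q) (F b n m l q')

/-- Indices of rectangles: a pair of levels and a pair of positions. -/
abbrev RIdx (T : ℕ) : Type := Σ p : Fin T × Fin T, Fin (2 ^ (p.1 : ℕ)) × Fin (2 ^ (p.2 : ℕ))

/-- The rectangle of a mesh with a given index. -/
def Mesh.rect {K T : ℕ} (M : Mesh K) (b : Bool) (e : RIdx T) : Finset (ℤ × ℤ) :=
  M.E b e.1.1 e.2.1 ×ˢ M.F b e.1.1 e.2.1 e.1.2 e.2.2

theorem Mesh.rect_subset {K T : ℕ} (M : Mesh K) (b : Bool) (e : RIdx T) :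
    M.rect b e ⊆ Icc (-(K : ℤ)) K ×ˢ Icc (-(K : ℤ)) K := by
  refine product_subset_product (fun x hx => mem_Icc.2 ?_) fun x hx => mem_Icc.2 ?_
  · exact (M.isIv_E _ _ _).subset hx
  · exact (M.isIv_F _ _ _ _ _).subset hx

theorem exists_mesh_prod (K : ℕ) (w : ℤ × ℤ → ℝ) (hw : ∀ ξ, 0 ≤ w ξ) (s : Bool) :
    ∃ (M : Mesh K) (T₀ : ℕ),
      (∀ T (e : RIdx T), ∑ ξ ∈ M.rect s e, w ξ ≤
        16 * (2 ^ (e.1.1 + e.1.2 : ℕ))⁻¹ * ∑ ξ ∈ Icc (-(K : ℤ)) K ×ˢ Icc (-(K : ℤ)) K, w ξ) ∧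
      ∀ T ≥ T₀, ∀ u ∈ Icc (-(K : ℤ)) K ×ˢ Icc (-(K : ℤ)) K,
        ∀ v ∈ Icc (-(K : ℤ)) K ×ˢ Icc (-(K : ℤ)) K, w (if s then u else v) ≠ 0 →
        ∑ e : RIdx T, (if u ∈ M.rect true e ∧ v ∈ M.rect false e then 1 else 0) =
          if u.1 < v.1 ∧ u.2 < v.2 then 1 else 0 := by
  set B := Icc (-(K : ℤ)) K with hB
  obtain ⟨E, T₁, hE, hEd, hEm, hE0, hEs⟩ := exists_mesh K (fun x => ∑ y ∈ B, w (x, y))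
    fun x => sum_nonneg fun y _ => hw _
  choose F T₂ hF hFd hFm hF0 hFs using fun n m => exists_mesh K (fun y => ∑ x ∈ E s n m, w (x, y))
    fun x => sum_nonneg fun y _ => hw _
  have hEB : ∀ b n m, E b n m ⊆ B := fun b n m x hx => mem_Icc.2 ((hE b n m).subset hx)
  let M : Mesh K :=
    { E := E
      F := fun b n m => F n m b
      isIv_E := hE
      isIv_F := fun b n m => hF n m b
      disj_E := hEd
      disj_F := fun b n m => hFd n m b }
  refine ⟨M, T₁ + ∑ n ∈ range T₁, ∑ m ∈ range (2 ^ n), T₂ n m, fun T e => ?_, ?_⟩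
  · have h1 := hFm e.1.1 e.2.1 s e.1.2 e.2.2
    have h2 := hEm s e.1.1 e.2.1
    rw [Mesh.rect, sum_product_right]
    refine h1.trans ?_
    rw [sum_comm]
    have h3 : ∑ x ∈ E s e.1.1 e.2.1, ∑ y ∈ B, w (x, y) ≤
      4 * (2 ^ (e.1.1 : ℕ))⁻¹ * ∑ x ∈ B, ∑ y ∈ B, w (x, y) := h2
    refine (mul_le_mul_of_nonneg_left h3 (by positivity)).trans (le_of_eq ?_)
    rw [sum_product, pow_add, mul_inv]
    ring
  · intro T hT u hu v hv hne
    rw [mem_product] at hu hv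
    have hW : ∀ x ∈ B, ∀ y ∈ B, w (x, y) ≠ 0 → ∑ y ∈ B, w (x, y) ≠ 0 := fun x _ y hy h h0 =>
      h ((sum_eq_zero_iff_of_nonneg fun y _ => hw _).1 h0 y hy)
    have hW' : ∀ n m, ∀ x ∈ E s n m, ∀ y, w (x, y) ≠ 0 → ∑ x ∈ E s n m, w (x, y) ≠ 0 :=
      fun n m x hx y h h0 => h ((sum_eq_zero_iff_of_nonneg fun x _ => hw _).1 h0 x hx)
    have hx := hEs T (by omega) u.1 hu.1 v.1 hv.1 (by
      cases s
      · exact Or.inr (hW _ hv.1 _ hv.2 hne)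
      · exact Or.inl (hW _ hu.1 _ hu.2 hne))
    have hy : ∀ n m, m < 2 ^ n → u.1 ∈ E true n m → v.1 ∈ E false n m →
        ∑ l ∈ range T, ∑ q ∈ range (2 ^ l),
          (if u.2 ∈ F n m true l q ∧ v.2 ∈ F n m false l q then 1 else 0) =
        if u.2 < v.2 then 1 else 0 := fun n m hm hu1 hv1 => by
      refine hFs n m T ?_ _ hu.2 _ hv.2 ?_
      · have hn : n < T₁ := by
          by_contra h
          rw [hE0 true n m (by omega)] at hu1
          simp at hu1
        have h1 := single_le_sum (f := fun m => T₂ n m) (fun _ _ => Nat.zero_le _)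
          (mem_range.2 hm)
        have h2 := single_le_sum (f := fun n => ∑ m ∈ range (2 ^ n), T₂ n m)
          (fun _ _ => Nat.zero_le _) (mem_range.2 hn)
        omega
      · cases s
        · exact Or.inr (hW' n m _ hv1 _ hne)
        · exact Or.inl (hW' n m _ hu1 _ hne)
    rw [Fintype.sum_sigma, Fintype.sum_prod_type]
    have e1 : ∀ n l : Fin T, ∑ y : Fin (2 ^ (n : ℕ)) × Fin (2 ^ (l : ℕ)),
        (if u ∈ M.rect (T := T) true ⟨(n, l), y⟩ ∧ v ∈ M.rect (T := T) false ⟨(n, l), y⟩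
          then 1 else 0) =
        ∑ m ∈ range (2 ^ (n : ℕ)), ∑ q ∈ range (2 ^ (l : ℕ)),
          (if u.1 ∈ E true n m ∧ v.1 ∈ E false n m then
            (if u.2 ∈ F n m true l q ∧ v.2 ∈ F n m false l q then 1 else 0) else 0) := by
      intro n l
      rw [Fintype.sum_prod_type, sum_range]
      refine sum_congr rfl fun m _ => ?_
      rw [sum_range]
      refine sum_congr rfl fun q _ => ?_
      simp only [Mesh.rect, mem_product, M]
      split_ifs <;> tauto
    simp only [e1]
    rw [← sum_range (fun n => ∑ l : Fin T, ∑ m ∈ range (2 ^ n), ∑ q ∈ range (2 ^ (l : ℕ)),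
          (if u.1 ∈ E true n m ∧ v.1 ∈ E false n m then
            (if u.2 ∈ F n m true l q ∧ v.2 ∈ F n m false l q then 1 else 0) else 0))]
    have e2 : ∀ n ∈ range T, ∑ l : Fin T, ∑ m ∈ range (2 ^ n), ∑ q ∈ range (2 ^ (l : ℕ)),
          (if u.1 ∈ E true n m ∧ v.1 ∈ E false n m then
            (if u.2 ∈ F n m true l q ∧ v.2 ∈ F n m false l q then 1 else 0) else 0) =
        ∑ m ∈ range (2 ^ n), (if u.1 ∈ E true n m ∧ v.1 ∈ E false n m then 1 else 0) *
          (if u.2 < v.2 then 1 else 0) := by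
      intro n _
      rw [sum_comm]
      refine sum_congr rfl fun m hm => ?_
      rw [← sum_range (fun l => ∑ q ∈ range (2 ^ l),
          (if u.1 ∈ E true n m ∧ v.1 ∈ E false n m then
            (if u.2 ∈ F n m true l q ∧ v.2 ∈ F n m false l q then 1 else 0) else 0))]
      by_cases h : u.1 ∈ E true n m ∧ v.1 ∈ E false n m
      · simp only [if_pos h, one_mul]
        exact hy n m (mem_range.1 hm) h.1 h.2
      · simp [if_neg h]
    rw [sum_congr rfl e2]
    simp only [← sum_mul]
    rw [hx]
    split_ifs <;> tauto

/-- The mesh consisting of the whole box. -/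
theorem exists_mesh_trivial (K : ℕ) : ∃ M : Mesh K, ∀ T (e : RIdx T) b,
    M.rect b e = if (e.1.1 : ℕ) = 0 ∧ (e.1.2 : ℕ) = 0 then
      Icc (-(K : ℤ)) K ×ˢ Icc (-(K : ℤ)) K else ∅ := by
  have hB : IsIv K (Icc (-(K : ℤ)) K) :=
    isIv_of_ordConnected (by simpa using Set.ordConnected_Icc) (by simp)
  have h0 : IsIv K ∅ :=
    isIv_of_ordConnected (by simpa using Set.ordConnected_empty) (by simp)
  let M : Mesh K :=
    { E := fun _ n m => if n = 0 ∧ m = 0 then Icc (-(K : ℤ)) K else ∅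
      F := fun _ _ _ l q => if l = 0 ∧ q = 0 then Icc (-(K : ℤ)) K else ∅
      isIv_E := fun _ n m => by split_ifs <;> assumption
      isIv_F := fun _ _ _ l q => by split_ifs <;> assumption
      disj_E := fun _ n m m' h => by
        split_ifs <;> first | omega | simp
      disj_F := fun _ _ _ l q q' h => by
        split_ifs <;> first | omega | simp }
  refine ⟨M, fun T e b => ?_⟩
  obtain ⟨⟨n, l⟩, m, q⟩ := e
  simp only [Mesh.rect, M]
  have hm : (n : ℕ) = 0 → (m : ℕ) = 0 := fun h => by have := m.2; simp only [h] at this; omega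
  have hq : (l : ℕ) = 0 → (q : ℕ) = 0 := fun h => by have := q.2; simp only [h] at this; omega
  by_cases h1 : (n : ℕ) = 0 <;> by_cases h2 : (l : ℕ) = 0 <;>
    simp [h1, h2, hm, hq]

end Mesh

section Vertex

open Finset

/-- The sum of a pair of levels. -/
def lev {T : ℕ} (p : Fin T × Fin T) : ℝ := (p.1 : ℕ) + (p.2 : ℕ)

/-- The weight attached to a rectangle index. -/
noncomputable def wt {T : ℕ} (κ : ℝ) (e : RIdx T) : ℝ := 2 ^ (κ * lev e.1)

theorem wt_neg_mul {T : ℕ} (κ : ℝ) (e : RIdx T) : wt (-κ) e * wt κ e = 1 := by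
  rw [wt, wt, ← Real.rpow_add two_pos]
  simp

theorem two_pow_level {T : ℕ} (p : Fin T × Fin T) :
    (((2 : ℕ) ^ (p.1 : ℕ) * 2 ^ (p.2 : ℕ) : ℕ) : ℝ) = 2 ^ lev p := by
  rw [lev, Real.rpow_add two_pos, Real.rpow_natCast, Real.rpow_natCast]
  push_cast
  rfl

theorem sum_two_rpow_lev_le {δ : ℝ} (hδ : 0 < δ) (T : ℕ) :
    ∑ p : Fin T × Fin T, (2 : ℝ) ^ (-δ * lev p) ≤ ((1 - 2 ^ (-δ))⁻¹) ^ 2 := by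
  set r : ℝ := 2 ^ (-δ)
  have hr0 : 0 < r := Real.rpow_pos_of_pos two_pos _
  have hr1 : r < 1 := Real.rpow_lt_one_of_one_lt_of_neg one_lt_two (by linarith)
  have h : ∀ p : Fin T × Fin T, (2 : ℝ) ^ (-δ * lev p) = r ^ (p.1 : ℕ) * r ^ (p.2 : ℕ) := by
    intro p
    rw [lev, Real.rpow_mul two_pos.le, Real.rpow_add hr0, Real.rpow_natCast, Real.rpow_natCast]
  have hg : ∑ n : Fin T, r ^ (n : ℕ) ≤ (1 - r)⁻¹ := by
    rw [← sum_range (fun n => r ^ n), ← tsum_geometric_of_lt_one hr0.le hr1]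
    exact (summable_geometric_of_lt_one hr0.le hr1).sum_le_tsum _ fun _ _ => by positivity
  simp only [h, Fintype.sum_prod_type, ← mul_sum, ← sum_mul]
  rw [← sq]
  exact pow_le_pow_left₀ (sum_nonneg fun _ _ => by positivity) hg 2

theorem l2_equiv {I J : Type*} [Fintype I] [Fintype J] (e : I ≃ J) (g : J → ℂ) :
    l2 (fun i => g (e i)) = l2 g := by
  rw [l2, l2, ← e.sum_comp]

theorem l2_sigma_le {T : ℕ} (g : RIdx T × RIdx T → ℂ) :
    l2 g ≤ ∑ P : (Fin T × Fin T) × (Fin T × Fin T),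
      l2 (fun j : (Fin (2 ^ (P.1.1 : ℕ)) × Fin (2 ^ (P.1.2 : ℕ))) ×
        (Fin (2 ^ (P.2.1 : ℕ)) × Fin (2 ^ (P.2.2 : ℕ))) => g (⟨P.1, j.1⟩, ⟨P.2, j.2⟩)) := by
  refine Real.sqrt_le_iff.2 ⟨sum_nonneg fun _ _ => l2_nonneg _, ?_⟩
  refine le_trans (le_of_eq ?_) (sum_sq_le_sq_sum_of_nonneg fun _ _ => l2_nonneg _)
  simp only [l2_sq]
  rw [Fintype.sum_prod_type, Fintype.sum_prod_type, Fintype.sum_sigma]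
  refine sum_congr rfl fun p _ => ?_
  simp only [Fintype.sum_sigma]
  rw [sum_comm]
  refine sum_congr rfl fun p' _ => ?_
  simp only [Fintype.sum_prod_type]

/-- Summation over levels of weighted square functions. -/
theorem exists_weighted_level_bound {κ₁ κ₂ ρ₁ ρ₂ : ℝ} (h₁ : κ₁ < ρ₁) (h₂ : κ₂ < ρ₂) :
    ∃ C : ℝ, 0 < C ∧ ∀ {X : Type} [Fintype X] {a : ℝ}, 0 < a → a ≤ 1 → ∀ {T : ℕ}
      (H : RIdx T × RIdx T → X → ℂ) {D : ℝ}, 0 ≤ D →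
      (∀ p₁ p₂ : Fin T × Fin T,
        nrm a (fun z => l2 (fun j : (Fin (2 ^ (p₁.1 : ℕ)) × Fin (2 ^ (p₁.2 : ℕ))) ×
          (Fin (2 ^ (p₂.1 : ℕ)) × Fin (2 ^ (p₂.2 : ℕ))) => H (⟨p₁, j.1⟩, ⟨p₂, j.2⟩) z)) ≤
          D * (2 ^ (-ρ₁ * lev p₁) * 2 ^ (-ρ₂ * lev p₂))) →
      nrm a (fun z => l2 (fun i => ((wt κ₁ i.1 * wt κ₂ i.2 : ℝ) : ℂ) * H i z)) ≤ C * D := by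
  have hpos : ∀ δ : ℝ, 0 < δ → 0 < ((1 - (2 : ℝ) ^ (-δ))⁻¹) ^ 2 := fun δ hδ => by
    have := Real.rpow_lt_one_of_one_lt_of_neg (one_lt_two : (1 : ℝ) < 2) (neg_lt_zero.2 hδ)
    have : 0 < 1 - (2 : ℝ) ^ (-δ) := by linarith
    positivity
  refine ⟨_, mul_pos (hpos (ρ₁ - κ₁) (by linarith)) (hpos (ρ₂ - κ₂) (by linarith)), ?_⟩
  intro X _ a ha ha1 T H D hD hH
  refine (nrm_mono ha (fun _ => l2_nonneg _) fun z => l2_sigma_le _).trans ?_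
  refine (nrm_sum_le ha ha1 univ fun _ _ => l2_nonneg _).trans ?_
  have hterm : ∀ P : (Fin T × Fin T) × (Fin T × Fin T),
      nrm a (fun z => l2 (fun j : (Fin (2 ^ (P.1.1 : ℕ)) × Fin (2 ^ (P.1.2 : ℕ))) ×
        (Fin (2 ^ (P.2.1 : ℕ)) × Fin (2 ^ (P.2.2 : ℕ))) =>
          ((wt κ₁ (⟨P.1, j.1⟩ : RIdx T) * wt κ₂ (⟨P.2, j.2⟩ : RIdx T) : ℝ) : ℂ) *
            H (⟨P.1, j.1⟩, ⟨P.2, j.2⟩) z)) ≤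
      D * (2 ^ (-(ρ₁ - κ₁) * lev P.1) * 2 ^ (-(ρ₂ - κ₂) * lev P.2)) := by
    intro P
    simp only [wt, l2_smul]
    have hw : (0 : ℝ) ≤ 2 ^ (κ₁ * lev P.1) * 2 ^ (κ₂ * lev P.2) := by positivity
    rw [Complex.norm_real, Real.norm_of_nonneg hw, nrm_mul_left ha hw fun _ => l2_nonneg _]
    refine (mul_le_mul_of_nonneg_left (hH P.1 P.2) hw).trans (le_of_eq ?_)
    rw [show -(ρ₁ - κ₁) * lev P.1 = κ₁ * lev P.1 + -ρ₁ * lev P.1 by ring,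
      show -(ρ₂ - κ₂) * lev P.2 = κ₂ * lev P.2 + -ρ₂ * lev P.2 by ring,
      Real.rpow_add two_pos, Real.rpow_add two_pos]
    ring
  refine (sum_le_sum fun P _ => hterm P).trans ?_
  rw [← mul_sum, mul_comm, Fintype.sum_prod_type]
  simp only [← mul_sum, ← sum_mul]
  refine mul_le_mul_of_nonneg_right (mul_le_mul (sum_two_rpow_lev_le (by linarith) T)
    (sum_two_rpow_lev_le (by linarith) T) (sum_nonneg fun _ _ => by positivity)
    (hpos _ (by linarith)).le) hD

/-- The vertex estimate at a Wiener vertex. -/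
theorem exists_wiener_vertex_bound {a κ₁ κ₂ : ℝ} (ha : 0 < a) (ha1 : a < 1 / 2)
    (h₁ : κ₁ < (1 / 2 - a) / 2) (h₂ : κ₂ < (1 / 2 - a) / 2) :
    ∃ C : ℝ, 0 < C ∧ ∀ (L : ℕ) [NeZero L] (K T : ℕ), DR L (Icc (-(K : ℤ)) K) →
      ∀ (M₁ M₂ : Mesh K) (c : ℤ × ℤ → ℂ),
      (∀ e : RIdx T, ∑ ξ ∈ M₁.rect false e, ‖c ξ‖ ^ (1 - a)⁻¹ ≤
        16 * (2 ^ (e.1.1 + e.1.2 : ℕ))⁻¹ *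
          ∑ ξ ∈ Icc (-(K : ℤ)) K ×ˢ Icc (-(K : ℤ)) K, ‖c ξ‖ ^ (1 - a)⁻¹) →
      (∀ e : RIdx T, ∑ ξ ∈ M₂.rect true e, ‖c ξ‖ ^ (1 - a)⁻¹ ≤
        16 * (2 ^ (e.1.1 + e.1.2 : ℕ))⁻¹ *
          ∑ ξ ∈ Icc (-(K : ℤ)) K ×ˢ Icc (-(K : ℤ)) K, ‖c ξ‖ ^ (1 - a)⁻¹) →
      nrm a (fun z : ZMod L × ZMod L => l2 (fun i : RIdx T × RIdx T =>
        ((wt κ₁ i.1 * wt κ₂ i.2 : ℝ) : ℂ) *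
          ∑ ξ ∈ M₁.rect false i.1 ∩ M₂.rect true i.2, c ξ * chi2 L ξ z)) ≤
      C * ((L : ℝ) ^ (2 * a) *
        (∑ ξ ∈ Icc (-(K : ℤ)) K ×ˢ Icc (-(K : ℤ)) K, ‖c ξ‖ ^ (1 - a)⁻¹) ^ (1 - a)) := by
  obtain ⟨C, hC, h⟩ := exists_weighted_level_bound h₁ h₂
  refine ⟨C * 16 ^ (1 / 2 - a), by positivity, ?_⟩
  intro L _ K T hL M₁ M₂ c hm₁ hm₂
  set W := ∑ ξ ∈ Icc (-(K : ℤ)) K ×ˢ Icc (-(K : ℤ)) K, ‖c ξ‖ ^ (1 - a)⁻¹ with hW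
  have hw0 : ∀ ξ, 0 ≤ ‖c ξ‖ ^ (1 - a)⁻¹ := fun ξ => Real.rpow_nonneg (norm_nonneg _) _
  have hW0 : 0 ≤ W := sum_nonneg fun ξ _ => hw0 ξ
  rw [mul_assoc]
  refine h ha (by linarith) (fun i z =>
    ∑ ξ ∈ M₁.rect false i.1 ∩ M₂.rect true i.2, c ξ * chi2 L ξ z) (by positivity) ?_
  intro p₁ p₂
  set x : ℝ := (2 ^ lev p₁)⁻¹
  set y : ℝ := (2 ^ lev p₂)⁻¹
  have hx : 0 < x := by positivity
  have hy : 0 < y := by positivity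
  have hlev : ∀ p : Fin T × Fin T, ((2 : ℝ) ^ (p.1 + p.2 : ℕ))⁻¹ = (2 ^ lev p)⁻¹ := fun p => by
    rw [← two_pow_level, pow_add]; push_cast; rfl
  refine (square_function_fourier (μ := 16 * √(x * y)) hL ha ha1.le c
    (fun j : (Fin (2 ^ (p₁.1 : ℕ)) × Fin (2 ^ (p₁.2 : ℕ))) ×
        (Fin (2 ^ (p₂.1 : ℕ)) × Fin (2 ^ (p₂.2 : ℕ))) =>
      M₁.rect (T := T) false ⟨p₁, j.1⟩ ∩ M₂.rect (T := T) true ⟨p₂, j.2⟩)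
    (fun j => inter_subset_left.trans (M₁.rect_subset _ _)) ?_ (by positivity) ?_).trans
    (le_of_eq ?_)
  · intro i j hij
    refine disjoint_left.2 fun ξ hi hj => hij ?_
    simp only [mem_inter, Mesh.rect, mem_product] at hi hj
    have hE : ∀ (M : Mesh K) b n m m' l q q', ξ.1 ∈ M.E b n m → ξ.1 ∈ M.E b n m' →
        ξ.2 ∈ M.F b n m l q → ξ.2 ∈ M.F b n m' l q' → m = m' ∧ q = q' := by
      intro M b n m m' l q q' e1 e2 f1 f2
      have hmm : m = m' := by
        by_contra hne
        exact disjoint_left.1 (M.disj_E b n m m' hne) e1 e2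
      subst hmm
      refine ⟨rfl, ?_⟩
      by_contra hne
      exact disjoint_left.1 (M.disj_F b n m l q q' hne) f1 f2
    have e1 := hE _ _ _ _ _ _ _ _ hi.1.1 hj.1.1 hi.1.2 hj.1.2
    have e2 := hE _ _ _ _ _ _ _ _ hi.2.1 hj.2.1 hi.2.2 hj.2.2
    exact Prod.ext (Prod.ext (Fin.ext e1.1) (Fin.ext e1.2))
      (Prod.ext (Fin.ext e2.1) (Fin.ext e2.2))
  · intro i
    have h1 : ∑ ξ ∈ M₁.rect (T := T) false ⟨p₁, i.1⟩ ∩ M₂.rect (T := T) true ⟨p₂, i.2⟩,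
        ‖c ξ‖ ^ (1 - a)⁻¹ ≤ 16 * x * W := by
      refine (sum_le_sum_of_subset_of_nonneg inter_subset_left fun ξ _ _ => hw0 ξ).trans ?_
      have := hm₁ ⟨p₁, i.1⟩
      rwa [hlev p₁] at this
    have h2 : ∑ ξ ∈ M₁.rect (T := T) false ⟨p₁, i.1⟩ ∩ M₂.rect (T := T) true ⟨p₂, i.2⟩,
        ‖c ξ‖ ^ (1 - a)⁻¹ ≤ 16 * y * W := by
      refine (sum_le_sum_of_subset_of_nonneg inter_subset_right fun ξ _ _ => hw0 ξ).trans ?_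
      have := hm₂ ⟨p₂, i.2⟩
      rwa [hlev p₂] at this
    rcases le_total x y with hxy | hxy
    · refine h1.trans (mul_le_mul_of_nonneg_right (mul_le_mul_of_nonneg_left
        (Real.le_sqrt_of_sq_le ?_) (by norm_num)) hW0)
      nlinarith
    · refine h2.trans (mul_le_mul_of_nonneg_right (mul_le_mul_of_nonneg_left
        (Real.le_sqrt_of_sq_le ?_) (by norm_num)) hW0)
      nlinarith
  · have e : ∀ p : Fin T × Fin T, (((2 : ℝ) ^ lev p)⁻¹) ^ ((1 / 2 : ℝ) * (1 / 2 - a)) =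
        2 ^ (-((1 / 2 - a) / 2) * lev p) := fun p => by
      rw [← Real.rpow_neg two_pos.le, ← Real.rpow_mul two_pos.le]
      congr 1
      ring
    rw [Real.mul_rpow (by norm_num) (by positivity), Real.sqrt_eq_rpow, ← Real.rpow_mul
      (by positivity), Real.mul_rpow hx.le hy.le, e, e]
    ring

theorem IsIv.inter {K : ℕ} {E F : Finset ℤ} (hE : IsIv K E) (hF : IsIv K F) : IsIv K (E ∩ F) := by
  refine isIv_of_ordConnected ?_ fun x hx => hE.subset (mem_inter.1 (mem_coe.1 hx)).1
  obtain ⟨a, b, -, -, -, rfl⟩ := hE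
  obtain ⟨c, d, -, -, -, rfl⟩ := hF
  rw [coe_inter, coe_Ico, coe_Ico]
  exact Set.ordConnected_Ico.inter Set.ordConnected_Ico

/-- The vertex estimate at a Lebesgue vertex. -/
theorem exists_lebesgue_vertex_bound {a κ₁ κ₂ : ℝ} (ha : 0 < a) (ha1 : a < 1)
    (h₁ : max 0 (a - 1 / 2) < κ₁) (h₂ : max 0 (a - 1 / 2) < κ₂) :
    ∃ C : ℝ, 0 < C ∧ ∃ c : ℕ, ∀ (L : ℕ) [NeZero L] (K T : ℕ), c * (K + 1) < L →
      ∀ (M₁ M₂ : Mesh K) (f : ZMod L × ZMod L → ℂ),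
      nrm a (fun z : ZMod L × ZMod L => l2 (fun i : RIdx T × RIdx T =>
        ((wt (-κ₁) i.1 * wt (-κ₂) i.2 : ℝ) : ℂ) *
          ∑ ξ ∈ M₁.rect false i.1 ∩ M₂.rect true i.2, hat2 f ξ * chi2 L ξ z)) ≤
      C * nrm a (fun z => ‖f z‖) := by
  set γ := max 0 (a - 1 / 2) with hγ
  set τ := (min κ₁ κ₂ - γ) / 2 with hτ
  have hτ0 : 0 < τ := by have := lt_min h₁ h₂; linarith
  have hm := min_le_left κ₁ κ₂
  have hm' := min_le_right κ₁ κ₂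
  obtain ⟨C, hC, h⟩ := exists_weighted_level_bound (κ₁ := -κ₁) (κ₂ := -κ₂) (ρ₁ := -(γ + τ))
    (ρ₂ := -(γ + τ)) (by linarith) (by linarith)
  obtain ⟨C', hC', c, h'⟩ := square_function ha ha1 hτ0
  refine ⟨C * C', by positivity, c, ?_⟩
  intro L _ K T hL M₁ M₂ f
  have hf0 : 0 ≤ nrm a (fun z => ‖f z‖) := nrm_nonneg _ fun _ => norm_nonneg _
  rw [mul_assoc]
  refine h ha ha1.le (fun i z =>
    ∑ ξ ∈ M₁.rect false i.1 ∩ M₂.rect true i.2, hat2 f ξ * chi2 L ξ z) (by positivity) ?_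
  intro p₁ p₂
  have key := h' L K hL (Fin (2 ^ (p₁.1 : ℕ)) × Fin (2 ^ (p₂.1 : ℕ)))
    (Fin (2 ^ (p₁.2 : ℕ)) × Fin (2 ^ (p₂.2 : ℕ)))
    (fun μ => M₁.E false p₁.1 μ.1 ∩ M₂.E true p₂.1 μ.2)
    (fun i => M₁.F false p₁.1 i.1.1 p₁.2 i.2.1 ∩ M₂.F true p₂.1 i.1.2 p₂.2 i.2.2) f
    (fun μ => (M₁.isIv_E _ _ _).inter (M₂.isIv_E _ _ _))
    (fun i => (M₁.isIv_F _ _ _ _ _).inter (M₂.isIv_F _ _ _ _ _)) ?_ ?_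
  · have e : (fun z => l2 (fun j : (Fin (2 ^ (p₁.1 : ℕ)) × Fin (2 ^ (p₁.2 : ℕ))) ×
          (Fin (2 ^ (p₂.1 : ℕ)) × Fin (2 ^ (p₂.2 : ℕ))) =>
          ∑ ξ ∈ M₁.rect (T := T) false ⟨p₁, j.1⟩ ∩ M₂.rect (T := T) true ⟨p₂, j.2⟩,
            hat2 f ξ * chi2 L ξ z)) = fun z => l2 (fun i : (Fin (2 ^ (p₁.1 : ℕ)) ×
          Fin (2 ^ (p₂.1 : ℕ))) × (Fin (2 ^ (p₁.2 : ℕ)) × Fin (2 ^ (p₂.2 : ℕ))) =>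
          rproj (M₁.E false p₁.1 i.1.1 ∩ M₂.E true p₂.1 i.1.2)
            (M₁.F false p₁.1 i.1.1 p₁.2 i.2.1 ∩ M₂.F true p₂.1 i.1.2 p₂.2 i.2.2) f z) := by
      funext z
      rw [← l2_equiv (Equiv.prodProdProdComm _ _ _ _)]
      congr 1
      funext j
      rw [rproj_apply, Mesh.rect, Mesh.rect, product_inter_product]
      rfl
    rw [e]
    refine key.trans (le_of_eq ?_)
    have hcard : (Fintype.card ((Fin (2 ^ (p₁.1 : ℕ)) × Fin (2 ^ (p₂.1 : ℕ))) ×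
        (Fin (2 ^ (p₁.2 : ℕ)) × Fin (2 ^ (p₂.2 : ℕ)))) : ℝ) = 2 ^ lev p₁ * 2 ^ lev p₂ := by
      rw [← two_pow_level, ← two_pow_level]
      simp only [Fintype.card_prod, Fintype.card_fin]
      push_cast
      ring
    rw [hcard, Real.mul_rpow (by positivity) (by positivity), ← Real.rpow_mul two_pos.le,
      ← Real.rpow_mul two_pos.le, neg_neg, mul_comm (lev p₁), mul_comm (lev p₂)]
    ring
  · intro μ ν hne
    refine disjoint_left.2 fun x hx hy => hne ?_
    rw [mem_inter] at hx hy
    refine Prod.ext (Fin.ext ?_) (Fin.ext ?_)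
    · by_contra h
      exact disjoint_left.1 (M₁.disj_E false p₁.1 _ _ h) hx.1 hy.1
    · by_contra h
      exact disjoint_left.1 (M₂.disj_E true p₂.1 _ _ h) hx.2 hy.2
  · intro μ i j hne
    refine disjoint_left.2 fun x hx hy => hne ?_
    rw [mem_inter] at hx hy
    refine Prod.ext (Fin.ext ?_) (Fin.ext ?_)
    · by_contra h
      exact disjoint_left.1 (M₁.disj_F false p₁.1 _ _ _ _ h) hx.1 hy.1
    · by_contra h
      exact disjoint_left.1 (M₂.disj_F true p₂.1 _ _ _ _ h) hx.2 hy.2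

end Vertex

section Chain

open Finset

/-- The sums over increasing chains in the box `[-K, K]²` ending at a given point. -/
noncomputable def chainSum (K : ℕ) (φ : ℕ → ℤ × ℤ → ℂ) : ℕ → ℤ × ℤ → ℂ
  | 0, ξ => φ 0 ξ
  | m + 1, ξ => φ (m + 1) ξ * ∑ η ∈ Icc (-(K : ℤ)) K ×ˢ Icc (-(K : ℤ)) K,
      if η.1 < ξ.1 ∧ η.2 < ξ.2 then chainSum K φ m η else 0

theorem chainSum_ne_zero {K : ℕ} {φ : ℕ → ℤ × ℤ → ℂ} {m : ℕ} {ξ : ℤ × ℤ}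
    (h : chainSum K φ m ξ ≠ 0) : φ m ξ ≠ 0 := by
  cases m with
  | zero => exact h
  | succ m => exact left_ne_zero_of_mul h

theorem l2_mono_embedding {I J : Type*} [Fintype I] [Fintype J] {e : I → J}
    (he : Function.Injective e) (g : J → ℂ) : l2 (fun i => g (e i)) ≤ l2 g := by
  classical
  refine Real.sqrt_le_sqrt ?_
  rw [← sum_image (f := fun j => ‖g j‖ ^ 2) (s := univ) (g := e) fun _ _ _ _ h => he h]
  exact sum_le_sum_of_subset_of_nonneg (subset_univ _) fun _ _ _ => by positivity

theorem l2_matrix_le {I J : Type*} [Fintype I] [Fintype J] (v : I → ℂ) (A : I × J → ℂ) :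
    l2 (fun j => ∑ i, v i * A (i, j)) ≤ l2 v * l2 A := by
  refine Real.sqrt_le_iff.2 ⟨mul_nonneg (l2_nonneg _) (l2_nonneg _), ?_⟩
  rw [mul_pow, l2_sq A, Fintype.sum_prod_type_right, mul_sum]
  refine sum_le_sum fun j _ => ?_
  rw [← l2_sq fun i => A (i, j), ← mul_pow]
  exact pow_le_pow_left₀ (norm_nonneg _) (norm_sum_mul_le_l2 _ _) 2

/-- The weighted matrix attached to a vertex between two meshes. -/
noncomputable def vertexMatrix {K : ℕ} (T : ℕ) (M : ℕ → Mesh K) (θ : ℕ → ℝ)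
    (φ : ℕ → ℤ × ℤ → ℂ) (t : ℕ) (i : RIdx T × RIdx T) : ℂ :=
  ((wt (-θ t) i.1 * wt (θ (t + 1)) i.2 : ℝ) : ℂ) *
    ∑ ξ ∈ (M t).rect false i.1 ∩ (M (t + 1)).rect true i.2, φ t ξ

theorem vertexMatrix_eq {K : ℕ} (T : ℕ) (M : ℕ → Mesh K) (θ : ℕ → ℝ)
    (φ : ℕ → ℤ × ℤ → ℂ) (t : ℕ) : vertexMatrix T M θ φ t = fun i =>
    ((wt (-θ t) i.1 * wt (θ (t + 1)) i.2 : ℝ) : ℂ) *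
      ∑ ξ ∈ (M t).rect false i.1 ∩ (M (t + 1)).rect true i.2, φ t ξ := rfl

theorem sum_mul_sum_indicator {α : Type*} [DecidableEq α] {P B : Finset α} (h : P ⊆ B)
    (Q R : Finset α) (φ c : α → ℂ) :
    ∑ ξ ∈ R, φ ξ * ∑ η ∈ B, c η * (if η ∈ P ∧ ξ ∈ Q then 1 else 0) =
      (∑ ξ ∈ P, c ξ) * ∑ ξ ∈ Q ∩ R, φ ξ := by
  rw [inter_comm, ← filter_mem_eq_inter, sum_filter, mul_sum]
  refine sum_congr rfl fun ξ _ => ?_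
  by_cases hξ : ξ ∈ Q
  · simp only [hξ, and_true, if_true, mul_ite, mul_one, mul_zero]
    rw [← sum_filter, filter_mem_eq_inter, inter_eq_right.2 h, mul_comm]
  · simp [hξ]

theorem l2_chainSum_le {K T n : ℕ} (M : ℕ → Mesh K) (θ : ℕ → ℝ) (φ : ℕ → ℤ × ℤ → ℂ)
    {e₀ : RIdx T} (he₀ : lev e₀.1 = 0)
    (h0 : (M 0).rect false e₀ = Icc (-(K : ℤ)) K ×ˢ Icc (-(K : ℤ)) K)
    (hsep : ∀ m < n, ∀ u ∈ Icc (-(K : ℤ)) K ×ˢ Icc (-(K : ℤ)) K,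
      ∀ v ∈ Icc (-(K : ℤ)) K ×ˢ Icc (-(K : ℤ)) K, φ m u ≠ 0 → φ (m + 1) v ≠ 0 →
      ∑ e : RIdx T, (if u ∈ (M (m + 1)).rect true e ∧ v ∈ (M (m + 1)).rect false e then 1 else 0) =
          if u.1 < v.1 ∧ u.2 < v.2 then 1 else 0) {m : ℕ} (hm : m ≤ n) :
    l2 (fun e : RIdx T => (wt (θ (m + 1)) e : ℂ) *
      ∑ ξ ∈ (M (m + 1)).rect true e, chainSum K φ m ξ) ≤
      ∏ t ∈ range (m + 1), l2 (vertexMatrix T M θ φ t) := by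
  set B := Icc (-(K : ℤ)) K ×ˢ Icc (-(K : ℤ)) K with hB
  induction m with
  | zero =>
    rw [zero_add, prod_range_one]
    refine le_trans (le_of_eq ?_) (l2_mono_embedding (e := fun e : RIdx T => (e₀, e))
      (fun a b h => (Prod.ext_iff.1 h).2) _)
    congr 1
    funext e
    rw [vertexMatrix, h0, inter_eq_right.2 ((M 1).rect_subset _ _)]
    simp [wt, he₀, chainSum]
  | succ m ih =>
    rw [prod_range_succ]
    refine le_trans (le_of_eq ?_) ((l2_matrix_le _ _).trans
      (mul_le_mul_of_nonneg_right (ih (by omega)) (l2_nonneg _)))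
    congr 1
    funext e'
    have h1 : ∀ e : RIdx T, ((wt (θ (m + 1)) e : ℂ) *
        ∑ ξ ∈ (M (m + 1)).rect true e, chainSum K φ m ξ) * vertexMatrix T M θ φ (m + 1) (e, e') =
        (wt (θ (m + 1 + 1)) e' : ℂ) * ∑ ξ ∈ (M (m + 1 + 1)).rect true e', φ (m + 1) ξ *
          ∑ η ∈ B, chainSum K φ m η *
            (if η ∈ (M (m + 1)).rect true e ∧ ξ ∈ (M (m + 1)).rect false e then 1 else 0) := by
      intro e
      have h2 : ∑ ξ ∈ (M (m + 1 + 1)).rect true e', φ (m + 1) ξ *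
          ∑ η ∈ B, chainSum K φ m η *
            (if η ∈ (M (m + 1)).rect true e ∧ ξ ∈ (M (m + 1)).rect false e then 1 else 0) =
          (∑ ξ ∈ (M (m + 1)).rect true e, chainSum K φ m ξ) *
            ∑ ξ ∈ (M (m + 1)).rect false e ∩ (M (m + 1 + 1)).rect true e', φ (m + 1) ξ :=
        sum_mul_sum_indicator ((M (m + 1)).rect_subset _ _) _ _ _ _
      rw [h2, vertexMatrix]
      have h4 : (wt (-θ (m + 1)) e : ℂ) * (wt (θ (m + 1)) e : ℂ) = 1 := by
        exact_mod_cast wt_neg_mul _ _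
      push_cast
      linear_combination (-(wt (θ (m + 1 + 1)) e' : ℂ) *
        (∑ ξ ∈ (M (m + 1)).rect true e, chainSum K φ m ξ) *
        ∑ ξ ∈ (M (m + 1)).rect false e ∩ (M (m + 1 + 1)).rect true e', φ (m + 1) ξ) * (-h4)
    simp only [h1]
    rw [← mul_sum, sum_comm]
    congr 1
    refine sum_congr rfl fun ξ hξ => ?_
    rw [← mul_sum, sum_comm, chainSum]
    by_cases hφ : φ (m + 1) ξ = 0
    · rw [hφ, zero_mul, zero_mul]
    congr 1
    refine sum_congr rfl fun η hη => ?_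
    rw [← mul_sum]
    by_cases hc : chainSum K φ m η = 0
    · simp [hc]
    have := hsep m (by omega) η hη ξ ((M (m + 1 + 1)).rect_subset _ _ hξ)
      (chainSum_ne_zero hc) hφ
    have h5 : ∑ e : RIdx T, (if η ∈ (M (m + 1)).rect true e ∧ ξ ∈ (M (m + 1)).rect false e
        then (1 : ℂ) else 0) = if η.1 < ξ.1 ∧ η.2 < ξ.2 then 1 else 0 := by
      exact_mod_cast congrArg (Nat.cast : ℕ → ℂ) this
    rw [h5]
    split_ifs <;> simp

theorem nrm_mul_le {X : Type*} [Fintype X] {a b : ℝ} (ha : 0 < a) (hb : 0 < b) {f g : X → ℝ}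
    (hf : ∀ x, 0 ≤ f x) (hg : ∀ x, 0 ≤ g x) :
    nrm (a + b) (fun x => f x * g x) ≤ nrm a f * nrm b g := by
  have hab : 0 < a + b := by linarith
  have hpq : ((a + b) / a).HolderConjugate ((a + b) / b) := by
    rw [Real.holderConjugate_iff]
    constructor
    · rw [one_lt_div ha]; linarith
    · field_simp
  have h := Real.inner_le_Lp_mul_Lq_of_nonneg univ hpq (f := fun x => f x ^ (a + b)⁻¹)
    (g := fun x => g x ^ (a + b)⁻¹) (fun x _ => Real.rpow_nonneg (hf x) _)
    fun x _ => Real.rpow_nonneg (hg x) _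
  have e1 : ∀ x, (f x ^ (a + b)⁻¹) ^ ((a + b) / a) = f x ^ a⁻¹ := fun x => by
    rw [← Real.rpow_mul (hf x)]; congr 1; field_simp
  have e2 : ∀ x, (g x ^ (a + b)⁻¹) ^ ((a + b) / b) = g x ^ b⁻¹ := fun x => by
    rw [← Real.rpow_mul (hg x)]; congr 1; field_simp
  simp only [e1, e2] at h
  have hF : 0 ≤ ∑ x, f x ^ a⁻¹ := sum_nonneg fun x _ => Real.rpow_nonneg (hf x) _
  have hG : 0 ≤ ∑ x, g x ^ b⁻¹ := sum_nonneg fun x _ => Real.rpow_nonneg (hg x) _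
  have h0 : 0 ≤ ∑ x, (f x * g x) ^ (a + b)⁻¹ :=
    sum_nonneg fun x _ => Real.rpow_nonneg (mul_nonneg (hf x) (hg x)) _
  have h' := Real.rpow_le_rpow (z := a + b) (sum_nonneg fun x _ => mul_nonneg
    (Real.rpow_nonneg (hf x) _) (Real.rpow_nonneg (hg x) _)) h hab.le
  rw [Real.mul_rpow (Real.rpow_nonneg hF _) (Real.rpow_nonneg hG _), ← Real.rpow_mul hF,
    ← Real.rpow_mul hG, show 1 / ((a + b) / a) * (a + b) = a by field_simp,
    show 1 / ((a + b) / b) * (a + b) = b by field_simp] at h'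
  refine le_trans (le_of_eq ?_) h'
  unfold nrm
  congr 1
  exact sum_congr rfl fun x _ => Real.mul_rpow (hf x) (hg x)

theorem nrm_prod_le {X : Type*} [Fintype X] {a : ℕ → ℝ} (ha : ∀ t, 0 < a t) {S : ℕ → X → ℝ}
    (hS : ∀ t x, 0 ≤ S t x) (n : ℕ) :
    nrm (∑ t ∈ range (n + 1), a t) (fun x => ∏ t ∈ range (n + 1), S t x) ≤
      ∏ t ∈ range (n + 1), nrm (a t) (S t) := by
  induction n with
  | zero => simp
  | succ n ih =>
    simp only [prod_range_succ _ (n + 1), sum_range_succ _ (n + 1)]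
    refine (nrm_mul_le (sum_pos (fun t _ => ha t) ⟨0, by simp⟩) (ha _)
      (fun x => prod_nonneg fun t _ => hS t x) (hS _)).trans ?_
    exact mul_le_mul_of_nonneg_right ih (nrm_nonneg _ (hS _))

theorem nrm_zsmul {L : ℕ} [NeZero L] {ε : ℤ} (hε : ε = 1 ∨ ε = -1) (a : ℝ)
    (g : ZMod L × ZMod L → ℝ) : nrm a (fun z => g (ε • z)) = nrm a g := by
  rcases hε with rfl | rfl
  · simp
  · simp only [neg_smul, one_smul]
    unfold nrm
    rw [← Equiv.sum_comp (Equiv.neg (ZMod L × ZMod L)) (fun z => g z ^ a⁻¹)]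
    rfl

end Chain

section Discrete

open Finset

theorem exists_edge_exponents {N : ℕ} (hN : Even N) {a : ℕ → ℝ} (ha1 : ∀ t, a t < 1)
    (hev : ∀ t, Even t → a t < 1 / 2)
    (hcond : ∀ i < N, ∀ j < N, Even i → (j + 1 = i ∨ j = i + 1) → a i + 2 * a j < 3 / 2) :
    ∃ κ : ℕ → ℝ, ∀ t < N,
      (Even t → κ t < (1 / 2 - a t) / 2 ∧ κ (t + 1) < (1 / 2 - a t) / 2) ∧
      (¬Even t → max 0 (a t - 1 / 2) < κ t ∧ max 0 (a t - 1 / 2) < κ (t + 1)) := by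
  have key : ∀ i < N, ∀ j < N, Even i → (j + 1 = i ∨ j = i + 1) →
      max 0 (a j - 1 / 2) < (1 / 2 - a i) / 2 := fun i hi j hj he h => by
    have := hcond i hi j hj he h; have := hev i he
    exact max_lt (by linarith) (by linarith)
  refine ⟨fun s => if s = 0 then 0 else if s = N then 1 else
    if Even s then (max 0 (a (s - 1) - 1 / 2) + (1 / 2 - a s) / 2) / 2
    else (max 0 (a s - 1 / 2) + (1 / 2 - a (s - 1)) / 2) / 2, fun t ht => ⟨fun he => ?_,
      fun ho => ?_⟩⟩
  · have h1 : t + 1 ≠ N := fun h => by rw [← h] at hN; exact (Nat.even_add_one.1 hN) he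
    have h2 : ¬Even (t + 1) := fun h => (Nat.even_add_one.1 h) he
    have h3 := key t ht (t + 1) (by omega) he (Or.inr rfl)
    have h4 := hev t he
    constructor
    · simp only [ht.ne, if_false, he, if_true]
      split_ifs with h0
      · linarith
      · have := key t ht (t - 1) (by omega) he (Or.inl (by omega))
        linarith
    · simp only [Nat.succ_ne_zero, h1, h2, if_false, Nat.add_sub_cancel]
      linarith
  · have h0 : t ≠ 0 := fun h => ho (by simp [h])
    have h2 : Even (t + 1) := Nat.even_add_one.2 ho
    have h3 : Even (t - 1) := by
      rw [Nat.even_sub (by omega)]; simp [ho]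
    have h4 := key (t - 1) (by omega) t ht h3 (Or.inr (by omega))
    constructor
    · simp only [h0, ht.ne, ho, if_false]
      linarith
    · simp only [Nat.succ_ne_zero, h2, if_false, if_true, Nat.add_sub_cancel]
      split_ifs with h5
      · have := ha1 t
        exact max_lt (by linarith) (by linarith)
      · have := key (t + 1) (by omega) t ht h2 (Or.inl rfl)
        linarith

/-- The size of the data at a vertex. -/
noncomputable def vertexNorm (L : ℕ) [NeZero L] (K : ℕ) (a : ℕ → ℝ) (u : ℕ → ℤ × ℤ → ℂ)
    (F : ℕ → ZMod L × ZMod L → ℂ) (t : ℕ) : ℝ :=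
  if Even t then (L : ℝ) ^ (2 * a t) *
    (∑ ξ ∈ Icc (-(K : ℤ)) K ×ˢ Icc (-(K : ℤ)) K, ‖u t ξ‖ ^ (1 - a t)⁻¹) ^ (1 - a t)
  else nrm (a t) (fun z => ‖F t z‖)

/-- The frequency coefficients of the data at a vertex. -/
noncomputable def vertexCoeff (L : ℕ) [NeZero L] (u : ℕ → ℤ × ℤ → ℂ)
    (F : ℕ → ZMod L × ZMod L → ℂ) (t : ℕ) : ℤ × ℤ → ℂ :=
  if Even t then u t else hat2 (F t)

/-- The discrete model of the mixed estimate. -/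
theorem exists_discrete_bound {n : ℕ} (hn : Even (n + 1)) {a : ℕ → ℝ} (ha : ∀ t, 0 < a t)
    (ha1 : ∀ t, a t < 1) (hev : ∀ t, Even t → a t < 1 / 2)
    (hcond : ∀ i < n + 1, ∀ j < n + 1, Even i → (j + 1 = i ∨ j = i + 1) →
      a i + 2 * a j < 3 / 2) {ε : ℕ → ℤ} (hε : ∀ t, ε t = 1 ∨ ε t = -1) :
    ∃ C : ℝ, 0 < C ∧ ∃ c : ℕ, ∀ (L : ℕ) [NeZero L] (K : ℕ), c * (K + 1) < L →
      ∀ (u : ℕ → ℤ × ℤ → ℂ) (F : ℕ → ZMod L × ZMod L → ℂ),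
      nrm (∑ t ∈ range (n + 1), a t) (fun z => ‖∑ ξ ∈ Icc (-(K : ℤ)) K ×ˢ Icc (-(K : ℤ)) K,
        chainSum K (fun t ξ => vertexCoeff L u F t ξ * chi2 L ξ (ε t • z)) n ξ‖) ≤
      C * ∏ t ∈ range (n + 1), vertexNorm L K a u F t := by
  obtain ⟨κ, hκ⟩ := exists_edge_exponents hn ha1 hev hcond
  set θ : ℕ → ℝ := fun s => if Even s then -κ s else κ s with hθ
  have hvertex : ∀ t : ℕ, ∃ C : ℝ, 0 < C ∧ ∃ c : ℕ, t < n + 1 →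
      ∀ (L : ℕ) [NeZero L] (K T : ℕ), c * (K + 1) < L →
      ∀ (M : ℕ → Mesh K) (u : ℕ → ℤ × ℤ → ℂ) (F : ℕ → ZMod L × ZMod L → ℂ),
      (Even t → (∀ e : RIdx T, ∑ ξ ∈ (M t).rect false e, ‖u t ξ‖ ^ (1 - a t)⁻¹ ≤
        16 * (2 ^ (e.1.1 + e.1.2 : ℕ))⁻¹ *
          ∑ ξ ∈ Icc (-(K : ℤ)) K ×ˢ Icc (-(K : ℤ)) K, ‖u t ξ‖ ^ (1 - a t)⁻¹) ∧
        (∀ e : RIdx T, ∑ ξ ∈ (M (t + 1)).rect true e, ‖u t ξ‖ ^ (1 - a t)⁻¹ ≤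
        16 * (2 ^ (e.1.1 + e.1.2 : ℕ))⁻¹ *
          ∑ ξ ∈ Icc (-(K : ℤ)) K ×ˢ Icc (-(K : ℤ)) K, ‖u t ξ‖ ^ (1 - a t)⁻¹)) →
      nrm (a t) (fun z => l2 (vertexMatrix T M θ
        (fun t ξ => vertexCoeff L u F t ξ * chi2 L ξ (ε t • z)) t)) ≤
        C * vertexNorm L K a u F t := by
    intro t
    by_cases ht : t < n + 1
    swap
    · exact ⟨1, one_pos, 0, fun h => absurd h ht⟩
    by_cases he : Even t
    · obtain ⟨C, hC, h⟩ := exists_wiener_vertex_bound (ha t) (hev t he) ((hκ t ht).1 he).1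
        ((hκ t ht).1 he).2
      refine ⟨C, hC, 2, fun _ L _ K T hL M u F hm => ?_⟩
      have h2 : ¬Even (t + 1) := fun h => (Nat.even_add_one.1 h) he
      have hL' : (K : ℤ) - -(K : ℤ) < L := by omega
      have := h L K T (by rw [coe_Icc]; exact DR_Icc hL') (M t) (M (t + 1)) (u t) (hm he).1 (hm he).2
      rw [← nrm_zsmul (hε t)] at this
      simpa only [vertexMatrix_eq, vertexCoeff, vertexNorm, hθ, he, h2, if_true, if_false,
        neg_neg] using this
    · obtain ⟨C, hC, c, h⟩ := exists_lebesgue_vertex_bound (ha t) (ha1 t) ((hκ t ht).2 he).1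
        ((hκ t ht).2 he).2
      refine ⟨C, hC, c, fun _ L _ K T hL M u F _ => ?_⟩
      have h2 : Even (t + 1) := Nat.even_add_one.2 he
      have := h L K T hL (M t) (M (t + 1)) (F t)
      rw [← nrm_zsmul (hε t)] at this
      simpa only [vertexMatrix_eq, vertexCoeff, vertexNorm, hθ, he, h2, if_true, if_false] using this
  choose C hC c hCc using hvertex
  refine ⟨∏ t ∈ range (n + 1), C t, prod_pos fun t _ => hC t, ∑ t ∈ range (n + 1), c t,
    fun L _ K hL u F => ?_⟩
  set B := Icc (-(K : ℤ)) K ×ˢ Icc (-(K : ℤ)) K with hB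
  have hmesh := fun s : ℕ => exists_mesh_prod K
    (fun ξ => ‖u (if Even s then s else s - 1) ξ‖ ^ (1 - a (if Even s then s else s - 1))⁻¹)
    (fun ξ => Real.rpow_nonneg (norm_nonneg _) _) (decide (¬Even s))
  choose M' T₀ hmass hsep using hmesh
  obtain ⟨M₀, hM₀⟩ := exists_mesh_trivial K
  set M : ℕ → Mesh K := fun s => if s = 0 ∨ s = n + 1 then M₀ else M' s with hM
  set T := ∑ s ∈ range (n + 1), T₀ s + 1 with hT
  have hTs : ∀ s < n + 1, T₀ s ≤ T := fun s hs => by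
    have := single_le_sum (f := T₀) (fun _ _ => Nat.zero_le _) (mem_range.2 hs)
    omega
  let e₀ : RIdx T := ⟨(⟨0, by omega⟩, ⟨0, by omega⟩), ⟨0, by simp⟩, ⟨0, by simp⟩⟩
  have he₀ : lev e₀.1 = 0 := by simp [lev, e₀]
  have hr : ∀ b, M₀.rect b e₀ = B := fun b => by rw [hM₀]; simp [e₀, hB]
  have hM0 : M 0 = M₀ := by simp [hM]
  have hMn : M (n + 1) = M₀ := by simp [hM]
  have hM' : ∀ s, s ≠ 0 → s < n + 1 → M s = M' s := fun s h1 h2 => by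
    simp only [hM]; rw [if_neg]; omega
  have hpt : ∀ z : ZMod L × ZMod L, ‖∑ ξ ∈ B,
        chainSum K (fun t ξ => vertexCoeff L u F t ξ * chi2 L ξ (ε t • z)) n ξ‖ ≤
      ∏ t ∈ range (n + 1), l2 (vertexMatrix T M θ
        (fun t ξ => vertexCoeff L u F t ξ * chi2 L ξ (ε t • z)) t) := by
    intro z
    set φ : ℕ → ℤ × ℤ → ℂ := fun t ξ => vertexCoeff L u F t ξ * chi2 L ξ (ε t • z) with hφ
    have h1 := l2_chainSum_le (T := T) (n := n) M θ φ he₀ (by rw [hM0, hr]) ?_ le_rfl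
    · refine le_trans (le_of_eq ?_) ((norm_le_l2 _ e₀).trans h1)
      rw [hMn, hr, wt, he₀]
      simp
    · intro m hm v hv w hw hv0 hw0
      rw [hM' _ (by omega) (by omega)]
      refine hsep (m + 1) T (hTs _ (by omega)) v hv w hw ?_
      by_cases he : Even m
      · have h2 : ¬Even (m + 1) := fun h => (Nat.even_add_one.1 h) he
        have h3 : u m v ≠ 0 := by
          have := left_ne_zero_of_mul hv0
          rwa [vertexCoeff, if_pos he] at this
        simp only [h2, not_false_eq_true, decide_true, if_true, if_false, Nat.add_sub_cancel]
        exact (Real.rpow_pos_of_pos (norm_pos_iff.2 h3) _).ne'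
      · have h2 : Even (m + 1) := Nat.even_add_one.2 he
        have h3 : u (m + 1) w ≠ 0 := by
          have := left_ne_zero_of_mul hw0
          rwa [vertexCoeff, if_pos h2] at this
        simp only [h2, not_true_eq_false, decide_false, if_true, Bool.false_eq_true, if_false]
        exact (Real.rpow_pos_of_pos (norm_pos_iff.2 h3) _).ne'
  refine (nrm_mono (sum_pos (fun t _ => ha t) ⟨0, by simp⟩) (fun _ => norm_nonneg _) hpt).trans ?_
  refine (nrm_prod_le ha (fun t z => l2_nonneg _) n).trans ?_
  rw [← prod_mul_distrib]
  refine prod_le_prod (fun t _ => nrm_nonneg _ fun z => l2_nonneg _) fun t ht => ?_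
  have ht' := mem_range.1 ht
  refine hCc t ht' L K T ?_ M u F fun he => ?_
  · refine lt_of_le_of_lt (Nat.mul_le_mul_right _ ?_) hL
    exact single_le_sum (f := c) (fun _ _ => Nat.zero_le _) ht
  · have h2 : ¬Even (t + 1) := fun h => (Nat.even_add_one.1 h) he
    have h3 : t + 1 < n + 1 := by
      rcases Nat.lt_or_ge (t + 1) (n + 1) with h | h
      · exact h
      · exact absurd hn (by rwa [show n + 1 = t + 1 by omega])
    constructor
    · intro e
      by_cases ht0 : t = 0
      · have hw0 : ∀ ξ, 0 ≤ ‖u t ξ‖ ^ (1 - a t)⁻¹ := fun ξ => Real.rpow_nonneg (norm_nonneg _) _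
        have hs0 : 0 ≤ ∑ ξ ∈ B, ‖u t ξ‖ ^ (1 - a t)⁻¹ := sum_nonneg fun ξ _ => hw0 ξ
        rw [show M t = M₀ by rw [ht0, hM0], hM₀]
        split_ifs with h0
        · rw [h0.1, h0.2]
          norm_num
          linarith
        · rw [sum_empty]
          positivity
      · rw [hM' t ht0 ht']
        have := hmass t T e
        simpa only [he, not_true_eq_false, decide_false, if_true] using this
    · intro e
      rw [hM' (t + 1) (by omega) h3]
      have := hmass (t + 1) T e
      simpa only [h2, not_false_eq_true, decide_true, if_false, Nat.add_sub_cancel] using this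

end Discrete

section GridInequality

open Finset ComplexConjugate

/-- The planar character `e^{2πi x·y}`. -/
noncomputable def planeChar (x y : ℝ × ℝ) : ℂ :=
  exp (2 * π * I * (x.1 * y.1 + x.2 * y.2))

/-- The grid point `k / ν`. -/
noncomputable def gridPt (ν : ℕ) (k : ℤ × ℤ) : ℝ × ℝ := (k.1 / ν, k.2 / ν)

/-- The centred box of integer points representing `(ℤ/ν²)²`. -/
noncomputable def gridBox (ν : ℕ) : Finset (ℤ × ℤ) :=
  ((Finset.Icc (-(ν ^ 2 : ℕ) : ℤ) (ν ^ 2 : ℕ)).filter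
    fun j => j * 2 ∈ Set.Ioc (-(ν ^ 2 : ℕ) : ℤ) (ν ^ 2 : ℕ)) ×ˢ
  ((Finset.Icc (-(ν ^ 2 : ℕ) : ℤ) (ν ^ 2 : ℕ)).filter
    fun j => j * 2 ∈ Set.Ioc (-(ν ^ 2 : ℕ) : ℤ) (ν ^ 2 : ℕ))

theorem mem_gridBox {ν : ℕ} {j : ℤ × ℤ} : j ∈ gridBox ν ↔
    j.1 * 2 ∈ Set.Ioc (-(ν ^ 2 : ℕ) : ℤ) (ν ^ 2 : ℕ) ∧
      j.2 * 2 ∈ Set.Ioc (-(ν ^ 2 : ℕ) : ℤ) (ν ^ 2 : ℕ) := by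
  simp only [gridBox, mem_product, mem_filter, Finset.mem_Icc, Set.mem_Ioc]
  omega

/-- Coordinatewise centred representatives. -/
def centredRep {L : ℕ} (z : ZMod L × ZMod L) : ℤ × ℤ := (z.1.valMinAbs, z.2.valMinAbs)

theorem sum_centredRep {M : Type*} [AddCommMonoid M] (ν : ℕ) [NeZero (ν ^ 2)] (G : ℤ × ℤ → M) :
    ∑ z : ZMod (ν ^ 2) × ZMod (ν ^ 2), G (centredRep z) = ∑ j ∈ gridBox ν, G j := by
  refine Finset.sum_bij (fun z _ => centredRep z) (fun z _ => ?_) (fun z _ w _ h => ?_)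
    (fun j hj => ?_) fun _ _ => rfl
  · exact mem_gridBox.2 ⟨ZMod.valMinAbs_mem_Ioc _, ZMod.valMinAbs_mem_Ioc _⟩
  · simp only [centredRep, Prod.mk.injEq, ZMod.valMinAbs_inj] at h
    exact Prod.ext h.1 h.2
  · obtain ⟨h1, h2⟩ := mem_gridBox.1 hj
    exact ⟨((j.1 : ZMod (ν ^ 2)), (j.2 : ZMod (ν ^ 2))), mem_univ _,
      Prod.ext ((ZMod.valMinAbs_spec _ _).2 ⟨rfl, h1⟩) ((ZMod.valMinAbs_spec _ _).2 ⟨rfl, h2⟩)⟩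

theorem chi2_smul_eq (ν : ℕ) [NeZero (ν ^ 2)] (k : ℤ × ℤ) (e : ℤ)
    (z : ZMod (ν ^ 2) × ZMod (ν ^ 2)) :
    chi2 (ν ^ 2) k (e • z) =
      planeChar (gridPt ν k) ((e : ℝ) • gridPt ν (centredRep z)) := by
  have h (k : ℤ) (x : ZMod (ν ^ 2)) : chi (ν ^ 2) k (e • x) =
      exp (2 * π * I * ((k / ν : ℝ) * ((e : ℝ) * (x.valMinAbs / ν : ℝ)))) := by
    rw [chi, show (k : ZMod (ν ^ 2)) * (e • x) = ((k * (e * x.valMinAbs) : ℤ) : ZMod (ν ^ 2)) by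
      push_cast; simp [zsmul_eq_mul], ZMod.stdAddChar_coe]
    congr 1
    push_cast
    have : (ν : ℂ) ≠ 0 := by
      have := NeZero.ne (ν ^ 2); simp_all
    field_simp
  rw [chi2, Prod.smul_fst, Prod.smul_snd, h, h, planeChar, ← Complex.exp_add]
  congr 1
  simp [gridPt, centredRep]
  ring

/-- The Riemann sum of the Fourier integral of `f` at the frequency `k / ν`. -/
noncomputable def gridFT (ν : ℕ) (f : ℝ × ℝ → ℂ) (k : ℤ × ℤ) : ℂ :=
  ((ν : ℂ) ^ 2)⁻¹ * ∑ j ∈ gridBox ν, f (gridPt ν j) * conj (planeChar (gridPt ν k) (gridPt ν j))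

theorem hat2_gridFT (ν : ℕ) [NeZero (ν ^ 2)] (f : ℝ × ℝ → ℂ) (k : ℤ × ℤ) :
    hat2 (fun z : ZMod (ν ^ 2) × ZMod (ν ^ 2) => (ν : ℂ) ^ 2 * f (gridPt ν (centredRep z))) k =
      gridFT ν f k := by
  rw [hat2, gridFT, ← sum_centredRep ν, mul_sum, mul_sum]
  refine sum_congr rfl fun z _ => ?_
  have h := chi2_smul_eq ν k 1 z
  rw [one_smul, Int.cast_one, one_smul] at h
  rw [h]
  have : (ν : ℂ) ≠ 0 := by
    have := NeZero.ne (ν ^ 2); simp_all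
  push_cast
  field_simp

/-- The frequency coefficients of the discretised data. -/
noncomputable def gridCoeff (ν : ℕ) (g f : ℕ → ℝ × ℝ → ℂ) (t : ℕ) (k : ℤ × ℤ) : ℂ :=
  if Even t then g t (gridPt ν k) else gridFT ν (f t) k

/-- The discretised operator. -/
noncomputable def gridOp (ν K n : ℕ) (ε : ℕ → ℤ) (g f : ℕ → ℝ × ℝ → ℂ) (j : ℤ × ℤ) : ℂ :=
  (((ν : ℂ) ^ 2)⁻¹) ^ (n + 1) * ∑ k ∈ Icc (-(K : ℤ)) K ×ˢ Icc (-(K : ℤ)) K,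
    chainSum K (fun t k => gridCoeff ν g f t k *
      planeChar (gridPt ν k) ((ε t : ℝ) • gridPt ν j)) n k

/-- The discretised norms of the data. -/
noncomputable def gridNorm (ν K : ℕ) (a : ℕ → ℝ) (g f : ℕ → ℝ × ℝ → ℂ) (t : ℕ) : ℝ :=
  if Even t then (((ν : ℝ) ^ 2)⁻¹ * ∑ k ∈ Icc (-(K : ℤ)) K ×ˢ Icc (-(K : ℤ)) K,
    ‖g t (gridPt ν k)‖ ^ (1 - a t)⁻¹) ^ (1 - a t)
  else (((ν : ℝ) ^ 2)⁻¹ * ∑ j ∈ gridBox ν, ‖f t (gridPt ν j)‖ ^ (a t)⁻¹) ^ a t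

theorem vertexNorm_grid (ν K : ℕ) [NeZero (ν ^ 2)] {a : ℕ → ℝ} (ha : ∀ t, 0 < a t)
    (g f : ℕ → ℝ × ℝ → ℂ) (t : ℕ) :
    vertexNorm (ν ^ 2) K a (fun t k => g t (gridPt ν k))
      (fun t z => (ν : ℂ) ^ 2 * f t (gridPt ν (centredRep z))) t =
    (ν : ℝ) ^ (2 + 2 * a t) * gridNorm ν K a g f t := by
  have hν : (0 : ℝ) < ν := by
    have := NeZero.ne (ν ^ 2)
    exact_mod_cast Nat.pos_of_ne_zero (by simp_all)
  have hs : (((ν : ℝ) ^ 2)⁻¹) = (ν : ℝ) ^ (-2 : ℝ) := by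
    rw [Real.rpow_neg hν.le]; norm_cast
  rw [vertexNorm, gridNorm]
  split_ifs with h
  · have h0 : 0 ≤ ∑ k ∈ Icc (-(K : ℤ)) K ×ˢ Icc (-(K : ℤ)) K,
      ‖g t (gridPt ν k)‖ ^ (1 - a t)⁻¹ := sum_nonneg fun _ _ => by positivity
    rw [hs, Real.mul_rpow (by positivity) h0, ← Real.rpow_mul hν.le, ← mul_assoc,
      ← Real.rpow_add hν]
    push_cast
    rw [← Real.rpow_natCast, ← Real.rpow_mul hν.le]
    congr 2
    push_cast; ring
  · have h0 : 0 ≤ ∑ j ∈ gridBox ν, ‖f t (gridPt ν j)‖ ^ (a t)⁻¹ :=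
      sum_nonneg fun _ _ => by positivity
    have h1 : nrm (a t) (fun z : ZMod (ν ^ 2) × ZMod (ν ^ 2) =>
        ‖(ν : ℂ) ^ 2 * f t (gridPt ν (centredRep z))‖) =
        (ν : ℝ) ^ 2 * (∑ j ∈ gridBox ν, ‖f t (gridPt ν j)‖ ^ (a t)⁻¹) ^ a t := by
      simp only [norm_mul, norm_pow, Complex.norm_natCast]
      rw [nrm_mul_left (ha t) (by positivity) (fun _ => norm_nonneg _), nrm,
        ← sum_centredRep ν]
    rw [h1, hs, Real.mul_rpow (by positivity) h0, ← Real.rpow_mul hν.le, ← mul_assoc,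
      ← Real.rpow_add hν, ← Real.rpow_natCast]
    congr 2
    push_cast; ring

theorem exists_grid_bound {n : ℕ} (hn : Even (n + 1)) {a : ℕ → ℝ} (ha : ∀ t, 0 < a t)
    (ha1 : ∀ t, a t < 1) (hev : ∀ t, Even t → a t < 1 / 2)
    (hcond : ∀ i < n + 1, ∀ j < n + 1, Even i → (j + 1 = i ∨ j = i + 1) →
      a i + 2 * a j < 3 / 2) {ε : ℕ → ℤ} (hε : ∀ t, ε t = 1 ∨ ε t = -1) :
    ∃ C : ℝ, 0 < C ∧ ∃ c : ℕ, ∀ ν K : ℕ, c * (K + 1) < ν ^ 2 → ∀ g f : ℕ → ℝ × ℝ → ℂ,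
      (((ν : ℝ) ^ 2)⁻¹ * ∑ j ∈ gridBox ν,
        ‖gridOp ν K n ε g f j‖ ^ (∑ t ∈ range (n + 1), a t)⁻¹) ^ (∑ t ∈ range (n + 1), a t) ≤
      C * ∏ t ∈ range (n + 1), gridNorm ν K a g f t := by
  obtain ⟨C, hC, c, h⟩ := exists_discrete_bound hn ha ha1 hev hcond hε
  refine ⟨C, hC, c, fun ν K hK g f => ?_⟩
  have : NeZero (ν ^ 2) := ⟨by omega⟩
  have hν : (0 : ℝ) < ν := by
    have := NeZero.ne (ν ^ 2)
    exact_mod_cast Nat.pos_of_ne_zero (by simp_all)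
  specialize h (ν ^ 2) K hK (fun t k => g t (gridPt ν k))
    (fun t z => (ν : ℂ) ^ 2 * f t (gridPt ν (centredRep z)))
  set α := ∑ t ∈ range (n + 1), a t with hα
  have hα0 : 0 < α := sum_pos (fun t _ => ha t) (by simp)
  simp only [vertexNorm_grid ν K ha, prod_mul_distrib] at h
  have hprod : ∏ t ∈ range (n + 1), (ν : ℝ) ^ (2 + 2 * a t) = (ν : ℝ) ^ (2 * (n + 1) + 2 * α) := by
    rw [← Real.rpow_sum_of_pos hν, sum_add_distrib, ← mul_sum]
    simp [mul_comm, hα]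
  have hcoef (t : ℕ) (k : ℤ × ℤ) : vertexCoeff (ν ^ 2) (fun t k => g t (gridPt ν k))
      (fun t z => (ν : ℂ) ^ 2 * f t (gridPt ν (centredRep z))) t k = gridCoeff ν g f t k := by
    rw [vertexCoeff, gridCoeff]
    split_ifs
    · rfl
    · exact hat2_gridFT ν (f t) k
  simp only [hcoef, chi2_smul_eq] at h
  have hop (z : ZMod (ν ^ 2) × ZMod (ν ^ 2)) :
      ‖∑ k ∈ Icc (-(K : ℤ)) K ×ˢ Icc (-(K : ℤ)) K, chainSum K (fun t k => gridCoeff ν g f t k *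
        planeChar (gridPt ν k) ((ε t : ℝ) • gridPt ν (centredRep z))) n k‖ =
      ((ν : ℝ) ^ 2) ^ (n + 1) * ‖gridOp ν K n ε g f (centredRep z)‖ := by
    rw [gridOp, norm_mul, norm_pow, norm_inv, norm_pow, Complex.norm_natCast, inv_pow,
      mul_inv_cancel_left₀ (by positivity)]
  simp only [hop] at h
  rw [nrm_mul_left hα0 (by positivity) (fun _ => norm_nonneg _), nrm,
    sum_centredRep ν (fun j => ‖gridOp ν K n ε g f j‖ ^ α⁻¹), hprod] at h
  have h0 : 0 ≤ ∑ j ∈ gridBox ν, ‖gridOp ν K n ε g f j‖ ^ α⁻¹ :=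
    sum_nonneg fun _ _ => by positivity
  have hs : (((ν : ℝ) ^ 2)⁻¹) = (ν : ℝ) ^ (-2 : ℝ) := by
    rw [Real.rpow_neg hν.le]; norm_cast
  rw [hs, Real.mul_rpow (by positivity) h0, ← Real.rpow_mul hν.le]
  have hfac : ((ν : ℝ) ^ 2) ^ (n + 1) = (ν : ℝ) ^ (2 * (n + 1) + 2 * α) * (ν : ℝ) ^ (-2 * α) := by
    rw [← Real.rpow_add hν, ← pow_mul, ← Real.rpow_natCast]
    congr 1
    push_cast; ring
  rw [hfac] at h
  refine le_of_mul_le_mul_left ?_ (Real.rpow_pos_of_pos hν (2 * (n + 1) + 2 * α))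
  calc _ = _ := by rw [mul_assoc]
    _ ≤ _ := h
    _ = _ := by ring

end GridInequality

section SchwartzTransform

open scoped SchwartzMap FourierTransform

theorem exists_schwartz_eq_FT2 (f : 𝓢(ℝ × ℝ, ℂ)) : ∃ g : 𝓢(ℝ × ℝ, ℂ), ⇑g = FT2 f := by
  let e : WithLp 2 (ℝ × ℝ) ≃L[ℝ] ℝ × ℝ := WithLp.prodContinuousLinearEquiv 2 ℝ ℝ ℝ
  refine ⟨SchwartzMap.compCLMOfContinuousLinearEquiv ℝ e.symm
    (𝓕 (SchwartzMap.compCLMOfContinuousLinearEquiv ℝ e f)), funext fun ξ => ?_⟩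
  change (𝓕 (SchwartzMap.compCLMOfContinuousLinearEquiv ℝ e f) : 𝓢(WithLp 2 (ℝ × ℝ), ℂ)) (e.symm ξ) = _
  rw [SchwartzMap.fourier_coe, Real.fourier_eq', FT2,
    ← (WithLp.volume_preserving_ofLp ℝ ℝ).integral_comp
      (MeasurableEquiv.toLp 2 (ℝ × ℝ)).symm.measurableEmbedding]
  refine integral_congr_ae (.of_forall fun x => ?_)
  have hinner : inner ℝ x (e.symm ξ) = x.ofLp.1 * ξ.1 + x.ofLp.2 * ξ.2 := by
    rw [WithLp.prod_inner_apply, mul_comm x.ofLp.1, mul_comm x.ofLp.2]; rfl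
  beta_reduce
  rw [hinner, smul_eq_mul, mul_comm]
  refine congrArg₂ (· * ·) rfl (congrArg exp ?_)
  push_cast
  ring

/-- An integrable majorant of product type. -/
noncomputable def planeDecay (x : ℝ × ℝ) : ℝ := (1 + x.1 ^ 2)⁻¹ * (1 + x.2 ^ 2)⁻¹

theorem planeDecay_pos (x : ℝ × ℝ) : 0 < planeDecay x := by unfold planeDecay; positivity

theorem planeDecay_le_one (x : ℝ × ℝ) : planeDecay x ≤ 1 :=
  mul_le_one₀ (inv_le_one_of_one_le₀ (by nlinarith [sq_nonneg x.1])) (by positivity)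
    (inv_le_one_of_one_le₀ (by nlinarith [sq_nonneg x.2]))

theorem integrable_planeDecay : Integrable planeDecay :=
  integrable_inv_one_add_sq.mul_prod integrable_inv_one_add_sq

theorem planeDecay_le {x y : ℝ × ℝ} (h1 : |x.1 - y.1| ≤ 1) (h2 : |x.2 - y.2| ≤ 1) :
    planeDecay y ≤ 9 * planeDecay x := by
  have key (s t : ℝ) (h : |s - t| ≤ 1) : (1 + t ^ 2)⁻¹ ≤ 3 * (1 + s ^ 2)⁻¹ := by
    rw [← div_eq_mul_inv, inv_le_comm₀ (by positivity) (by positivity), inv_div,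
      div_le_iff₀ (by norm_num)]
    have := abs_le.1 h
    nlinarith [sq_nonneg (s - 2 * t)]
  calc planeDecay y ≤ (3 * (1 + x.1 ^ 2)⁻¹) * (3 * (1 + x.2 ^ 2)⁻¹) :=
        mul_le_mul (key _ _ h1) (key _ _ h2) (by positivity) (by positivity)
    _ = 9 * planeDecay x := by unfold planeDecay; ring

theorem exists_le_planeDecay (f : 𝓢(ℝ × ℝ, ℂ)) : ∃ C, 0 < C ∧ ∀ x, ‖f x‖ ≤ C * planeDecay x := by
  let p := 2 ^ 4 * ((Finset.Iic (4, 0)).sup fun m => SchwartzMap.seminorm ℝ m.1 m.2) f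
  have hp : 0 ≤ p := by positivity
  refine ⟨p + 1, by positivity, fun x => ?_⟩
  have h := SchwartzMap.one_add_le_sup_seminorm_apply (𝕜 := ℝ) (m := (4, 0)) (k := 4) (n := 0)
    le_rfl le_rfl f x
  rw [norm_iteratedFDeriv_zero] at h
  have h1 : |x.1| ≤ ‖x‖ := norm_fst_le x
  have h2 : |x.2| ≤ ‖x‖ := norm_snd_le x
  have key (s : ℝ) (h : |s| ≤ ‖x‖) : 1 + s ^ 2 ≤ (1 + ‖x‖) ^ 2 := by
    rw [← sq_abs]; nlinarith [abs_nonneg s]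
  have h3 : (1 + x.1 ^ 2) * (1 + x.2 ^ 2) ≤ (1 + ‖x‖) ^ 4 :=
    (mul_le_mul (key _ h1) (key _ h2) (by positivity) (by positivity)).trans_eq (by ring)
  rw [planeDecay, ← mul_inv, ← div_eq_mul_inv, le_div_iff₀ (by positivity), mul_comm]
  calc _ ≤ (1 + ‖x‖) ^ 4 * ‖f x‖ := by gcongr
    _ ≤ p := h
    _ ≤ p + 1 := by linarith

end SchwartzTransform

section Riemann

open Filter Topology

/-- The index of the grid cell containing a point. -/
noncomputable def cell (ν : ℕ) (x : ℝ × ℝ) : ℤ × ℤ := (⌊ν * x.1⌋, ⌊ν * x.2⌋)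

theorem measurable_cell (ν : ℕ) : Measurable (cell ν) := by
  unfold cell
  fun_prop

theorem volume_cell {ν : ℕ} (hν : 0 < ν) (k : ℤ × ℤ) :
    volume (cell ν ⁻¹' {k}) = ENNReal.ofReal ((ν : ℝ) ^ 2)⁻¹ := by
  have hν' : (0 : ℝ) < ν := by exact_mod_cast hν
  have h : cell ν ⁻¹' {k} =
      Set.Ico ((k.1 : ℝ) / ν) ((k.1 + 1) / ν) ×ˢ Set.Ico ((k.2 : ℝ) / ν) ((k.2 + 1) / ν) := by
    ext x
    simp only [cell, Set.mem_preimage, Set.mem_singleton_iff, Prod.ext_iff, Int.floor_eq_iff,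
      Set.mem_prod, Set.mem_Ico, div_le_iff₀ hν', lt_div_iff₀ hν', mul_comm (ν : ℝ)]
  rw [h, Measure.volume_eq_prod, Measure.prod_prod, Real.volume_Ico, Real.volume_Ico,
    ← ENNReal.ofReal_mul (by rw [← sub_div]; simp)]
  congr 1
  field_simp
  ring

theorem abs_sub_gridPt_cell {ν : ℕ} (hν : 0 < ν) (x : ℝ × ℝ) :
    |x.1 - (gridPt ν (cell ν x)).1| ≤ (ν : ℝ)⁻¹ ∧ |x.2 - (gridPt ν (cell ν x)).2| ≤ (ν : ℝ)⁻¹ := by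
  have hν' : (0 : ℝ) < ν := by exact_mod_cast hν
  have key (s : ℝ) : |s - (⌊ν * s⌋ : ℝ) / ν| ≤ (ν : ℝ)⁻¹ := by
    have h1 := Int.floor_le (ν * s)
    have h2 := Int.lt_floor_add_one (ν * s)
    rw [show s - (⌊ν * s⌋ : ℝ) / ν = (ν * s - ⌊ν * s⌋) / ν by field_simp, abs_div,
      abs_of_pos hν', div_le_iff₀ hν', inv_mul_cancel₀ hν'.ne', abs_le]
    constructor <;> linarith
  exact ⟨key _, key _⟩

theorem tendsto_gridPt_cell (x : ℝ × ℝ) :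
    Tendsto (fun ν => gridPt ν (cell ν x)) atTop (𝓝 x) := by
  have h0 : Tendsto (fun ν : ℕ => (ν : ℝ)⁻¹) atTop (𝓝 0) := tendsto_inv_atTop_nhds_zero_nat
  have key (u : ℕ → ℝ) (s : ℝ) (h : ∀ᶠ ν : ℕ in atTop, |s - u ν| ≤ (ν : ℝ)⁻¹) :
      Tendsto u atTop (𝓝 s) := by
    rw [tendsto_iff_norm_sub_tendsto_zero]
    refine squeeze_zero' (.of_forall fun _ => norm_nonneg _) ?_ h0
    filter_upwards [h] with ν hν
    rwa [Real.norm_eq_abs, abs_sub_comm]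
  refine Tendsto.prodMk_nhds (key _ _ ?_) (key _ _ ?_) <;>
    filter_upwards [eventually_gt_atTop 0] with ν hν
  exacts [(abs_sub_gridPt_cell hν x).1, (abs_sub_gridPt_cell hν x).2]

theorem planeDecay_gridPt_cell {ν : ℕ} (hν : 0 < ν) (x : ℝ × ℝ) :
    planeDecay (gridPt ν (cell ν x)) ≤ 9 * planeDecay x := by
  have h1 : (ν : ℝ)⁻¹ ≤ 1 := inv_le_one_of_one_le₀ (by exact_mod_cast hν)
  have h := abs_sub_gridPt_cell hν x
  exact planeDecay_le (h.1.trans h1) (h.2.trans h1)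

section Step

variable {E : Type*} [NormedAddCommGroup E]

theorem stronglyMeasurable_comp_cell (ν : ℕ) (G : ℤ × ℤ → E) :
    StronglyMeasurable fun x => G (cell ν x) :=
  (StronglyMeasurable.of_discrete (f := G)).comp_measurable (measurable_cell ν)

theorem comp_cell_eq_sum (ν : ℕ) {S : Finset (ℤ × ℤ)} {G : ℤ × ℤ → E}
    (hG : ∀ k ∉ S, G k = 0) (x : ℝ × ℝ) :
    G (cell ν x) = ∑ k ∈ S, (cell ν ⁻¹' {k}).indicator (fun _ => G k) x := by
  classical
  have h : ∀ k, (cell ν ⁻¹' {k}).indicator (fun _ => G k) x = if cell ν x = k then G k else 0 :=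
    fun k => by simp [Set.indicator_apply]
  simp only [h]
  rw [Finset.sum_ite_eq]
  split_ifs with h
  · rfl
  · exact hG _ h

theorem memLp_comp_cell {ν : ℕ} (hν : 0 < ν) {S : Finset (ℤ × ℤ)} {G : ℤ × ℤ → E}
    (hG : ∀ k ∉ S, G k = 0) (q : ℝ≥0∞) : MemLp (fun x => G (cell ν x)) q volume := by
  simp only [comp_cell_eq_sum ν hG]
  refine memLp_finsetSum _ fun k _ => memLp_indicator_const _
    (measurable_cell ν (measurableSet_singleton k)) _ (Or.inr ?_)
  rw [volume_cell hν]
  exact ENNReal.ofReal_ne_top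

theorem integral_comp_cell [NormedSpace ℝ E] [CompleteSpace E] {ν : ℕ} (hν : 0 < ν)
    {S : Finset (ℤ × ℤ)} {G : ℤ × ℤ → E} (hG : ∀ k ∉ S, G k = 0) :
    ∫ x, G (cell ν x) = ((ν : ℝ) ^ 2)⁻¹ • ∑ k ∈ S, G k := by
  simp only [comp_cell_eq_sum ν hG]
  have hm (k : ℤ × ℤ) : MeasurableSet (cell ν ⁻¹' {k}) :=
    measurable_cell ν (measurableSet_singleton k)
  rw [integral_finsetSum, Finset.smul_sum]
  · refine Finset.sum_congr rfl fun k _ => ?_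
    rw [integral_indicator_const _ (hm k), Measure.real, volume_cell hν,
      ENNReal.toReal_ofReal (by positivity)]
  · refine fun k _ => (integrable_indicator_iff (hm k)).2 (integrableOn_const ?_)
    rw [volume_cell hν]
    exact ENNReal.ofReal_ne_top

theorem eLpNorm_comp_cell {ν : ℕ} (hν : 0 < ν) {S : Finset (ℤ × ℤ)} {G : ℤ × ℤ → E}
    (hG : ∀ k ∉ S, G k = 0) {a : ℝ} (ha : 0 < a) :
    eLpNorm (fun x => G (cell ν x)) (ENNReal.ofReal a⁻¹) volume =
      ENNReal.ofReal ((((ν : ℝ) ^ 2)⁻¹ * ∑ k ∈ S, ‖G k‖ ^ a⁻¹) ^ a) := by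
  have hia : 0 < a⁻¹ := inv_pos.2 ha
  rw [(memLp_comp_cell hν hG _).eLpNorm_eq_integral_rpow_norm (by simpa using ha)
    ENNReal.ofReal_ne_top, ENNReal.toReal_ofReal hia.le, inv_inv,
    integral_comp_cell (G := fun k => ‖G k‖ ^ a⁻¹) (S := S) hν, smul_eq_mul]
  intro k hk
  simp [hG k hk, hia.ne']

theorem tendsto_riemann_sum [NormedSpace ℝ E] [CompleteSpace E] {S : ℕ → Finset (ℤ × ℤ)}
    {G : ℕ → ℤ × ℤ → E} {F : ℝ × ℝ → E} {C : ℝ}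
    (hb : ∀ ν, ∀ k ∈ S ν, ‖G ν k‖ ≤ C * planeDecay (gridPt ν k))
    (hlim : ∀ x, Tendsto (fun ν => if cell ν x ∈ S ν then G ν (cell ν x) else 0) atTop (𝓝 (F x))) :
    Tendsto (fun ν : ℕ => ((ν : ℝ) ^ 2)⁻¹ • ∑ k ∈ S ν, G ν k) atTop (𝓝 (∫ x, F x)) := by
  have h := tendsto_integral_filter_of_dominated_convergence (μ := volume)
    (F := fun ν x => if cell ν x ∈ S ν then G ν (cell ν x) else 0) (f := F) (l := atTop)
    (fun x => |C| * (9 * planeDecay x))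
    (.of_forall fun ν => (stronglyMeasurable_comp_cell ν
      (fun k => if k ∈ S ν then G ν k else 0)).aestronglyMeasurable) ?_
    ((integrable_planeDecay.const_mul _).const_mul _) (.of_forall hlim)
  · refine h.congr' ?_
    filter_upwards [eventually_gt_atTop 0] with ν hν
    rw [integral_comp_cell (G := fun k => if k ∈ S ν then G ν k else 0) (S := S ν) hν
      (fun k hk => if_neg hk)]
    exact congrArg _ (Finset.sum_congr rfl fun k hk => if_pos hk)
  · filter_upwards [eventually_gt_atTop 0] with ν hν
    refine .of_forall fun x => ?_
    have h1 := planeDecay_gridPt_cell hν x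
    have h2 := planeDecay_pos (gridPt ν (cell ν x))
    split_ifs with hx
    · refine (hb ν _ hx).trans (mul_le_mul (le_abs_self C) h1 h2.le (abs_nonneg C))
    · rw [norm_zero]
      exact mul_nonneg (abs_nonneg C) (h2.le.trans h1)

end Step

theorem eventually_cell_mem_gridBox (x : ℝ × ℝ) : ∀ᶠ ν in atTop, cell ν x ∈ gridBox ν := by
  have key (s : ℝ) : ∀ᶠ ν : ℕ in atTop,
      ⌊ν * s⌋ * 2 ∈ Set.Ioc (-(ν ^ 2 : ℕ) : ℤ) (ν ^ 2 : ℕ) := by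
    obtain ⟨M, hM⟩ := exists_nat_gt |s|
    filter_upwards [eventually_ge_atTop (2 * (M + 2))] with ν hν
    have h1 := Int.floor_le (ν * s)
    have h2 := Int.lt_floor_add_one (ν * s)
    have hs := abs_lt.1 hM
    have hν' : (2 * (M + 2) : ℝ) ≤ ν := by exact_mod_cast hν
    have hM0 : (0 : ℝ) ≤ M := M.cast_nonneg
    constructor
    · have : (-(ν ^ 2 : ℕ) : ℝ) < (⌊ν * s⌋ * 2 : ℤ) := by push_cast; nlinarith
      exact_mod_cast this
    · have : ((⌊ν * s⌋ * 2 : ℤ) : ℝ) ≤ (ν ^ 2 : ℕ) := by push_cast; nlinarith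
      exact_mod_cast this
  filter_upwards [key x.1, key x.2] with ν h1 h2 using mem_gridBox.2 ⟨h1, h2⟩

theorem tendsto_ite_gridBox {E : Type*} [NormedAddCommGroup E] {G : ℕ → ℤ × ℤ → E} {x : ℝ × ℝ}
    {y : E} (h : Tendsto (fun ν => G ν (cell ν x)) atTop (𝓝 y)) :
    Tendsto (fun ν => if cell ν x ∈ gridBox ν then G ν (cell ν x) else 0) atTop (𝓝 y) := by
  refine h.congr' ?_
  filter_upwards [eventually_cell_mem_gridBox x] with ν hν
  rw [if_pos hν]

theorem eventually_floor_lt_iff (s t : ℝ) : ∀ᶠ ν : ℕ in atTop, ⌊ν * s⌋ < ⌊ν * t⌋ ↔ s < t := by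
  by_cases h : s < t
  · obtain ⟨M, hM⟩ := exists_nat_gt (t - s)⁻¹
    filter_upwards [eventually_ge_atTop M] with ν hν
    simp only [h, iff_true]
    have h0 : (M : ℝ) ≤ ν := by exact_mod_cast hν
    have h1 : 1 ≤ ν * (t - s) := by
      have := mul_lt_mul_of_pos_right hM (sub_pos.2 h)
      rw [inv_mul_cancel₀ (sub_pos.2 h).ne'] at this
      nlinarith
    rw [← Int.add_one_le_iff, Int.le_floor]
    push_cast
    have := Int.floor_le (ν * s)
    linarith
  · refine .of_forall fun ν => ?_
    simp only [h, iff_false, not_lt]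
    exact Int.floor_mono (mul_le_mul_of_nonneg_left (not_lt.1 h) ν.cast_nonneg)

theorem eventually_floor_mem_Icc_iff (A : ℕ) (s : ℝ) :
    ∀ᶠ ν : ℕ in atTop, ⌊ν * s⌋ ∈ Finset.Icc (-((A * ν : ℕ) : ℤ)) (A * ν : ℕ) ↔ |s| ≤ A := by
  have h1 := eventually_floor_lt_iff A s
  have h2 := eventually_floor_lt_iff s (-A)
  filter_upwards [h1, h2] with ν h1 h2
  rw [show (ν * A : ℝ) = ((A * ν : ℕ) : ℤ) by push_cast; ring, Int.floor_intCast] at h1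
  rw [show (ν * (-A) : ℝ) = ((-(A * ν : ℕ) : ℤ) : ℝ) by push_cast; ring, Int.floor_intCast] at h2
  rw [Finset.mem_Icc, abs_le, ← not_lt, ← not_lt, ← not_lt, ← not_lt, h1, h2]

end Riemann

section Chain

open Filter Topology

/-- Iterated integration of `φ 0, …, φ m` against the kernel `θ`. -/
noncomputable def chainInt (θ : ℝ × ℝ → ℝ × ℝ → ℂ) (φ : ℕ → ℝ × ℝ → ℂ) : ℕ → ℝ × ℝ → ℂ
  | 0, ξ => φ 0 ξ
  | m + 1, ξ => φ (m + 1) ξ * ∫ η, θ η ξ * chainInt θ φ m η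

theorem stronglyMeasurable_chainInt {θ : ℝ × ℝ → ℝ × ℝ → ℂ} {φ : ℕ → ℝ × ℝ → ℂ}
    (hθ : StronglyMeasurable (Function.uncurry θ)) (hφ : ∀ t, StronglyMeasurable (φ t)) (m : ℕ) :
    StronglyMeasurable (chainInt θ φ m) := by
  induction m with
  | zero => exact hφ 0
  | succ m ih =>
    refine (hφ (m + 1)).mul (StronglyMeasurable.integral_prod_right'
      (f := fun p : (ℝ × ℝ) × (ℝ × ℝ) => θ p.2 p.1 * chainInt θ φ m p.2) ?_)
    exact (hθ.comp_measurable measurable_swap).mul (ih.comp_measurable measurable_snd)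

theorem stronglyMeasurable_kernel_mul_chainInt {θ : ℝ × ℝ → ℝ × ℝ → ℂ} {φ : ℕ → ℝ × ℝ → ℂ}
    (hθ : StronglyMeasurable (Function.uncurry θ)) (hφ : ∀ t, StronglyMeasurable (φ t)) (m : ℕ)
    (ξ : ℝ × ℝ) : StronglyMeasurable fun η => θ η ξ * chainInt θ φ m η :=
  (hθ.comp_measurable (measurable_id.prodMk measurable_const)).mul
    (stronglyMeasurable_chainInt hθ hφ m)

theorem exists_chainInt_bound {C : ℕ → ℝ} (hC : ∀ t, 0 ≤ C t) (m : ℕ) : ∃ D, 0 ≤ D ∧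
    ∀ (θ : ℝ × ℝ → ℝ × ℝ → ℂ) (φ : ℕ → ℝ × ℝ → ℂ), (∀ η ξ, ‖θ η ξ‖ ≤ 1) →
      (∀ t x, ‖φ t x‖ ≤ C t * planeDecay x) → ∀ ξ, ‖chainInt θ φ m ξ‖ ≤ D * planeDecay ξ := by
  induction m with
  | zero => exact ⟨C 0, hC 0, fun θ φ _ hφ ξ => hφ 0 ξ⟩
  | succ m ih =>
    obtain ⟨D, hD, h⟩ := ih
    have hI : 0 ≤ ∫ η, D * planeDecay η :=
      integral_nonneg fun η => mul_nonneg hD (planeDecay_pos η).le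
    refine ⟨C (m + 1) * ∫ η, D * planeDecay η, mul_nonneg (hC _) hI, fun θ φ hθ hφ ξ => ?_⟩
    rw [chainInt, norm_mul, mul_right_comm]
    refine mul_le_mul (hφ _ ξ) (norm_integral_le_of_norm_le (integrable_planeDecay.const_mul D)
      (.of_forall fun η => ?_)) (norm_nonneg _) (mul_nonneg (hC _) (planeDecay_pos _).le)
    rw [norm_mul]
    exact (mul_le_of_le_one_left (norm_nonneg _) (hθ η ξ)).trans (h θ φ hθ hφ η)

section Limit

variable {θs : ℕ → ℝ × ℝ → ℝ × ℝ → ℂ} {θ : ℝ × ℝ → ℝ × ℝ → ℂ} {φs : ℕ → ℕ → ℝ × ℝ → ℂ}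
  {φ : ℕ → ℝ × ℝ → ℂ} {C : ℕ → ℝ}

theorem tendsto_chainInt (hθm : ∀ ν, StronglyMeasurable (Function.uncurry (θs ν)))
    (hφm : ∀ ν t, StronglyMeasurable (φs ν t)) (hC : ∀ t, 0 ≤ C t)
    (hθ1 : ∀ ν η ξ, ‖θs ν η ξ‖ ≤ 1) (hφ1 : ∀ᶠ ν in atTop, ∀ t x, ‖φs ν t x‖ ≤ C t * planeDecay x)
    (hθ : ∀ η ξ, Tendsto (fun ν => θs ν η ξ) atTop (𝓝 (θ η ξ)))
    (hφ : ∀ t x, Tendsto (fun ν => φs ν t x) atTop (𝓝 (φ t x))) (m : ℕ) (ξ : ℝ × ℝ) :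
    Tendsto (fun ν => chainInt (θs ν) (φs ν) m ξ) atTop (𝓝 (chainInt θ φ m ξ)) := by
  induction m generalizing ξ with
  | zero => exact hφ 0 ξ
  | succ m ih =>
    obtain ⟨D, hD, h⟩ := exists_chainInt_bound hC m
    refine (hφ (m + 1) ξ).mul (tendsto_integral_filter_of_dominated_convergence
      (fun η => D * planeDecay η) (.of_forall fun ν =>
        (stronglyMeasurable_kernel_mul_chainInt (hθm ν) (hφm ν) m ξ).aestronglyMeasurable) ?_
      (integrable_planeDecay.const_mul D) (.of_forall fun η => (hθ η ξ).mul (ih η)))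
    filter_upwards [hφ1] with ν hν
    refine .of_forall fun η => ?_
    rw [norm_mul]
    exact (mul_le_of_le_one_left (norm_nonneg _) (hθ1 ν η ξ)).trans (h _ _ (hθ1 ν) hν η)

theorem tendsto_integral_chainInt (hθm : ∀ ν, StronglyMeasurable (Function.uncurry (θs ν)))
    (hφm : ∀ ν t, StronglyMeasurable (φs ν t)) (hC : ∀ t, 0 ≤ C t)
    (hθ1 : ∀ ν η ξ, ‖θs ν η ξ‖ ≤ 1) (hφ1 : ∀ᶠ ν in atTop, ∀ t x, ‖φs ν t x‖ ≤ C t * planeDecay x)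
    (hθ : ∀ η ξ, Tendsto (fun ν => θs ν η ξ) atTop (𝓝 (θ η ξ)))
    (hφ : ∀ t x, Tendsto (fun ν => φs ν t x) atTop (𝓝 (φ t x))) (m : ℕ) :
    Tendsto (fun ν => ∫ ξ, chainInt (θs ν) (φs ν) m ξ) atTop (𝓝 (∫ ξ, chainInt θ φ m ξ)) := by
  obtain ⟨D, hD, h⟩ := exists_chainInt_bound hC m
  refine tendsto_integral_filter_of_dominated_convergence
    (fun η => D * planeDecay η) (.of_forall fun ν =>
      (stronglyMeasurable_chainInt (hθm ν) (hφm ν) m).aestronglyMeasurable) ?_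
    (integrable_planeDecay.const_mul D)
    (.of_forall fun η => tendsto_chainInt hθm hφm hC hθ1 hφ1 hθ hφ m η)
  filter_upwards [hφ1] with ν hν
  exact .of_forall fun η => h _ _ (hθ1 ν) hν η

end Limit

/-- The kernel of the strict order in both coordinates. -/
noncomputable def orderKernel (η ξ : ℝ × ℝ) : ℂ := if η.1 < ξ.1 ∧ η.2 < ξ.2 then 1 else 0

theorem norm_orderKernel_le (η ξ : ℝ × ℝ) : ‖orderKernel η ξ‖ ≤ 1 := by
  unfold orderKernel; split_ifs <;> simp

theorem stronglyMeasurable_orderKernel : StronglyMeasurable (Function.uncurry orderKernel) := by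
  refine Measurable.stronglyMeasurable (Measurable.ite ?_ measurable_const measurable_const)
  exact (measurableSet_lt measurable_fst.fst measurable_snd.fst).inter
    (measurableSet_lt measurable_fst.snd measurable_snd.snd)

/-- The strict order kernel on grid cells. -/
noncomputable def cellKernel (ν : ℕ) (η ξ : ℝ × ℝ) : ℂ :=
  if (cell ν η).1 < (cell ν ξ).1 ∧ (cell ν η).2 < (cell ν ξ).2 then 1 else 0

theorem norm_cellKernel_le (ν : ℕ) (η ξ : ℝ × ℝ) : ‖cellKernel ν η ξ‖ ≤ 1 := by
  unfold cellKernel; split_ifs <;> simp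

theorem stronglyMeasurable_cellKernel (ν : ℕ) :
    StronglyMeasurable (Function.uncurry (cellKernel ν)) :=
  (StronglyMeasurable.of_discrete (f := fun p : (ℤ × ℤ) × (ℤ × ℤ) =>
    if p.1.1 < p.2.1 ∧ p.1.2 < p.2.2 then (1 : ℂ) else 0)).comp_measurable
    (((measurable_cell ν).comp measurable_fst).prodMk ((measurable_cell ν).comp measurable_snd))

theorem tendsto_cellKernel (η ξ : ℝ × ℝ) :
    Tendsto (fun ν => cellKernel ν η ξ) atTop (𝓝 (orderKernel η ξ)) := by
  refine tendsto_const_nhds.congr' ?_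
  filter_upwards [eventually_floor_lt_iff η.1 ξ.1, eventually_floor_lt_iff η.2 ξ.2] with ν h1 h2
  simp only [cellKernel, orderKernel, cell, h1, h2]

theorem chainInt_cell {ν : ℕ} (hν : 0 < ν) (K : ℕ) (φ : ℕ → ℤ × ℤ → ℂ) (m : ℕ) (x : ℝ × ℝ) :
    chainInt (cellKernel ν) (fun t x =>
      if cell ν x ∈ Finset.Icc (-(K : ℤ)) K ×ˢ Finset.Icc (-(K : ℤ)) K then φ t (cell ν x) else 0)
      m x =
    if cell ν x ∈ Finset.Icc (-(K : ℤ)) K ×ˢ Finset.Icc (-(K : ℤ)) K then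
      (((ν : ℂ) ^ 2)⁻¹) ^ m * chainSum K φ m (cell ν x) else 0 := by
  induction m generalizing x with
  | zero => simp [chainInt, chainSum]
  | succ m ih =>
    rw [chainInt]
    simp only [ih]
    have h := integral_comp_cell (E := ℂ) hν (S := Finset.Icc (-(K : ℤ)) K ×ˢ Finset.Icc (-(K : ℤ)) K)
      (G := fun k => (if k.1 < (cell ν x).1 ∧ k.2 < (cell ν x).2 then (1 : ℂ) else 0) *
        (if k ∈ Finset.Icc (-(K : ℤ)) K ×ˢ Finset.Icc (-(K : ℤ)) K then
          (((ν : ℂ) ^ 2)⁻¹) ^ m * chainSum K φ m k else 0)) fun k hk => by rw [if_neg hk, mul_zero]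
    simp only [cellKernel]
    rw [h]
    split_ifs with hx
    · have hsum : ∑ k ∈ Finset.Icc (-(K : ℤ)) K ×ˢ Finset.Icc (-(K : ℤ)) K,
          (if k.1 < (cell ν x).1 ∧ k.2 < (cell ν x).2 then (1 : ℂ) else 0) *
            ((((ν : ℂ) ^ 2)⁻¹) ^ m * chainSum K φ m k) =
          (((ν : ℂ) ^ 2)⁻¹) ^ m * ∑ k ∈ Finset.Icc (-(K : ℤ)) K ×ˢ Finset.Icc (-(K : ℤ)) K,
            if k.1 < (cell ν x).1 ∧ k.2 < (cell ν x).2 then chainSum K φ m k else 0 := by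
        rw [Finset.mul_sum]
        refine Finset.sum_congr rfl fun k _ => ?_
        split_ifs <;> simp
      rw [hsum, chainSum, Complex.real_smul]
      push_cast
      ring
    · rw [zero_mul]

theorem gridOp_eq_integral {ν : ℕ} (hν : 0 < ν) (K n : ℕ) (ε : ℕ → ℤ) (g f : ℕ → ℝ × ℝ → ℂ)
    (j : ℤ × ℤ) : gridOp ν K n ε g f j = ∫ x, chainInt (cellKernel ν) (fun t x =>
      if cell ν x ∈ Finset.Icc (-(K : ℤ)) K ×ˢ Finset.Icc (-(K : ℤ)) K then
        gridCoeff ν g f t (cell ν x) *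
          planeChar (gridPt ν (cell ν x)) ((ε t : ℝ) • gridPt ν j) else 0) n x := by
  have h := fun x => chainInt_cell hν K (fun t k => gridCoeff ν g f t k *
    planeChar (gridPt ν k) ((ε t : ℝ) • gridPt ν j)) n x
  simp only [h]
  rw [integral_comp_cell (S := Finset.Icc (-(K : ℤ)) K ×ˢ Finset.Icc (-(K : ℤ)) K) hν
    (G := fun k => if k ∈ Finset.Icc (-(K : ℤ)) K ×ˢ Finset.Icc (-(K : ℤ)) K then
      (((ν : ℂ) ^ 2)⁻¹) ^ n * chainSum K (fun t k => gridCoeff ν g f t k *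
    planeChar (gridPt ν k) ((ε t : ℝ) • gridPt ν j)) n k else 0) fun k hk => if_neg hk,
    gridOp, Complex.real_smul, pow_succ', mul_assoc, Finset.mul_sum]
  push_cast
  refine congrArg _ (Finset.sum_congr rfl fun k hk => ?_)
  rw [if_pos hk]

end Chain

section Fubini

/-- Simultaneous strict monotonicity of both coordinates. -/
def BiStrictMono {n : ℕ} (x : Fin n → ℝ × ℝ) : Prop :=
  StrictMono (fun i => (x i).1) ∧ StrictMono fun i => (x i).2

theorem strictMono_snoc_iff {m : ℕ} {y : Fin (m + 1) → ℝ} {a : ℝ} :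
    StrictMono (Fin.snoc y a : Fin (m + 2) → ℝ) ↔ StrictMono y ∧ y (Fin.last m) < a := by
  rw [Fin.strictMono_iff_lt_succ, Fin.strictMono_iff_lt_succ, Fin.forall_fin_succ']
  simp only [Fin.snoc_castSucc, Fin.succ_last, Fin.snoc_last, Fin.succ_castSucc]

theorem biStrictMono_snoc_iff {m : ℕ} {y : Fin (m + 1) → ℝ × ℝ} {a : ℝ × ℝ} :
    BiStrictMono (Fin.snoc y a : Fin (m + 2) → ℝ × ℝ) ↔
      BiStrictMono y ∧ (y (Fin.last m)).1 < a.1 ∧ (y (Fin.last m)).2 < a.2 := by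
  have h (p : ℝ × ℝ → ℝ) : (fun i => p ((Fin.snoc y a : Fin (m + 2) → ℝ × ℝ) i)) =
      (Fin.snoc (fun i => p (y i)) (p a) : Fin (m + 2) → ℝ) := by
    funext i
    refine Fin.lastCases ?_ (fun i => ?_) i <;> simp
  rw [BiStrictMono, h Prod.fst, h Prod.snd, strictMono_snoc_iff, strictMono_snoc_iff, BiStrictMono]
  tauto

theorem measurableSet_biStrictMono (m : ℕ) :
    MeasurableSet {x : Fin (m + 1) → ℝ × ℝ | BiStrictMono x} := by
  simp only [BiStrictMono, Fin.strictMono_iff_lt_succ, Set.ofPred_and, Set.ofPred_forall]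
  refine (MeasurableSet.iInter fun i => ?_).inter (MeasurableSet.iInter fun i => ?_)
  · exact measurableSet_lt (measurable_pi_apply _).fst (measurable_pi_apply _).fst
  · exact measurableSet_lt (measurable_pi_apply _).snd (measurable_pi_apply _).snd

/-- The integrand over ordered tuples. -/
noncomputable def tupleFun (φ : ℕ → ℝ × ℝ → ℂ) (h : ℝ × ℝ → ℂ) (m : ℕ) (x : Fin (m + 1) → ℝ × ℝ) :
    ℂ :=
  {x | BiStrictMono x}.indicator (fun x => (∏ i : Fin (m + 1), φ i (x i)) * h (x (Fin.last m))) x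

theorem integrable_tupleFun {φ : ℕ → ℝ × ℝ → ℂ} {h : ℝ × ℝ → ℂ} {C : ℕ → ℝ}
    (hφ : ∀ t, StronglyMeasurable (φ t)) (hh : StronglyMeasurable h)
    (hφ1 : ∀ t x, ‖φ t x‖ ≤ C t * planeDecay x) (hh1 : ∀ x, ‖h x‖ ≤ 1) (m : ℕ) :
    Integrable (tupleFun φ h m) := by
  have hprod : Integrable (fun x : Fin (m + 1) → ℝ × ℝ => ∏ i : Fin (m + 1), φ i (x i)) :=
    Integrable.fintype_prod fun i : Fin (m + 1) => Integrable.mono' (integrable_planeDecay.const_mul (C i))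
      (hφ i).aestronglyMeasurable (.of_forall (hφ1 i))
  refine Integrable.indicator (hprod.mul_bdd (c := 1) ?_ (.of_forall fun x => hh1 _))
    (measurableSet_biStrictMono m)
  exact (hh.comp_measurable (measurable_pi_apply _)).aestronglyMeasurable

theorem integral_tupleFun {φ : ℕ → ℝ × ℝ → ℂ} {C : ℕ → ℝ}
    (hφ : ∀ t, StronglyMeasurable (φ t)) (hφ1 : ∀ t x, ‖φ t x‖ ≤ C t * planeDecay x) (m : ℕ)
    {h : ℝ × ℝ → ℂ} (hh : StronglyMeasurable h) (hh1 : ∀ x, ‖h x‖ ≤ 1) :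
    ∫ x, tupleFun φ h m x = ∫ ξ, h ξ * chainInt orderKernel φ m ξ := by
  induction m generalizing h with
  | zero =>
    rw [← (volume_preserving_funUnique (Fin 1) (ℝ × ℝ)).integral_comp']
    refine integral_congr_ae (.of_forall fun x => ?_)
    have : Subsingleton (Fin (0 + 1)) := inferInstanceAs (Subsingleton (Fin 1))
    have hx : BiStrictMono x := ⟨Subsingleton.strictMono _, Subsingleton.strictMono _⟩
    simp [tupleFun, hx, chainInt, mul_comm]
  | succ m ih =>
    have hmp := (volume_preserving_piFinSuccAbove (fun _ : Fin (m + 2) => ℝ × ℝ)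
      (Fin.last (m + 1))).symm
    have hprod : Integrable (fun p => tupleFun φ h (m + 1)
        ((MeasurableEquiv.piFinSuccAbove (fun _ : Fin (m + 2) => ℝ × ℝ)
          (Fin.last (m + 1))).symm p)) (volume.prod volume) :=
      hmp.integrable_comp_of_integrable (integrable_tupleFun hφ hh hφ1 hh1 (m + 1))
    rw [← hmp.integral_comp', Measure.volume_eq_prod, integral_prod _ hprod]
    refine integral_congr_ae (.of_forall fun ξ => ?_)
    have hk : StronglyMeasurable fun η => orderKernel η ξ :=
      stronglyMeasurable_orderKernel.comp_measurable (measurable_id.prodMk measurable_const)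
    have key (y : Fin (m + 1) → ℝ × ℝ) : tupleFun φ h (m + 1)
        ((MeasurableEquiv.piFinSuccAbove (fun _ : Fin (m + 2) => ℝ × ℝ)
          (Fin.last (m + 1))).symm (ξ, y)) =
        h ξ * φ (m + 1) ξ * tupleFun φ (fun η => orderKernel η ξ) m y := by
      have hs : (MeasurableEquiv.piFinSuccAbove (fun _ : Fin (m + 2) => ℝ × ℝ)
          (Fin.last (m + 1))).symm (ξ, y) = Fin.snoc y ξ := Fin.insertNth_last' ξ y
      rw [hs, tupleFun, tupleFun]
      by_cases h1 : BiStrictMono y <;>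
        by_cases h2 : (y (Fin.last m)).1 < ξ.1 ∧ (y (Fin.last m)).2 < ξ.2 <;>
        simp [biStrictMono_snoc_iff, h1, h2, orderKernel, Fin.prod_univ_castSucc]
      ring
    simp only [key]
    rw [integral_const_mul, ih hk fun η => norm_orderKernel_le η ξ, chainInt, mul_assoc]

end Fubini

section Limits

open Filter Topology ComplexConjugate
open scoped SchwartzMap

theorem norm_planeChar (x y : ℝ × ℝ) : ‖planeChar x y‖ = 1 := by
  rw [planeChar, show 2 * π * I * (x.1 * y.1 + x.2 * y.2 : ℂ) =
    ((2 * π * (x.1 * y.1 + x.2 * y.2) : ℝ) : ℂ) * I by push_cast; ring]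
  exact Complex.norm_exp_ofReal_mul_I _

theorem conj_planeChar (x y : ℝ × ℝ) :
    conj (planeChar x y) = exp (-(2 * π * I * (y.1 * x.1 + y.2 * x.2))) := by
  rw [planeChar, ← Complex.exp_conj]
  congr 1
  simp only [map_mul, map_add, Complex.conj_ofReal, Complex.conj_I, map_ofNat]
  ring

theorem continuous_planeChar : Continuous fun p : (ℝ × ℝ) × (ℝ × ℝ) => planeChar p.1 p.2 := by
  unfold planeChar
  fun_prop

theorem tendsto_planeChar {u v : ℕ → ℝ × ℝ} {x y : ℝ × ℝ} (hu : Tendsto u atTop (𝓝 x))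
    (hv : Tendsto v atTop (𝓝 y)) :
    Tendsto (fun ν => planeChar (u ν) (v ν)) atTop (𝓝 (planeChar x y)) := by
  have key : ContinuousAt (fun p : (ℝ × ℝ) × (ℝ × ℝ) => planeChar p.1 p.2) (x, y) :=
    continuous_planeChar.continuousAt
  exact key.tendsto.comp (f := fun ν => (u ν, v ν)) (hu.prodMk_nhds hv)

theorem tendsto_gridFT (f : 𝓢(ℝ × ℝ, ℂ)) (ξ : ℝ × ℝ) :
    Tendsto (fun ν => gridFT ν f (cell ν ξ)) atTop (𝓝 (FT2 f ξ)) := by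
  obtain ⟨C, hC, h⟩ := exists_le_planeDecay f
  have key := tendsto_riemann_sum (S := gridBox) (C := C)
    (G := fun ν j => f (gridPt ν j) * conj (planeChar (gridPt ν (cell ν ξ)) (gridPt ν j)))
    (F := fun x => f x * Complex.exp (-(2 * π * Complex.I * (x.1 * ξ.1 + x.2 * ξ.2))))
    (fun ν k _ => by rw [norm_mul, RCLike.norm_conj, norm_planeChar, mul_one]; exact h _)
    (fun x => tendsto_ite_gridBox
      (G := fun ν j => f (gridPt ν j) * conj (planeChar (gridPt ν (cell ν ξ)) (gridPt ν j))) ?_)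
  · refine key.congr fun ν => ?_
    rw [gridFT, Complex.real_smul]
    push_cast
    rfl
  · rw [← conj_planeChar ξ x]
    have h1 : Tendsto (fun ν => f (gridPt ν (cell ν x))) atTop (𝓝 (f x)) :=
      (f.continuous.tendsto x).comp (tendsto_gridPt_cell x)
    have h2 := tendsto_planeChar (tendsto_gridPt_cell ξ) (tendsto_gridPt_cell x)
    exact h1.mul ((Complex.continuous_conj.tendsto _).comp h2)

theorem norm_gridFT_le {f : ℝ × ℝ → ℂ} {C : ℝ} (hC : 0 ≤ C) (hf : ∀ x, ‖f x‖ ≤ C * planeDecay x)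
    {ν : ℕ} (hν : 0 < ν) (k : ℤ × ℤ) : ‖gridFT ν f k‖ ≤ C * ∫ x, 9 * planeDecay x := by
  have h1 : ((ν : ℝ) ^ 2)⁻¹ * ∑ j ∈ gridBox ν, planeDecay (gridPt ν j) ≤ ∫ x, 9 * planeDecay x := by
    have h := integral_comp_cell (S := gridBox ν) hν
      (G := fun j => if j ∈ gridBox ν then planeDecay (gridPt ν j) else 0) fun _ hk => if_neg hk
    rw [Finset.sum_congr rfl fun j hj => if_pos hj, smul_eq_mul] at h
    rw [← h]
    refine integral_mono_of_nonneg (.of_forall fun x => ?_) (integrable_planeDecay.const_mul 9)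
      (.of_forall fun x => ?_)
    · dsimp only
      split_ifs
      exacts [(planeDecay_pos _).le, le_rfl]
    · dsimp only
      split_ifs
      · exact planeDecay_gridPt_cell hν x
      · exact mul_nonneg (by norm_num) (planeDecay_pos x).le
  rw [gridFT, norm_mul, norm_inv, norm_pow, Complex.norm_natCast]
  calc _ ≤ ((ν : ℝ) ^ 2)⁻¹ * ∑ j ∈ gridBox ν, C * planeDecay (gridPt ν j) := by
        gcongr
        refine norm_sum_le_of_le _ fun j _ => ?_
        rw [norm_mul, RCLike.norm_conj, norm_planeChar, mul_one]
        exact hf _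
    _ = C * (((ν : ℝ) ^ 2)⁻¹ * ∑ j ∈ gridBox ν, planeDecay (gridPt ν j)) := by
        rw [← Finset.mul_sum]; ring
    _ ≤ _ := by gcongr

theorem tendsto_gridLp (f : 𝓢(ℝ × ℝ, ℂ)) {b : ℝ} (hb : 0 < b) (hb1 : b < 1) :
    Tendsto (fun ν : ℕ => (((ν : ℝ) ^ 2)⁻¹ * ∑ j ∈ gridBox ν, ‖f (gridPt ν j)‖ ^ b⁻¹) ^ b) atTop
      (𝓝 (eLpNorm f (ENNReal.ofReal b⁻¹) volume).toReal) := by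
  obtain ⟨C, hC, h⟩ := exists_le_planeDecay f
  have hib : 1 ≤ b⁻¹ := (one_le_inv₀ hb).2 hb1.le
  have key := tendsto_riemann_sum (S := gridBox) (C := C ^ b⁻¹)
    (G := fun ν j => ‖f (gridPt ν j)‖ ^ b⁻¹) (F := fun x => ‖f x‖ ^ b⁻¹)
    (fun ν k _ => ?_) (fun x => tendsto_ite_gridBox (G := fun ν j => ‖f (gridPt ν j)‖ ^ b⁻¹)
      ((((f.continuous.tendsto x).comp (tendsto_gridPt_cell x)).norm).rpow_const
        (Or.inr (by positivity))))
  · rw [(f.memLp (ENNReal.ofReal b⁻¹) volume).eLpNorm_eq_integral_rpow_norm (by simpa using hb) ENNReal.ofReal_ne_top,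
      ENNReal.toReal_ofReal (by positivity), ENNReal.toReal_ofReal (by positivity), inv_inv]
    exact key.rpow_const (Or.inr hb.le)
  · have hw := planeDecay_pos (gridPt ν k)
    rw [Real.norm_of_nonneg (by positivity)]
    calc _ ≤ (C * planeDecay (gridPt ν k)) ^ b⁻¹ := by gcongr; exact h _
      _ = C ^ b⁻¹ * planeDecay (gridPt ν k) ^ b⁻¹ := Real.mul_rpow hC.le hw.le
      _ ≤ _ := by
        gcongr
        simpa using Real.rpow_le_rpow_of_exponent_ge hw (planeDecay_le_one _) hib

theorem inv_sq_le_planeDecay {A : ℕ} {x : ℝ × ℝ} (h1 : |x.1| ≤ A) (h2 : |x.2| ≤ A) :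
    1 ≤ (1 + (A : ℝ) ^ 2) ^ 2 * planeDecay x := by
  have key (s : ℝ) (h : |s| ≤ A) : 1 + s ^ 2 ≤ 1 + (A : ℝ) ^ 2 := by
    rw [← sq_abs]; gcongr
  rw [planeDecay, ← mul_inv, ← div_eq_mul_inv, one_le_div₀ (by positivity),
    sq (1 + (A : ℝ) ^ 2)]
  exact mul_le_mul (key _ h1) (key _ h2) (by positivity) (by positivity)

theorem abs_gridPt_le {ν A : ℕ} {k : ℤ × ℤ} (hν : 0 < ν)
    (hk : k ∈ Finset.Icc (-((A * ν : ℕ) : ℤ)) (A * ν : ℕ) ×ˢ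
      Finset.Icc (-((A * ν : ℕ) : ℤ)) (A * ν : ℕ)) :
    |(gridPt ν k).1| ≤ A ∧ |(gridPt ν k).2| ≤ A := by
  have hν' : (0 : ℝ) < ν := by exact_mod_cast hν
  have key (j : ℤ) (h : j ∈ Finset.Icc (-((A * ν : ℕ) : ℤ)) (A * ν : ℕ)) : |(j : ℝ) / ν| ≤ A := by
    obtain ⟨h1, h2⟩ := Finset.mem_Icc.1 h
    rw [abs_div, abs_of_pos hν', div_le_iff₀ hν', abs_le]
    constructor
    · exact_mod_cast h1
    · exact_mod_cast h2
  exact ⟨key _ (Finset.mem_product.1 hk).1, key _ (Finset.mem_product.1 hk).2⟩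

/-- The modulated frequency data entering the operator. -/
noncomputable def modData (ε : ℕ → ℤ) (f : ℕ → ℝ × ℝ → ℂ) (z : ℝ × ℝ) (t : ℕ) (ξ : ℝ × ℝ) : ℂ :=
  FT2 (f t) ξ * planeChar ξ ((ε t : ℝ) • z)

/-- The modulated frequency data cut off to the box of side `2 A`. -/
noncomputable def cutData (A : ℕ) (ε : ℕ → ℤ) (f : ℕ → ℝ × ℝ → ℂ) (z : ℝ × ℝ) (t : ℕ)
    (ξ : ℝ × ℝ) : ℂ :=
  if |ξ.1| ≤ A ∧ |ξ.2| ≤ A then modData ε f z t ξ else 0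

section Operator

variable (ε : ℕ → ℤ) (f : ℕ → 𝓢(ℝ × ℝ, ℂ))

theorem stronglyMeasurable_modData (z : ℝ × ℝ) (t : ℕ) :
    StronglyMeasurable (modData ε (fun t => f t) z t) := by
  obtain ⟨g, hg⟩ := exists_schwartz_eq_FT2 (f t)
  unfold modData
  rw [← hg]
  exact (g.continuous.mul (continuous_planeChar.comp
    (continuous_id.prodMk continuous_const))).stronglyMeasurable

theorem stronglyMeasurable_cutData (A : ℕ) (z : ℝ × ℝ) (t : ℕ) :
    StronglyMeasurable (cutData A ε (fun t => f t) z t) := by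
  refine StronglyMeasurable.ite ?_ (stronglyMeasurable_modData ε f z t) stronglyMeasurable_const
  exact (measurableSet_le measurable_fst.abs measurable_const).inter
    (measurableSet_le measurable_snd.abs measurable_const)

theorem exists_modData_bound : ∃ C : ℕ → ℝ, (∀ t, 0 ≤ C t) ∧
    ∀ z t x, ‖modData ε (fun t => f t) z t x‖ ≤ C t * planeDecay x := by
  choose g hg using fun t => exists_schwartz_eq_FT2 (f t)
  choose C hC h using fun t => exists_le_planeDecay (g t)
  refine ⟨C, fun t => (hC t).le, fun z t x => ?_⟩
  rw [modData, norm_mul, norm_planeChar, mul_one, ← hg]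
  exact h t x

theorem norm_cutData_le (A : ℕ) (z : ℝ × ℝ) (t : ℕ) (x : ℝ × ℝ) :
    ‖cutData A ε (fun t => f t) z t x‖ ≤ ‖modData ε (fun t => f t) z t x‖ := by
  unfold cutData
  split_ifs <;> simp

theorem tendsto_cutData (z : ℝ × ℝ) (t : ℕ) (x : ℝ × ℝ) :
    Tendsto (fun A => cutData A ε (fun t => f t) z t x) atTop
      (𝓝 (modData ε (fun t => f t) z t x)) := by
  obtain ⟨M, hM⟩ := exists_nat_ge (max |x.1| |x.2|)
  refine tendsto_const_nhds.congr' ?_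
  filter_upwards [eventually_ge_atTop M] with A hA
  have h : (M : ℝ) ≤ A := by exact_mod_cast hA
  rw [cutData, if_pos ⟨(le_max_left _ _).trans (hM.trans h), (le_max_right _ _).trans (hM.trans h)⟩]

theorem tendsto_gridOp (A n : ℕ) (z : ℝ × ℝ) :
    Tendsto (fun ν => gridOp ν (A * ν) n ε (fun t => FT2 (f t)) (fun t => f t) (cell ν z)) atTop
      (𝓝 (∫ ξ, chainInt orderKernel (cutData A ε (fun t => f t) z) n ξ)) := by
  choose g hg using fun t => exists_schwartz_eq_FT2 (f t)
  choose Cg hCg hgb using fun t => exists_le_planeDecay (g t)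
  choose Cf hCf hfb using fun t => exists_le_planeDecay (f t)
  have hI : 0 ≤ ∫ x, 9 * planeDecay x :=
    integral_nonneg fun x => mul_nonneg (by norm_num) (planeDecay_pos x).le
  let C : ℕ → ℝ := fun t => Cg t * 9 +
    Cf t * (∫ x, 9 * planeDecay x) * ((1 + (A : ℝ) ^ 2) ^ 2 * 9)
  have hC1 (t : ℕ) : 0 ≤ Cg t * 9 := mul_nonneg (hCg t).le (by norm_num)
  have hC2 (t : ℕ) : 0 ≤ Cf t * (∫ x, 9 * planeDecay x) := mul_nonneg (hCf t).le hI
  have hC (t : ℕ) : 0 ≤ C t := add_nonneg (hC1 t) (mul_nonneg (hC2 t) (by positivity))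
  let φs : ℕ → ℕ → ℝ × ℝ → ℂ := fun ν t x =>
    if cell ν x ∈ Finset.Icc (-((A * ν : ℕ) : ℤ)) (A * ν : ℕ) ×ˢ
        Finset.Icc (-((A * ν : ℕ) : ℤ)) (A * ν : ℕ) then
      gridCoeff ν (fun t => FT2 (f t)) (fun t => f t) t (cell ν x) *
        planeChar (gridPt ν (cell ν x)) ((ε t : ℝ) • gridPt ν (cell ν z)) else 0
  have hlim := tendsto_integral_chainInt (θs := cellKernel) (θ := orderKernel) (φs := φs)
    (φ := cutData A ε (fun t => f t) z) (C := C) stronglyMeasurable_cellKernel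
    (fun ν t => stronglyMeasurable_comp_cell ν fun k =>
      if k ∈ Finset.Icc (-((A * ν : ℕ) : ℤ)) (A * ν : ℕ) ×ˢ
        Finset.Icc (-((A * ν : ℕ) : ℤ)) (A * ν : ℕ) then
      gridCoeff ν (fun t => FT2 (f t)) (fun t => f t) t k *
        planeChar (gridPt ν k) ((ε t : ℝ) • gridPt ν (cell ν z)) else 0)
    hC norm_cellKernel_le ?_ tendsto_cellKernel (fun t x => ?_) n
  · refine hlim.congr' ?_
    filter_upwards [eventually_gt_atTop 0] with ν hν
    rw [gridOp_eq_integral hν]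
  · filter_upwards [eventually_gt_atTop 0] with ν hν t x
    have hw := planeDecay_pos x
    simp only [φs]
    split_ifs with hx
    · rw [norm_mul, norm_planeChar, mul_one, gridCoeff, add_mul]
      have h9 := planeDecay_gridPt_cell hν x
      split_ifs
      · refine le_add_of_le_of_nonneg ?_ (mul_nonneg (mul_nonneg (hC2 t) (by positivity)) hw.le)
        rw [← hg, mul_assoc]
        exact (hgb t _).trans (mul_le_mul_of_nonneg_left h9 (hCg t).le)
      · refine le_add_of_nonneg_of_le (mul_nonneg (hC1 t) hw.le) ?_
        refine (norm_gridFT_le (hCf t).le (hfb t) hν _).trans ?_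
        rw [mul_assoc (Cf t * _) _ (planeDecay x), mul_assoc (_ ^ 2) 9 (planeDecay x)]
        refine le_mul_of_one_le_right (hC2 t) ?_
        obtain ⟨h1, h2⟩ := abs_gridPt_le hν hx
        exact (inv_sq_le_planeDecay h1 h2).trans (mul_le_mul_of_nonneg_left h9 (by positivity))
    · rw [norm_zero]
      exact mul_nonneg (hC t) hw.le
  · have hco : Tendsto (fun ν => gridCoeff ν (fun t => FT2 (f t)) (fun t => f t) t (cell ν x))
        atTop (𝓝 (FT2 (f t) x)) := by
      unfold gridCoeff
      split_ifs
      · change Tendsto (fun ν => FT2 (f t) (gridPt ν (cell ν x))) _ _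
        rw [← hg]
        exact ((g t).continuous.tendsto x).comp (tendsto_gridPt_cell x)
      · exact tendsto_gridFT (f t) x
    have hpc : Tendsto (fun ν => planeChar (gridPt ν (cell ν x))
        ((ε t : ℝ) • gridPt ν (cell ν z))) atTop (𝓝 (planeChar x ((ε t : ℝ) • z))) :=
      tendsto_planeChar (tendsto_gridPt_cell x) ((tendsto_gridPt_cell z).const_smul _)
    have hev : ∀ᶠ ν : ℕ in atTop, cell ν x ∈ Finset.Icc (-((A * ν : ℕ) : ℤ)) (A * ν : ℕ) ×ˢ
        Finset.Icc (-((A * ν : ℕ) : ℤ)) (A * ν : ℕ) ↔ |x.1| ≤ A ∧ |x.2| ≤ A := by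
      filter_upwards [eventually_floor_mem_Icc_iff A x.1, eventually_floor_mem_Icc_iff A x.2]
        with ν h1 h2
      rw [Finset.mem_product, cell, h1, h2]
    unfold cutData
    split_ifs with hx
    · refine (hco.mul hpc).congr' ?_
      filter_upwards [hev] with ν h
      simp only [φs, if_pos (h.2 hx)]
    · refine tendsto_const_nhds.congr' ?_
      filter_upwards [hev] with ν h
      simp only [φs, if_neg (fun h' => hx (h.1 h'))]

end Operator

end Limits

section Bound

open Filter Topology
open scoped SchwartzMap

theorem Icc_prod_subset_gridBox {A ν : ℕ} (h : 2 * A < ν) :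
    Finset.Icc (-((A * ν : ℕ) : ℤ)) (A * ν : ℕ) ×ˢ Finset.Icc (-((A * ν : ℕ) : ℤ)) (A * ν : ℕ) ⊆
      gridBox ν := by
  have h1 : ((2 * (A * ν) : ℕ) : ℤ) < ((ν ^ 2 : ℕ) : ℤ) := by
    have : 2 * (A * ν) < ν ^ 2 := by nlinarith
    exact_mod_cast this
  intro k hk
  obtain ⟨hk1, hk2⟩ := Finset.mem_product.1 hk
  rw [Finset.mem_Icc] at hk1 hk2
  rw [mem_gridBox, Set.mem_Ioc, Set.mem_Ioc]
  generalize ν ^ 2 = u at *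
  generalize A * ν = v at *
  omega

/-- The norm of an input function: Wiener for even indices and Lebesgue for odd ones. -/
noncomputable def mixedNorm (a : ℕ → ℝ) (f : ℕ → ℝ × ℝ → ℂ) (t : ℕ) : ℝ :=
  if Even t then (eLpNorm (FT2 (f t)) (ENNReal.ofReal (1 - a t)⁻¹) volume).toReal
  else (eLpNorm (f t) (ENNReal.ofReal (a t)⁻¹) volume).toReal

/-- The norm of an input function on the full frequency grid. -/
noncomputable def boxNorm (ν : ℕ) (a : ℕ → ℝ) (g f : ℕ → ℝ × ℝ → ℂ) (t : ℕ) : ℝ :=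
  if Even t then
    (((ν : ℝ) ^ 2)⁻¹ * ∑ j ∈ gridBox ν, ‖g t (gridPt ν j)‖ ^ (1 - a t)⁻¹) ^ (1 - a t)
  else (((ν : ℝ) ^ 2)⁻¹ * ∑ j ∈ gridBox ν, ‖f t (gridPt ν j)‖ ^ (a t)⁻¹) ^ a t

theorem gridNorm_nonneg (ν K : ℕ) (a : ℕ → ℝ) (g f : ℕ → ℝ × ℝ → ℂ) (t : ℕ) :
    0 ≤ gridNorm ν K a g f t := by
  unfold gridNorm
  split_ifs <;> positivity

theorem gridNorm_le_boxNorm {A ν : ℕ} (h : 2 * A < ν) {a : ℕ → ℝ} (ha1 : ∀ t, a t < 1)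
    (g f : ℕ → ℝ × ℝ → ℂ) (t : ℕ) : gridNorm ν (A * ν) a g f t ≤ boxNorm ν a g f t := by
  unfold gridNorm boxNorm
  split_ifs
  · have := ha1 t
    refine Real.rpow_le_rpow (by positivity) ?_ (by linarith)
    refine mul_le_mul_of_nonneg_left ?_ (by positivity)
    exact Finset.sum_le_sum_of_subset_of_nonneg (Icc_prod_subset_gridBox h)
      fun _ _ _ => by positivity
  · exact le_rfl

theorem tendsto_boxNorm {a : ℕ → ℝ} (ha : ∀ t, 0 < a t) (ha1 : ∀ t, a t < 1)
    (f : ℕ → 𝓢(ℝ × ℝ, ℂ)) (t : ℕ) :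
    Tendsto (fun ν => boxNorm ν a (fun t => FT2 (f t)) (fun t => f t) t) atTop
      (𝓝 (mixedNorm a (fun t => f t) t)) := by
  unfold boxNorm mixedNorm
  split_ifs
  · obtain ⟨g, hg⟩ := exists_schwartz_eq_FT2 (f t)
    dsimp only
    rw [← hg]
    exact tendsto_gridLp g (by linarith [ha1 t]) (by linarith [ha t])
  · exact tendsto_gridLp (f t) (ha t) (ha1 t)

theorem exists_order_bound {n : ℕ} (hn : Even (n + 1)) {a : ℕ → ℝ} (ha : ∀ t, 0 < a t)
    (ha1 : ∀ t, a t < 1) (hev : ∀ t, Even t → a t < 1 / 2)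
    (hcond : ∀ i < n + 1, ∀ j < n + 1, Even i → j + 1 = i ∨ j = i + 1 → a i + 2 * a j < 3 / 2)
    {ε : ℕ → ℤ} (hε : ∀ t, ε t = 1 ∨ ε t = -1) : ∃ C, 0 < C ∧ ∀ f : ℕ → 𝓢(ℝ × ℝ, ℂ),
      eLpNorm (fun z => ∫ ξ, chainInt orderKernel (modData ε (fun t => f t) z) n ξ)
        (ENNReal.ofReal (∑ t ∈ Finset.range (n + 1), a t)⁻¹) volume ≤
      ENNReal.ofReal (C * ∏ t ∈ Finset.range (n + 1), mixedNorm a (fun t => f t) t) := by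
  obtain ⟨C, hC, c, h⟩ := exists_grid_bound hn ha ha1 hev hcond hε
  refine ⟨C, hC, fun f => ?_⟩
  have hα : 0 < ∑ t ∈ Finset.range (n + 1), a t :=
    Finset.sum_pos (fun t _ => ha t) Finset.nonempty_range_add_one
  have hcut (A : ℕ) (z : ℝ × ℝ) : Tendsto (fun ν => if cell ν z ∈ gridBox ν then
      gridOp ν (A * ν) n ε (fun t => FT2 (f t)) (fun t => f t) (cell ν z) else 0) atTop
        (𝓝 (∫ ξ, chainInt orderKernel (cutData A ε (fun t => f t) z) n ξ)) :=
    tendsto_ite_gridBox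
      (G := fun ν => gridOp ν (A * ν) n ε (fun t => FT2 (f t)) (fun t => f t))
      (tendsto_gridOp ε f A n z)
  have hmeas (A ν : ℕ) : AEStronglyMeasurable (fun z => if cell ν z ∈ gridBox ν then
      gridOp ν (A * ν) n ε (fun t => FT2 (f t)) (fun t => f t) (cell ν z) else 0) volume :=
    (stronglyMeasurable_comp_cell ν fun k => if k ∈ gridBox ν then
      gridOp ν (A * ν) n ε (fun t => FT2 (f t)) (fun t => f t) k else 0).aestronglyMeasurable
  obtain ⟨D, hD, hDb⟩ := exists_modData_bound ε f
  refine (Lp.eLpNorm_lim_le_liminf_eLpNorm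
    (f := fun A z => ∫ ξ, chainInt orderKernel (cutData A ε (fun t => f t) z) n ξ)
    (fun A => aestronglyMeasurable_of_tendsto_ae atTop (hmeas A) (.of_forall (hcut A))) _
    (.of_forall fun z => tendsto_integral_chainInt (fun _ => stronglyMeasurable_orderKernel)
      (fun A t => stronglyMeasurable_cutData ε f A z t) hD (fun _ => norm_orderKernel_le)
      (.of_forall fun A t x => (norm_cutData_le ε f A z t x).trans (hDb z t x))
      (fun _ _ => tendsto_const_nhds) (tendsto_cutData ε f z) n)).trans ?_
  refine (liminf_le_liminf (.of_forall fun A => ?_)).trans (liminf_const _).le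
  refine (Lp.eLpNorm_lim_le_liminf_eLpNorm (hmeas A) _ (.of_forall (hcut A))).trans ?_
  have hlim : Tendsto (fun ν => ENNReal.ofReal (C * ∏ t ∈ Finset.range (n + 1),
      boxNorm ν a (fun t => FT2 (f t)) (fun t => f t) t)) atTop
        (𝓝 (ENNReal.ofReal (C * ∏ t ∈ Finset.range (n + 1), mixedNorm a (fun t => f t) t))) :=
    ENNReal.tendsto_ofReal ((tendsto_finsetProd _ fun t _ => tendsto_boxNorm ha ha1 f t).const_mul C)
  rw [← hlim.liminf_eq]
  refine liminf_le_liminf ?_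
  filter_upwards [eventually_gt_atTop (2 * A), eventually_gt_atTop (c * (A + 1))] with ν hν hν'
  have hν0 : 0 < ν := by omega
  have hK : c * (A * ν + 1) < ν ^ 2 := by
    calc c * (A * ν + 1) ≤ c * (A + 1) * ν := by
          rw [mul_assoc]; exact Nat.mul_le_mul_left c (by rw [add_mul, one_mul]; omega)
      _ < ν * ν := Nat.mul_lt_mul_of_pos_right hν' hν0
      _ = ν ^ 2 := (sq ν).symm
  rw [eLpNorm_comp_cell hν0 (S := gridBox ν) (G := fun k => if k ∈ gridBox ν then
    gridOp ν (A * ν) n ε (fun t => FT2 (f t)) (fun t => f t) k else 0)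
    (fun k hk => if_neg hk) hα]
  refine ENNReal.ofReal_le_ofReal ?_
  rw [Finset.sum_congr rfl fun k hk => by rw [if_pos hk]]
  refine (h ν (A * ν) hK _ _).trans (mul_le_mul_of_nonneg_left ?_ hC.le)
  exact Finset.prod_le_prod (fun t _ => gridNorm_nonneg _ _ _ _ _ t)
    fun t _ => gridNorm_le_boxNorm hν ha1 _ _ t

end Bound

section Identification

theorem CopT_eq_integral {n : ℕ} (ε : Fin (n + 1) → ℝ) (ε' : ℕ → ℤ)
    (hε : ∀ i : Fin (n + 1), (ε' i : ℝ) = ε i) (f : Fin (n + 1) → SchwartzMap (ℝ × ℝ) ℂ)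
    (F : ℕ → SchwartzMap (ℝ × ℝ) ℂ) (hF : ∀ i : Fin (n + 1), F i = f i) (z : ℝ × ℝ) :
    CopT (n + 1) ε (fun i => f i) z =
      ∫ ξ, chainInt orderKernel (modData ε' (fun t => F t) z) n ξ := by
  obtain ⟨D, hD, hDb⟩ := exists_modData_bound ε' F
  have h := integral_tupleFun (φ := modData ε' (fun t => F t) z) (C := D)
    (stronglyMeasurable_modData ε' F z) (hDb z) n (h := fun _ => 1) stronglyMeasurable_const
    (fun _ => by simp)
  simp only [one_mul] at h
  have hm : MeasurableSet {t : (Fin (n + 1) → ℝ) × (Fin (n + 1) → ℝ) |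
      StrictMono t.1 ∧ StrictMono t.2} :=
    measurableSet_biStrictMono n |> (MeasurableEquiv.arrowProdEquivProdArrow ℝ ℝ
      (Fin (n + 1))).symm.measurable
  rw [← h, CopT, ← integral_indicator hm,
    ← (volume_measurePreserving_arrowProdEquivProdArrow ℝ ℝ (Fin (n + 1))).integral_comp']
  refine integral_congr_ae (.of_forall fun x => ?_)
  simp only [tupleFun, mul_one]
  refine Set.indicator_eq_indicator Iff.rfl ?_
  simp only [modData, Finset.prod_mul_distrib, hF, planeChar, ← Complex.exp_sum]
  congr 2
  simp only [← Finset.mul_sum, Finset.sum_add_distrib, ← hε]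
  push_cast
  rw [Finset.mul_sum, Finset.mul_sum]
  congr 2 <;> refine Finset.sum_congr rfl fun i _ => ?_
  · change (z.1 : ℂ) * (_ * ((x i).1 : ℂ)) = _
    rw [Prod.smul_fst, smul_eq_mul]
    push_cast
    ring
  · change (z.2 : ℂ) * (_ * ((x i).2 : ℂ)) = _
    rw [Prod.smul_snd, smul_eq_mul]
    push_cast
    ring

end Identification

/-- mixed estimates for `C_N^ε ⊗ C_N^ε`.  Indices are `0`-based, so
the paper's odd indices (Wiener spaces `W_{p_i}[W_{p_i}]`) are those with
`(i : ℕ) % 2 = 0` and the paper's even ones (Lebesgue spaces) have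
`(i : ℕ) % 2 = 1`. -/
theorem stmt16 (N : ℕ) (hN : 2 ≤ N) (hNeven : Even N) (ε : Fin N → ℝ)
    (hε : ∀ i, ε i = 1 ∨ ε i = -1) (p : Fin N → ℝ) (hp : ∀ i, 1 < p i)
    (hodd : ∀ i : Fin N, (i : ℕ) % 2 = 0 → 2 < p i)
    (hcond : ∀ i j : Fin N, (i : ℕ) % 2 = 0 →
      ((j : ℕ) + 1 = (i : ℕ) ∨ (j : ℕ) = (i : ℕ) + 1) →
      1 / p i + 2 / p j < 3 / 2) :
    ∃ C : ℝ, 0 < C ∧ ∀ f : Fin N → SchwartzMap (ℝ × ℝ) ℂ,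
      eLpNorm (CopT N ε (fun i => ⇑(f i)))
          (ENNReal.ofReal (1 / ∑ i, 1 / p i)) volume ≤
        ENNReal.ofReal C *
          ∏ i : Fin N, (if (i : ℕ) % 2 = 0 then
              eLpNorm (FT2 ⇑(f i)) (ENNReal.ofReal (p i / (p i - 1))) volume
            else eLpNorm ⇑(f i) (ENNReal.ofReal (p i)) volume) := by
  obtain ⟨n, rfl⟩ : ∃ n, N = n + 1 := ⟨N - 1, by omega⟩
  let a : ℕ → ℝ := fun t => if h : t < n + 1 then (p ⟨t, h⟩)⁻¹ else 1 / 4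
  let ε' : ℕ → ℤ := fun t => if h : t < n + 1 then if ε ⟨t, h⟩ = 1 then 1 else -1 else 1
  have hai (i : Fin (n + 1)) : a i = (p i)⁻¹ := dif_pos i.is_lt
  have hεi (i : Fin (n + 1)) : (ε' i : ℝ) = ε i := by
    simp only [ε', Fin.is_lt, dif_pos, Fin.eta]
    rcases hε i with h | h
    · simp [h]
    · simp only [h]; norm_num
  have ha (t : ℕ) : 0 < a t := by
    by_cases h : t < n + 1
    · exact (hai ⟨t, h⟩).symm ▸ inv_pos.2 (one_pos.trans (hp _))
    · simp only [a, dif_neg h]; norm_num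
  have ha1 (t : ℕ) : a t < 1 := by
    by_cases h : t < n + 1
    · exact (hai ⟨t, h⟩).symm ▸ inv_lt_one_of_one_lt₀ (hp _)
    · simp only [a, dif_neg h]; norm_num
  have hev (t : ℕ) (ht : Even t) : a t < 1 / 2 := by
    by_cases h : t < n + 1
    · rw [hai ⟨t, h⟩, one_div]
      exact inv_strictAnti₀ two_pos (hodd ⟨t, h⟩ (Nat.even_iff.1 ht))
    · simp only [a, dif_neg h]; norm_num
  have hcond' (i : ℕ) (hi : i < n + 1) (j : ℕ) (hj : j < n + 1) (hie : Even i)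
      (hij : j + 1 = i ∨ j = i + 1) : a i + 2 * a j < 3 / 2 := by
    rw [hai ⟨i, hi⟩, hai ⟨j, hj⟩, ← one_div, ← div_eq_mul_inv]
    exact hcond ⟨i, hi⟩ ⟨j, hj⟩ (Nat.even_iff.1 hie) hij
  have hε' (t : ℕ) : ε' t = 1 ∨ ε' t = -1 := by
    simp only [ε']
    split_ifs <;> simp
  obtain ⟨C, hC, h⟩ := exists_order_bound hNeven ha ha1 hev hcond' hε'
  refine ⟨C, hC, fun f => ?_⟩
  let F : ℕ → SchwartzMap (ℝ × ℝ) ℂ := fun t => if h : t < n + 1 then f ⟨t, h⟩ else 0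
  have hF (i : Fin (n + 1)) : F i = f i := dif_pos i.is_lt
  have hmain := h F
  rw [← funext (CopT_eq_integral ε ε' hεi f F hF), Finset.sum_range, Finset.prod_range,
    ENNReal.ofReal_mul hC.le, ENNReal.ofReal_prod_of_nonneg fun i _ => by
      unfold mixedNorm; split_ifs <;> exact ENNReal.toReal_nonneg] at hmain
  simp only [hai, mixedNorm, hF] at hmain
  simp only [one_div]
  refine hmain.trans (mul_le_mul_right (Finset.prod_le_prod' fun i _ => ?_) _)
  have hpi := hp i
  have hq : (1 - (p i)⁻¹)⁻¹ = p i / (p i - 1) := by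
    have h0 : p i ≠ 0 := by positivity
    rw [← inv_div, sub_div, div_self h0, one_div]
  rw [hq, inv_inv]
  simp only [Nat.even_iff]
  split_ifs <;> exact ENNReal.ofReal_toReal_le
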